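/- For every a ∈ ℂ and every function μ : [2,∞) → (0,∞) with μ(T) → ∞ as T → ∞, there exist C > 0 and T_0 ≥ 16 such that for all T ≥ T_0 the set {ρ ∈ ℂ : ζ(ρ) = a, T < Im(ρ) ≤ 2T, and |Re(ρ) − 1/2| ≥ μ(T)·√(log log T)/log T} is finite and has at most C·T·log T/μ(T) elements. -/

import Mathlib

namespace ZA
open Complex MeasureTheory Set Filter Topology

theorem jensen_sum {G : ℂ → ℂ} {c : ℂ} {r : ℝ} (hr : 0 < r)
    (hGa0 : AnalyticOnNhd ℂ G (Metric.closedBall c r)) (hGc0 : G c ≠ 0) (Z : Finset ℂ)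
    (hZ : ∀ u ∈ Z, u ∈ Metric.closedBall c r ∧ G u = 0) :
    ∑ u ∈ Z, Real.log (r * ‖c - u‖⁻¹) + Real.log ‖G c‖ ≤
      Real.circleAverage (fun z => Real.log ‖G z‖) c r := by
  have hGa : AnalyticOnNhd ℂ G (Metric.closedBall c |r|) := by rwa [abs_of_pos hr]
  have J := hGa.circleAverage_log_norm hr.ne' hGc0
  rw [J]
  set D : ℂ → ℝ := fun u => (MeromorphicOn.divisor G (Metric.closedBall c |r|) u : ℝ)
      * Real.log (r * ‖c - u‖⁻¹) with hD
  have hlog : ∀ u ∈ Metric.closedBall c |r|, u ≠ c → 0 ≤ Real.log (r * ‖c - u‖⁻¹) := by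
    intro u h1 hu
    apply Real.log_nonneg
    rw [abs_of_pos hr, Metric.mem_closedBall, dist_eq_norm'] at h1
    have : 0 < ‖c - u‖ := norm_pos_iff.mpr (sub_ne_zero.mpr (Ne.symm hu))
    rw [← div_eq_mul_inv, one_le_div this]
    exact h1
  have hD0 : ∀ u, 0 ≤ D u := by
    intro u
    by_cases h1 : u ∈ Metric.closedBall c |r|
    · by_cases hu : u = c
      · simp only [hD]
        rw [hu, MeromorphicOn.AnalyticOnNhd.divisor_apply hGa (by simp),
          (hGa c (by simp)).analyticOrderAt_eq_zero.mpr hGc0]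
        simp
      · exact mul_nonneg (mod_cast MeromorphicOn.AnalyticOnNhd.divisor_nonneg hGa ..) (hlog u h1 hu)
    · simp [hD, h1]
  have hfin : (Function.support D).Finite :=
    ((MeromorphicOn.divisor G (Metric.closedBall c |r|)).finiteSupport
      (isCompact_closedBall ..)).subset fun u hu => by
        simp only [hD, Function.mem_support, ne_eq, mul_eq_zero, not_or] at hu ⊢
        exact_mod_cast hu.1
  have h1 : ∑ u ∈ Z, Real.log (r * ‖c - u‖⁻¹) ≤ ∑ u ∈ Z, D u := by
    apply Finset.sum_le_sum
    intro u hu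
    obtain ⟨hu1, hu2⟩ := hZ u hu
    have hu1' : u ∈ Metric.closedBall c |r| := by rwa [abs_of_pos hr]
    have huc : u ≠ c := fun h => hGc0 (h ▸ hu2)
    have hl := hlog u hu1' huc
    have hdiv : (1 : ℝ) ≤ (MeromorphicOn.divisor G (Metric.closedBall c |r|) u : ℝ) := by
      rw [MeromorphicOn.AnalyticOnNhd.divisor_apply hGa hu1']
      have hne : analyticOrderAt G u ≠ 0 := by
        rw [Ne, (hGa u hu1').analyticOrderAt_eq_zero]; simpa using hu2
      have hnt : analyticOrderAt G u ≠ ⊤ := by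
        intro htop
        rw [analyticOrderAt_eq_top] at htop
        have := hGa.eqOn_zero_of_preconnected_of_eventuallyEq_zero
          (convex_closedBall c |r|).isPreconnected hu1' htop
        exact hGc0 (this (by simp))
      obtain ⟨n, hn⟩ := ENat.ne_top_iff_exists.mp hnt
      rw [← hn] at hne ⊢
      have hn0 : n ≠ 0 := by exact_mod_cast hne
      have : 1 ≤ n := Nat.one_le_iff_ne_zero.mpr hn0
      simpa using this
    calc Real.log (r * ‖c - u‖⁻¹) = 1 * Real.log (r * ‖c - u‖⁻¹) := (one_mul _).symm
      _ ≤ D u := mul_le_mul_of_nonneg_right hdiv hl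
  have h2 : ∑ u ∈ Z, D u ≤ ∑ᶠ u, D u := by
    rw [finsum_eq_sum_of_support_subset D (s := Z ∪ hfin.toFinset) (by
      intro x hx; simp; right; exact hx)]
    exact Finset.sum_le_sum_of_subset_of_nonneg Finset.subset_union_left (fun _ _ _ => hD0 _)
  linarith

theorem submean {H : ℂ → ℂ} {c : ℂ} {r p : ℝ} (hr : 0 < r) (hp : 0 < p)
    (hH : AnalyticOnNhd ℂ H (Metric.closedBall c r)) :
    ‖H c‖ ^ p ≤ Real.circleAverage (fun z => ‖H z‖ ^ p) c r := by
  by_cases h0 : H c = 0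
  · rw [h0, norm_zero, Real.zero_rpow hp.ne']
    exact Real.circleAverage_nonneg_of_nonneg (fun x _ => by positivity)
  have hn : 0 < ‖H c‖ := norm_pos_iff.mpr h0
  -- scaling constant
  set κ : ℝ := Real.exp (1 / p) / ‖H c‖ with hκ
  have hκ0 : 0 < κ := by positivity
  set G : ℂ → ℂ := fun z => (κ : ℂ) * H z with hG
  have hGa : AnalyticOnNhd ℂ G (Metric.closedBall c |r|) := by
    rw [abs_of_pos hr]
    exact analyticOnNhd_const.mul hH
  have hGa' : AnalyticOnNhd ℂ G (Metric.closedBall c r) := analyticOnNhd_const.mul hH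
  have hGn : ∀ z, ‖G z‖ = κ * ‖H z‖ := fun z => by
    simp [hG, abs_of_pos hκ0]
  have hGc : ‖G c‖ = Real.exp (1 / p) := by
    rw [hGn, hκ]; field_simp
  have hGc0 : G c ≠ 0 := by
    rw [← norm_pos_iff, hGc]; positivity
  have J := jensen_sum hr hGa' hGc0 ∅ (by simp)
  simp only [Finset.sum_empty] at J
  rw [hGc, Real.log_exp] at J
  have hsph : Metric.sphere c |r| ⊆ Metric.closedBall c |r| := Metric.sphere_subset_closedBall
  have hIntg : CircleIntegrable (fun z => ‖H z‖ ^ p) c r := by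
    apply ContinuousOn.circleIntegrable hr.le
    refine ContinuousOn.rpow_const ?_ (fun x _ => Or.inr hp.le)
    exact (hH.continuousOn.mono Metric.sphere_subset_closedBall).norm
  have hIntg1 : CircleIntegrable (fun z => Real.log ‖G z‖) c r :=
    (hGa.mono hsph).meromorphicOn.circleIntegrable_log_norm
  have key : Real.circleAverage (fun z => Real.log ‖G z‖) c r ≤
      Real.circleAverage (fun z => (κ ^ p / (p * Real.exp 1)) • ‖H z‖ ^ p) c r := by
    refine Real.circleAverage_mono hIntg1 (hIntg.const_smul) ?_
    intro z _
    rw [smul_eq_mul]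
    rcases eq_or_lt_of_le (norm_nonneg (G z)) with h | h
    · rw [← h]; simp; positivity
    · have h1 : Real.log (‖G z‖ ^ p / Real.exp 1) ≤ ‖G z‖ ^ p / Real.exp 1 - 1 :=
        Real.log_le_sub_one_of_pos (by positivity)
      rw [Real.log_div (by positivity) (by positivity), Real.log_exp, Real.log_rpow h] at h1
      have h2 : ‖G z‖ ^ p = κ ^ p * ‖H z‖ ^ p := by
        rw [hGn, Real.mul_rpow hκ0.le (norm_nonneg _)]
      rw [h2] at h1
      have h3 : p * Real.log ‖G z‖ ≤ κ ^ p * ‖H z‖ ^ p / Real.exp 1 := by linarith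
      calc Real.log ‖G z‖ = (p * Real.log ‖G z‖) / p := by field_simp
        _ ≤ (κ ^ p * ‖H z‖ ^ p / Real.exp 1) / p := by gcongr
        _ = _ := by field_simp
  rw [Real.circleAverage_fun_smul, smul_eq_mul] at key
  have h4 : κ ^ p = Real.exp 1 / ‖H c‖ ^ p := by
    rw [hκ, Real.div_rpow (by positivity) hn.le, ← Real.exp_mul]
    congr 2; field_simp
  have hcp : 0 < ‖H c‖ ^ p := by positivity
  rw [h4] at key
  have h5 : 1 / p ≤ (Real.exp 1 / ‖H c‖ ^ p / (p * Real.exp 1)) *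
      Real.circleAverage (fun z => ‖H z‖ ^ p) c r := by linarith
  have h6 : (Real.exp 1 / ‖H c‖ ^ p / (p * Real.exp 1)) *
      Real.circleAverage (fun z => ‖H z‖ ^ p) c r = (1/p) * (Real.circleAverage (fun z => ‖H z‖ ^ p) c r / ‖H c‖ ^ p) := by
    field_simp
  rw [h6] at h5
  have h7 : 1 ≤ Real.circleAverage (fun z => ‖H z‖ ^ p) c r / ‖H c‖ ^ p := by
    have : 0 < 1 / p := by positivity
    nlinarith
  rwa [one_le_div hcp] at h7

end ZA

namespace ZA
open Complex MeasureTheory Set Filter Topology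

/-- Gaussian-weighted `p`-th moment on a vertical line. -/
noncomputable def MM (p T : ℝ) (h : ℂ → ℂ) (σ : ℝ) : ℝ :=
  ∫ t : ℝ, ‖h (σ + t * I)‖ ^ p * Real.exp (-(t / T) ^ 2)

theorem re_mk' (x y : ℝ) : ((x : ℂ) + (y : ℂ) * I).re = x := by simp
theorem im_mk' (x y : ℝ) : ((x : ℂ) + (y : ℂ) * I).im = y := by simp

theorem integrable_gauss {b : ℝ} (hb : 0 < b) :
    Integrable (fun t : ℝ => (1 + |t|) * Real.exp (-b * t ^ 2)) := by
  have h1 := integrable_exp_neg_mul_sq hb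
  have h2 := (integrable_mul_exp_neg_mul_sq hb).norm
  refine (h1.add h2).congr ?_
  filter_upwards with t
  simp
  ring

theorem integrable_gauss' {T : ℝ} (hT : 0 < T) :
    Integrable (fun t : ℝ => (1 + |t|) * Real.exp (-(t / T) ^ 2)) := by
  have := integrable_gauss (b := 1 / T ^ 2) (by positivity)
  refine this.congr ?_
  filter_upwards with t
  congr 2
  field_simp

theorem rpow_bound {x C t p : ℝ} (hx : 0 ≤ x) (hC : 1 ≤ C) (hp : 0 < p) (hp1 : p ≤ 1)
    (h : x ≤ C * (1 + |t|)) : x ^ p ≤ C * (1 + |t|) := by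
  have h1 : (1 : ℝ) ≤ C * (1 + |t|) := by nlinarith [abs_nonneg t]
  calc x ^ p ≤ (C * (1 + |t|)) ^ p := by gcongr
    _ ≤ (C * (1 + |t|)) ^ (1:ℝ) := Real.rpow_le_rpow_of_exponent_le h1 hp1
    _ = _ := Real.rpow_one _

theorem MM_integrable {p T C σ : ℝ} {h : ℂ → ℂ} (hp : 0 < p) (hp1 : p ≤ 1) (hT : 0 < T)
    (hC : 1 ≤ C) (hc : Continuous (fun t : ℝ => h (σ + t * I)))
    (hb : ∀ t : ℝ, ‖h (σ + t * I)‖ ≤ C * (1 + |t|)) :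
    Integrable (fun t : ℝ => ‖h (σ + t * I)‖ ^ p * Real.exp (-(t / T) ^ 2)) := by
  refine ((integrable_gauss' hT).const_mul C).mono' ?_ ?_
  · refine Continuous.aestronglyMeasurable ?_
    refine Continuous.mul (Continuous.rpow_const hc.norm (fun _ => Or.inr hp.le)) (by fun_prop)
  · filter_upwards with t
    rw [Real.norm_of_nonneg (by positivity), ← mul_assoc]
    gcongr
    exact rpow_bound (norm_nonneg _) hC hp hp1 (hb t)

theorem MM_nonneg (p T : ℝ) (h : ℂ → ℂ) (σ : ℝ) : 0 ≤ MM p T h σ :=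
  integral_nonneg fun t => by positivity

theorem one_dim_max {a b : ℝ} (hab : a ≤ b) {V : ℝ → ℝ} (hV : ContinuousOn V (Icc a b))
    (hsub : ∀ x ∈ Ioo a b, ∃ r > 0, (∀ θ : ℝ, x + r * Real.cos θ ∈ Icc a b) ∧
      V x ≤ (2 * Real.pi)⁻¹ * ∫ θ in (0:ℝ)..2 * Real.pi, V (x + r * Real.cos θ)) :
    ∀ x ∈ Icc a b, V x ≤ max (V a) (V b) := by
  intro x hx
  by_contra hcon
  push Not at hcon
  obtain ⟨ε, hε, hε2⟩ : ∃ ε > 0, ε * (a ^ 2 + b ^ 2) < V x - max (V a) (V b) := by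
    refine ⟨(V x - max (V a) (V b)) / (2 * (a ^ 2 + b ^ 2 + 1)), by
      apply div_pos (by linarith); positivity, ?_⟩
    rw [div_mul_eq_mul_div, div_lt_iff₀ (by positivity)]
    nlinarith [sq_nonneg a, sq_nonneg b]
  have hW : ContinuousOn (fun y => V y + ε * y ^ 2) (Icc a b) := hV.add (by fun_prop)
  obtain ⟨y, hy, hmax⟩ := isCompact_Icc.exists_isMaxOn (nonempty_Icc.mpr hab) hW
  have hmax' : ∀ z ∈ Icc a b, V z + ε * z ^ 2 ≤ V y + ε * y ^ 2 := fun z hz => hmax hz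
  have hyx := hmax' x hx
  have hya : y ≠ a := by
    rintro rfl
    nlinarith [le_max_left (V y) (V b), sq_nonneg b, sq_nonneg x, mul_nonneg hε.le (sq_nonneg b),
      mul_nonneg hε.le (sq_nonneg x)]
  have hyb : y ≠ b := by
    rintro rfl
    nlinarith [le_max_right (V a) (V y), mul_nonneg hε.le (sq_nonneg a),
      mul_nonneg hε.le (sq_nonneg x)]
  obtain ⟨r, hr, hmem, hle⟩ := hsub y ⟨lt_of_le_of_ne hy.1 (Ne.symm hya), lt_of_le_of_ne hy.2 hyb⟩
  have hcont : Continuous (fun θ : ℝ => V (y + r * Real.cos θ)) :=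
    hV.comp_continuous (by fun_prop) hmem
  have hI : ∫ θ in (0:ℝ)..2 * Real.pi, V (y + r * Real.cos θ) ≤
      ∫ θ in (0:ℝ)..2 * Real.pi, ((V y - ε * (2 * y * r) * Real.cos θ) - ε * r ^ 2 * Real.cos θ ^ 2) := by
    apply intervalIntegral.integral_mono_on (by positivity) (hcont.intervalIntegrable _ _)
    · apply Continuous.intervalIntegrable; fun_prop
    · intro θ _
      have := hmax' _ (hmem θ)
      nlinarith
  rw [intervalIntegral.integral_sub (by apply Continuous.intervalIntegrable; fun_prop)
    (by apply Continuous.intervalIntegrable; fun_prop),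
    intervalIntegral.integral_sub (by apply Continuous.intervalIntegrable; fun_prop)
    (by apply Continuous.intervalIntegrable; fun_prop),
    intervalIntegral.integral_const_mul, intervalIntegral.integral_const_mul, integral_cos,
    integral_cos_sq] at hI
  simp at hI
  have hpi := Real.pi_pos
  have h2 : V y ≤ (2 * Real.pi)⁻¹ * (2 * Real.pi * V y - ε * r ^ 2 * Real.pi) := by
    refine hle.trans ?_
    gcongr
  have h3 : (2 * Real.pi)⁻¹ * (2 * Real.pi * V y - ε * r ^ 2 * Real.pi) = V y - ε * r ^ 2 / 2 := by
    field_simp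
  rw [h3] at h2
  have : 0 < ε * r ^ 2 := by positivity
  linarith

theorem MM_max {p T C a b lam : ℝ} {h : ℂ → ℂ} (hp : 0 < p) (hp1 : p ≤ 1) (hT : 10 ≤ T)
    (hC : 1 ≤ C) (hab : a ≤ b) (ha : |a| ≤ 5) (hb : |b| ≤ 5)
    (hh : AnalyticOnNhd ℂ h {s : ℂ | a ≤ s.re ∧ s.re ≤ b})
    (hbd : ∀ s : ℂ, a ≤ s.re → s.re ≤ b → ‖h s‖ ≤ C * (1 + |s.im|)) (σ : ℝ) (hσ : σ ∈ Icc a b) :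
    MM p T h σ ≤ 2 * max (Real.exp (lam * (a - σ)) * MM p T h a)
      (Real.exp (lam * (b - σ)) * MM p T h b) := by
  have hT0 : 0 < T := by linarith
  set H : ℂ → ℂ := fun s => h s * exp (s ^ 2 / (p * T ^ 2)) * exp (lam * s / p) with hH
  have hHan : AnalyticOnNhd ℂ H {s : ℂ | a ≤ s.re ∧ s.re ≤ b} := by
    refine (hh.mul ?_).mul ?_
    · intro x _
      have : Differentiable ℂ (fun s : ℂ => exp (s ^ 2 / (p * T ^ 2))) := by fun_prop
      exact this.analyticAt x
    · intro x _
      have : Differentiable ℂ (fun s : ℂ => exp (lam * s / p)) := by fun_prop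
      exact this.analyticAt x
  have hHn : ∀ s : ℂ, ‖H s‖ ^ p = ‖h s‖ ^ p * Real.exp (-(s.im / T) ^ 2) *
      Real.exp (s.re ^ 2 / T ^ 2 + lam * s.re) := by
    intro s
    have e1 : (s ^ 2 / (p * T ^ 2) : ℂ).re = (s.re ^ 2 - s.im ^ 2) / (p * T ^ 2) := by
      have : (s ^ 2 / (p * T ^ 2) : ℂ) = s ^ 2 / ((p * T ^ 2 : ℝ) : ℂ) := by push_cast; rfl
      rw [this, Complex.div_ofReal_re, sq s, Complex.mul_re]; ring
    have e2 : (lam * s / p : ℂ).re = lam * s.re / p := by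
      rw [Complex.div_ofReal_re, Complex.re_ofReal_mul]
    rw [hH]
    simp only [norm_mul, Complex.norm_exp]
    rw [Real.mul_rpow (by positivity) (by positivity), Real.mul_rpow (by positivity) (by positivity),
      ← Real.exp_mul, ← Real.exp_mul, e1, e2, mul_assoc, mul_assoc, ← Real.exp_add, ← Real.exp_add]
    congr 2
    field_simp
    ring
  set V : ℝ → ℝ := fun x => ∫ t : ℝ, ‖H (x + t * I)‖ ^ p with hVdef
  have hVM : ∀ x, V x = MM p T h x * Real.exp (x ^ 2 / T ^ 2 + lam * x) := by
    intro x
    simp only [hVdef, MM]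
    rw [← integral_mul_const]
    congr 1
    ext t
    rw [hHn]
    simp
  -- uniform bound for H
  have hKex : ∃ K, 0 ≤ K ∧ ∀ x ∈ Icc a b, C * Real.exp (x ^ 2 / T ^ 2 + lam * x) ≤ K := by
    have : ContinuousOn (fun x : ℝ => C * Real.exp (x ^ 2 / T ^ 2 + lam * x)) (Icc a b) := by fun_prop
    obtain ⟨K, hK⟩ := isCompact_Icc.exists_bound_of_continuousOn this
    refine ⟨max K 0, le_max_right _ _, fun x hx => ?_⟩
    exact (Real.le_norm_self _).trans ((hK x hx).trans (le_max_left _ _))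
  obtain ⟨K, hK0, hK⟩ := hKex
  have hHbd : ∀ s : ℂ, a ≤ s.re → s.re ≤ b →
      ‖H s‖ ^ p ≤ K * ((1 + |s.im|) * Real.exp (-(s.im / T) ^ 2)) := by
    intro s h1 h2
    rw [hHn]
    calc _ ≤ (C * (1 + |s.im|)) * Real.exp (-(s.im / T) ^ 2) *
      Real.exp (s.re ^ 2 / T ^ 2 + lam * s.re) := by
          gcongr
          exact rpow_bound (norm_nonneg _) hC hp hp1 (hbd s h1 h2)
      _ = (C * Real.exp (s.re ^ 2 / T ^ 2 + lam * s.re)) * ((1 + |s.im|) * Real.exp (-(s.im / T) ^ 2)) := by ring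
      _ ≤ _ := by
          gcongr
          exact hK _ ⟨h1, h2⟩
  have hHc : ContinuousOn (fun s => ‖H s‖ ^ p) {s : ℂ | a ≤ s.re ∧ s.re ≤ b} :=
    ContinuousOn.rpow_const hHan.continuousOn.norm (fun _ _ => Or.inr hp.le)
  have hVc : ContinuousOn V (Icc a b) := by
    refine continuousOn_of_dominated (bound := fun t => K * ((1 + |t|) * Real.exp (-(t / T) ^ 2))) ?_ ?_ ?_ ?_
    · intro x hx
      refine Continuous.aestronglyMeasurable ?_
      exact hHc.comp_continuous (by fun_prop) (fun t => by simpa using hx)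
    · intro x hx
      filter_upwards with t
      rw [Real.norm_of_nonneg (by positivity)]
      have := hHbd (x + t * I) (by simpa using hx.1) (by simpa using hx.2)
      simpa using this
    · exact (integrable_gauss' hT0).const_mul K
    · filter_upwards with t
      exact hHc.comp (by fun_prop) (fun x hx => by simpa using hx)
  have hmain := one_dim_max hab hVc (by
    intro x hx
    obtain ⟨hx1, hx2⟩ := hx
    set r := min (min (x - a) (b - x)) 1 with hr
    have hr0 : 0 < r := by
      simp only [hr, lt_min_iff]; exact ⟨⟨by linarith, by linarith⟩, by norm_num⟩
    have hra : r ≤ x - a := (min_le_left _ _).trans (min_le_left _ _)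
    have hrb : r ≤ b - x := (min_le_left _ _).trans (min_le_right _ _)
    have hr1 : r ≤ 1 := min_le_right _ _
    have hmem : ∀ θ : ℝ, x + r * Real.cos θ ∈ Icc a b := by
      intro θ
      have h1 := Real.cos_le_one θ
      have h2 := Real.neg_one_le_cos θ
      constructor <;> nlinarith
    refine ⟨r, hr0, hmem, ?_⟩
    -- the circle points
    have hcm : ∀ t θ : ℝ, circleMap (x + t * I) r θ =
        ((x + r * Real.cos θ : ℝ) : ℂ) + ((t + r * Real.sin θ : ℝ) : ℂ) * I := by
      intro t θ
      rw [circleMap, Complex.exp_mul_I]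
      push_cast
      ring
    have hcont2 : Continuous (fun q : ℝ × ℝ => ‖H (((x + r * Real.cos q.2 : ℝ) : ℂ) +
        ((q.1 + r * Real.sin q.2 : ℝ) : ℂ) * I)‖ ^ p) :=
      hHc.comp_continuous (f := fun q : ℝ × ℝ => ((x + r * Real.cos q.2 : ℝ) : ℂ) +
        ((q.1 + r * Real.sin q.2 : ℝ) : ℂ) * I) (by fun_prop) (fun q => by
          have := hmem q.2
          simp only [mem_setOf_eq, re_mk']
          exact this)
    have hIntg2 : Integrable (fun q : ℝ × ℝ => ‖H (((x + r * Real.cos q.2 : ℝ) : ℂ) +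
        ((q.1 + r * Real.sin q.2 : ℝ) : ℂ) * I)‖ ^ p)
        (volume.prod (volume.restrict (Ioc 0 (2 * Real.pi)))) := by
      have hg := (((integrable_gauss (b := 1 / (2 * T ^ 2)) (by positivity)).const_mul
        (K * 2 * Real.exp (1 / T ^ 2))).comp_fst (volume.restrict (Ioc 0 (2 * Real.pi))))
      refine hg.mono' hcont2.aestronglyMeasurable ?_
      filter_upwards with q
      rw [Real.norm_of_nonneg (by positivity)]
      have hm := hmem q.2
      have := hHbd (((x + r * Real.cos q.2 : ℝ) : ℂ) +
        ((q.1 + r * Real.sin q.2 : ℝ) : ℂ) * I) (by rw [re_mk']; exact hm.1) (by rw [re_mk']; exact hm.2)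
      refine this.trans ?_
      have him : (((x + r * Real.cos q.2 : ℝ) : ℂ) +
        ((q.1 + r * Real.sin q.2 : ℝ) : ℂ) * I).im = q.1 + r * Real.sin q.2 := im_mk' _ _
      rw [him]
      set y := r * Real.sin q.2 with hy
      have hy1 : |y| ≤ 1 := by
        rw [hy, abs_mul, abs_of_pos hr0]
        have := Real.abs_sin_le_one q.2
        nlinarith [abs_nonneg (Real.sin q.2)]
      have e1 : 1 + |q.1 + y| ≤ 2 * (1 + |q.1|) := by
        have := abs_add_le q.1 y
        have := abs_nonneg q.1
        linarith
      have e2 : Real.exp (-((q.1 + y) / T) ^ 2) ≤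
          Real.exp (1 / T ^ 2) * Real.exp (-(1 / (2 * T ^ 2)) * q.1 ^ 2) := by
        rw [← Real.exp_add]
        apply Real.exp_le_exp.mpr
        rw [div_pow]
        have : y ^ 2 ≤ 1 := by rw [← sq_abs]; nlinarith [abs_nonneg y]
        have h3 : 1 / T ^ 2 + -(1 / (2 * T ^ 2)) * q.1 ^ 2 = -((q.1 ^ 2 / 2 - 1) / T ^ 2) := by
          field_simp; ring
        rw [h3]
        apply neg_le_neg
        gcongr
        nlinarith [sq_nonneg (q.1 + 2 * y)]
      calc K * ((1 + |q.1 + y|) * Real.exp (-((q.1 + y) / T) ^ 2))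
          ≤ K * ((2 * (1 + |q.1|)) * (Real.exp (1 / T ^ 2) * Real.exp (-(1 / (2 * T ^ 2)) * q.1 ^ 2))) := by
            gcongr
        _ = _ := by ring
    have hstep : V x ≤ ∫ t : ℝ, (2 * Real.pi)⁻¹ * ∫ θ in (0:ℝ)..2 * Real.pi,
        ‖H (((x + r * Real.cos θ : ℝ) : ℂ) + ((t + r * Real.sin θ : ℝ) : ℂ) * I)‖ ^ p := by
      simp only [hVdef]
      apply integral_mono_of_nonneg
      · filter_upwards with t; positivity
      · have := hIntg2.integral_prod_left
        simp only [intervalIntegral.integral_of_le Real.two_pi_pos.le]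
        exact this.const_mul _
      · filter_upwards with t
        have hball : AnalyticOnNhd ℂ H (Metric.closedBall ((x:ℂ) + t * I) r) := by
          apply hHan.mono
          intro s hs
          rw [Metric.mem_closedBall, dist_eq_norm] at hs
          have h1 := Complex.abs_re_le_norm (s - ((x:ℂ) + t * I))
          simp only [sub_re, add_re, ofReal_re, mul_re, I_re, mul_zero, ofReal_im, I_im, mul_one,
            sub_self, add_zero] at h1
          have h2 := abs_le.mp (h1.trans hs)
          constructor <;> linarith
        have := submean hr0 hp hball
        rw [Real.circleAverage_def, smul_eq_mul] at this
        simp only [hcm] at this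
        exact this
    refine hstep.trans (le_of_eq ?_)
    rw [integral_const_mul]
    congr 1
    simp only [intervalIntegral.integral_of_le Real.two_pi_pos.le]
    rw [integral_integral_swap (f := fun (t θ : ℝ) => ‖H (((x + r * Real.cos θ : ℝ) : ℂ) +
      ((t + r * Real.sin θ : ℝ) : ℂ) * I)‖ ^ p) hIntg2]
    congr 1
    ext θ
    simp only [hVdef]
    exact integral_add_right_eq_self (fun t : ℝ => ‖H (((x + r * Real.cos θ : ℝ) : ℂ) + (t : ℂ) * I)‖ ^ p) (r * Real.sin θ))
  have hσ2 := hmain σ hσ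
  simp only [hVM] at hσ2
  have hE : ∀ x : ℝ, |x| ≤ 5 → Real.exp (x ^ 2 / T ^ 2) ≤ 2 := by
    intro x hx
    have : x ^ 2 / T ^ 2 ≤ 1 / 4 := by
      rw [div_le_div_iff₀ (by positivity) (by norm_num)]
      have : x ^ 2 ≤ 25 := by rw [← sq_abs]; nlinarith [abs_nonneg x]
      nlinarith
    have h2 : (1/4 : ℝ) ≤ Real.log 2 := by have := Real.log_two_gt_d9; linarith
    calc _ ≤ Real.exp (Real.log 2) := Real.exp_le_exp.mpr (by linarith)
      _ = 2 := Real.exp_log (by norm_num)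
  have hE1 : (1:ℝ) ≤ Real.exp (σ ^ 2 / T ^ 2) := Real.one_le_exp (by positivity)
  have hMσ : MM p T h σ ≤ Real.exp (-(lam * σ)) * (MM p T h σ * Real.exp (σ ^ 2 / T ^ 2 + lam * σ)) := by
    have : Real.exp (-(lam * σ)) * (MM p T h σ * Real.exp (σ ^ 2 / T ^ 2 + lam * σ)) =
        MM p T h σ * Real.exp (σ ^ 2 / T ^ 2) := by
      rw [mul_left_comm, ← Real.exp_add]; congr 2; ring
    rw [this]
    nlinarith [MM_nonneg p T h σ]
  have hend : ∀ x : ℝ, |x| ≤ 5 → Real.exp (-(lam * σ)) * (MM p T h x * Real.exp (x ^ 2 / T ^ 2 + lam * x))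
      ≤ 2 * (Real.exp (lam * (x - σ)) * MM p T h x) := by
    intro x hx
    have : Real.exp (-(lam * σ)) * (MM p T h x * Real.exp (x ^ 2 / T ^ 2 + lam * x)) =
      Real.exp (x ^ 2 / T ^ 2) * (Real.exp (lam * (x - σ)) * MM p T h x) := by
      rw [mul_left_comm, ← Real.exp_add, ← mul_assoc, ← Real.exp_add, mul_comm]; congr 2; ring
    rw [this]
    have := hE x hx
    have := MM_nonneg p T h x
    gcongr
  calc MM p T h σ ≤ _ := hMσ
    _ ≤ Real.exp (-(lam * σ)) * max (MM p T h a * Real.exp (a ^ 2 / T ^ 2 + lam * a))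
          (MM p T h b * Real.exp (b ^ 2 / T ^ 2 + lam * b)) := by gcongr
    _ = max (Real.exp (-(lam * σ)) * (MM p T h a * Real.exp (a ^ 2 / T ^ 2 + lam * a)))
          (Real.exp (-(lam * σ)) * (MM p T h b * Real.exp (b ^ 2 / T ^ 2 + lam * b))) :=
        mul_max_of_nonneg _ _ (by positivity)
    _ ≤ max (2 * (Real.exp (lam * (a - σ)) * MM p T h a)) (2 * (Real.exp (lam * (b - σ)) * MM p T h b)) :=
        max_le_max (hend a ha) (hend b hb)
    _ = _ := by rw [mul_max_of_nonneg _ _ (by norm_num)]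

end ZA

open Complex MeasureTheory Set Filter Topology
namespace ZA

lemma cpow_diff_le {N : ℝ} (hN : 0 < N) {s : ℂ} (hs : 0 < s.re) {x : ℝ} (hx : x ∈ Icc N (N+1)) :
    ‖((x:ℂ))^(-s) - ((N:ℂ))^(-s)‖ ≤ ‖s‖ * N^(-s.re-1) := by
  have h := norm_image_sub_le_of_norm_deriv_le_segment' (f := fun x : ℝ => (x:ℂ)^(-s))
    (f' := fun x : ℝ => (-s) * (x:ℂ)^(-s-1)) (a := N) (b := N+1) (C := ‖s‖ * N^(-s.re-1)) ?_ ?_ x hx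
  · refine h.trans ?_
    have h1 : 0 ≤ ‖s‖ * N^(-s.re-1) := by positivity
    have : x - N ≤ 1 := by linarith [hx.2]
    nlinarith [hx.1]
  · intro y hy
    have hy0 : 0 < y := hN.trans_le hy.1
    have : HasDerivAt (fun x : ℂ => x^(-s)) ((-s) * (y:ℂ)^(-s-1)) (y:ℂ) := by
      simpa using (hasDerivAt_id (y:ℂ)).cpow_const (c := -s) (Or.inl (by simpa using hy0))
    exact this.comp_ofReal.hasDerivWithinAt
  · intro y hy
    have hy0 : 0 < y := hN.trans_le hy.1
    rw [norm_mul, norm_neg, norm_cpow_eq_rpow_re_of_pos hy0]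
    gcongr
    simp only [sub_re, neg_re, one_re]
    exact Real.rpow_le_rpow_of_nonpos hN hy.1 (by linarith)

lemma zterm_le {N : ℝ} (hN : 0 < N) {s : ℂ} (hs : 0 < s.re) :
    ‖(s-1) * (N:ℂ)^(-s) + ((N+1:ℝ):ℂ)^(1-s) - (N:ℂ)^(1-s)‖ ≤ ‖s-1‖ * (‖s‖ * N^(-s.re-1)) := by
  have h := norm_image_sub_le_of_norm_deriv_le_segment' (f := fun x : ℝ => (s-1) * (N:ℂ)^(-s) * (x:ℂ) + (x:ℂ)^(1-s))
    (f' := fun x : ℝ => (s-1) * (N:ℂ)^(-s) * 1 + (1-s) * (x:ℂ)^(1-s-1)) (a := N) (b := N+1) (C := ‖s-1‖ * (‖s‖ * N^(-s.re-1))) ?_ ?_ (N+1) ⟨by linarith, le_refl _⟩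
  · refine le_trans (le_of_eq ?_) (h.trans (le_of_eq (by ring)))
    congr 1
    push_cast
    ring
  · intro y hy
    have hy0 : 0 < y := hN.trans_le hy.1
    have : HasDerivAt (fun x : ℂ => (s-1) * (N:ℂ)^(-s) * x + x^(1-s)) ((s-1) * (N:ℂ)^(-s) * 1 + (1-s) * (y:ℂ)^(1-s-1)) (y:ℂ) := by
      refine ((hasDerivAt_id (y:ℂ)).const_mul _).add ?_
      simpa using (hasDerivAt_id (y:ℂ)).cpow_const (c := 1-s) (Or.inl (by simpa using hy0))
    exact this.comp_ofReal.hasDerivWithinAt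
  · intro y hy
    have : (s-1) * (N:ℂ)^(-s) * 1 + (1-s) * (y:ℂ)^(1-s-1) = -((s-1) * ((y:ℂ)^(-s) - (N:ℂ)^(-s))) := by
      rw [show 1-s-1 = -s by ring]; ring
    rw [this, norm_neg, norm_mul]
    gcongr
    exact cpow_diff_le hN hs ⟨hy.1, hy.2.le⟩

noncomputable def zt (n : ℕ) (s : ℂ) : ℂ :=
  (s-1) * ((n+1:ℝ):ℂ)^(-s) + ((n+1+1:ℝ):ℂ)^(1-s) - ((n+1:ℝ):ℂ)^(1-s)

lemma zt_le (n : ℕ) {s : ℂ} (hs : 0 < s.re) : ‖zt n s‖ ≤ ‖s-1‖ * (‖s‖ * (n+1:ℝ)^(-s.re-1)) :=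
  zterm_le (by positivity) hs

lemma summ_aux {e : ℝ} (he : 0 < e) : Summable fun n : ℕ => (n+1:ℝ)^(-e-1) := by
  have := (summable_nat_add_iff 1).2 (Real.summable_nat_rpow (p := -e-1) |>.2 (by linarith))
  simpa using this

lemma zt_summable {s : ℂ} (hs : 0 < s.re) : Summable fun n => zt n s :=
  Summable.of_norm_bounded (((summ_aux hs).mul_left _).mul_left _) (fun n => zt_le n hs)

lemma zt_diff (n : ℕ) : Differentiable ℂ (zt n) := by
  have h1 : ((n+1:ℝ):ℂ) ≠ 0 := by exact_mod_cast (by positivity : (n+1:ℝ) ≠ 0)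
  have h2 : ((n+1+1:ℝ):ℂ) ≠ 0 := by exact_mod_cast (by positivity : (n+1+1:ℝ) ≠ 0)
  intro s
  unfold zt
  refine DifferentiableAt.sub (DifferentiableAt.add (DifferentiableAt.mul (by fun_prop) ?_) ?_) ?_
  · exact DifferentiableAt.const_cpow (by fun_prop) (Or.inl h1)
  · exact DifferentiableAt.const_cpow (by fun_prop) (Or.inl h2)
  · exact DifferentiableAt.const_cpow (by fun_prop) (Or.inl h1)

lemma zt_tsum_diff : DifferentiableOn ℂ (fun s => 1 + ∑' n, zt n s) {s | 0 < s.re} := by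
  intro s hs
  have hs : 0 < s.re := hs
  refine DifferentiableAt.differentiableWithinAt ?_
  refine (differentiableAt_const _).add ?_
  set U : Set ℂ := {z | s.re/2 < z.re} ∩ Metric.ball 0 (‖s‖+1) with hU
  have hUo : IsOpen U := (isOpen_lt continuous_const continuous_re).inter Metric.isOpen_ball
  have hsU : s ∈ U := ⟨by simp; linarith, by simp⟩
  have := differentiableOn_tsum_of_summable_norm (F := fun n s => zt n s) (U := U)
    (u := fun n : ℕ => (‖s‖+2) * ((‖s‖+1) * (n+1:ℝ)^(-(s.re/2)-1)))
    (((summ_aux (half_pos hs)).mul_left _).mul_left _) (fun n => (zt_diff n).differentiableOn) hUo ?_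
  · exact this.differentiableAt (hUo.mem_nhds hsU)
  · intro n z hz
    have hz1 : s.re/2 < z.re := hz.1
    have hz2 : ‖z‖ < ‖s‖+1 := by simpa using hz.2
    refine (zt_le n (by linarith)).trans ?_
    have : ‖z - 1‖ ≤ ‖s‖+2 := (norm_sub_le _ _).trans (by simp; linarith)
    gcongr
    linarith

lemma zt_tsum_eq1 {s : ℂ} (hs : 1 < s.re) : 1 + ∑' n, zt n s = (s-1) * riemannZeta s := by
  have h1 : HasSum (fun n : ℕ => (s-1) * ((n+1:ℝ):ℂ)^(-s)) ((s-1) * riemannZeta s) := by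
    refine HasSum.mul_left _ ?_
    rw [zeta_eq_tsum_one_div_nat_add_one_cpow hs]
    have : Summable fun n : ℕ => 1 / ((n:ℂ)+1)^s := by
      have := (summable_nat_add_iff 1).2 (Complex.summable_one_div_nat_cpow.2 hs)
      simpa using this
    refine this.hasSum.congr_fun ?_
    intro n
    rw [cpow_neg]; push_cast; simp
  have h2 : HasSum (fun n : ℕ => ((n+1+1:ℝ):ℂ)^(1-s) - ((n+1:ℝ):ℂ)^(1-s)) (-1) := by
    have hsum : Summable (fun n : ℕ => ((n+1+1:ℝ):ℂ)^(1-s) - ((n+1:ℝ):ℂ)^(1-s)) := by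
      have := (zt_summable (s := s) (by linarith)).sub h1.summable
      refine this.congr ?_
      intro n; simp only [zt]; ring
    rw [hsum.hasSum_iff_tendsto_nat]
    have : ∀ n : ℕ, ∑ i ∈ Finset.range n, (((i+1+1:ℝ):ℂ)^(1-s) - ((i+1:ℝ):ℂ)^(1-s)) = ((n+1:ℝ):ℂ)^(1-s) - 1 := by
      intro n
      have := Finset.sum_range_sub (fun i : ℕ => ((i+1:ℝ):ℂ)^(1-s)) n
      simp only [Nat.cast_add, Nat.cast_one] at this
      rw [this]; simp
    simp_rw [this]
    have h0 : Tendsto (fun n : ℕ => ((n+1:ℝ):ℂ)^(1-s)) atTop (𝓝 0) := by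
      rw [tendsto_zero_iff_norm_tendsto_zero]
      have h3 := (tendsto_rpow_neg_atTop (y := s.re-1) (by linarith)).comp
        (tendsto_atTop_add_const_right _ 1 tendsto_natCast_atTop_atTop)
      refine h3.congr ?_
      intro n
      simp only [Function.comp]
      rw [norm_cpow_eq_rpow_re_of_pos (by positivity)]
      congr 1; simp
    simpa using h0.sub_const 1
  have h3 := h1.add h2
  have h4 : ∑' n, zt n s = (s-1) * riemannZeta s + -1 := by
    rw [← h3.tsum_eq]
    congr 1; ext n; simp only [zt]; ring
  rw [h4]; ring

lemma zt_tsum_eq {s : ℂ} (hs : 0 < s.re) (h1 : s ≠ 1) : 1 + ∑' n, zt n s = (s-1) * riemannZeta s := by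
  have hopen : IsOpen {s : ℂ | 0 < s.re} := isOpen_lt continuous_const continuous_re
  have ha : AnalyticOnNhd ℂ (fun s => 1 + ∑' n, zt n s) {s : ℂ | 0 < s.re} :=
    zt_tsum_diff.analyticOnNhd hopen
  have hb : AnalyticOnNhd ℂ riemannZeta₁ {s : ℂ | 0 < s.re} :=
    differentiable_riemannZeta₁.differentiableOn.analyticOnNhd hopen
  have hpre : IsPreconnected {s : ℂ | 0 < s.re} := (convex_halfSpace_re_gt 0).isPreconnected
  have hz : ∀ s : ℂ, s ≠ 1 → riemannZeta₁ s = (s-1) * riemannZeta s := by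
    intro s hs
    rw [riemannZeta_eq_inv_sub_mul hs]
    have : s - 1 ≠ 0 := sub_ne_zero.2 hs
    field_simp
  have := ha.eqOn_of_preconnected_of_eventuallyEq hb hpre (z₀ := 2) (by simp) ?_
  · have := this hs
    simp only at this
    rw [this, hz s h1]
  · filter_upwards [(isOpen_lt continuous_const continuous_re).mem_nhds (show (1:ℝ) < (2:ℂ).re by simp)] with z hz'
    have hz' : 1 < z.re := hz'
    rw [zt_tsum_eq1 hz', hz]
    rintro rfl; simp at hz'

lemma zeta_bound : ∃ C : ℝ, 1 ≤ C ∧ ∀ s : ℂ, 1/4 ≤ s.re → s ≠ 1 →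
    ‖riemannZeta s‖ ≤ 1/‖s-1‖ + C * ‖s‖ := by
  have hS := summ_aux (e := 1/4) (by norm_num)
  refine ⟨1 + ∑' n : ℕ, (n+1:ℝ)^(-(1/4:ℝ)-1), ?_, ?_⟩
  · have : 0 ≤ ∑' n : ℕ, (n+1:ℝ)^(-(1/4:ℝ)-1) := tsum_nonneg fun n => by positivity
    linarith
  intro s hs h1
  have hp : 0 < ‖s-1‖ := norm_pos_iff.2 (sub_ne_zero.2 h1)
  have h2 := zt_tsum_eq (by linarith) h1
  have h3 : ‖∑' n, zt n s‖ ≤ ‖s-1‖ * (‖s‖ * ∑' n : ℕ, (n+1:ℝ)^(-(1/4:ℝ)-1)) := by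
    rw [← tsum_mul_left, ← tsum_mul_left]
    refine tsum_of_norm_bounded ((hS.mul_left _).mul_left _).hasSum ?_
    intro n
    refine (zt_le n (by linarith)).trans ?_
    gcongr
    linarith
  have h4 : ‖s-1‖ * ‖riemannZeta s‖ ≤ 1 + ‖s-1‖ * (‖s‖ * ∑' n : ℕ, (n+1:ℝ)^(-(1/4:ℝ)-1)) := by
    rw [← norm_mul, ← h2]
    refine (norm_add_le _ _).trans ?_
    simpa using h3
  have h5 : ‖riemannZeta s‖ ≤ (1 + ‖s-1‖ * (‖s‖ * ∑' n : ℕ, (n+1:ℝ)^(-(1/4:ℝ)-1))) / ‖s-1‖ := by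
    rw [le_div_iff₀ hp]; linarith
  refine h5.trans ?_
  rw [add_div, mul_div_cancel_left₀ _ hp.ne']
  nlinarith [norm_nonneg s]

end ZA

open Complex MeasureTheory Set Filter Topology
namespace ZA

lemma Gamma_apriori : ∃ C : ℝ, 0 < C ∧ ∀ s : ℂ, 1/2 ≤ s.re → s.re ≤ 3/2 → ‖Gamma s‖ ≤ C := by
  refine ⟨Real.Gamma (1/2) + Real.Gamma (3/2), by
    have := Real.Gamma_pos_of_pos (show (0:ℝ) < 1/2 by norm_num)
    have := Real.Gamma_pos_of_pos (show (0:ℝ) < 3/2 by norm_num)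
    linarith, ?_⟩
  intro s h1 h2
  rw [Complex.Gamma_eq_integral (by linarith), Complex.GammaIntegral, Real.Gamma_eq_integral (by norm_num),
    Real.Gamma_eq_integral (by norm_num), ← integral_add]
  · refine norm_integral_le_of_norm_le ?_ ?_
    · exact (Real.GammaIntegral_convergent (by norm_num)).add (Real.GammaIntegral_convergent (by norm_num))
    · filter_upwards [ae_restrict_mem measurableSet_Ioi] with x hx
      have hx : 0 < x := hx
      rw [norm_mul, norm_cpow_eq_rpow_re_of_pos hx, norm_real, Real.norm_eq_abs, Real.abs_exp,
        ← mul_add]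
      gcongr
      simp only [sub_re, one_re]
      rcases le_total x 1 with h | h
      · have := Real.rpow_le_rpow_of_exponent_ge hx h (show (1/2-1:ℝ) ≤ s.re - 1 by linarith)
        have : 0 ≤ x^(3/2-1:ℝ) := by positivity
        linarith
      · have := Real.rpow_le_rpow_of_exponent_le h (show s.re - 1 ≤ (3/2-1:ℝ) by linarith)
        have : 0 ≤ x^(1/2-1:ℝ) := by positivity
        linarith
  · exact (Real.GammaIntegral_convergent (by norm_num))
  · exact (Real.GammaIntegral_convergent (by norm_num))

lemma Gamma_half (t : ℝ) : ‖Gamma (1/2 + t*I)‖ ≤ Real.sqrt (2*Real.pi) * Real.exp (-Real.pi*|t|/2) := by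
  have h1 := Complex.Gamma_mul_Gamma_one_sub (1/2 + t*I)
  have h2 : (1:ℂ) - (1/2 + t*I) = (starRingEnd ℂ) (1/2 + t*I) := by
    apply Complex.ext <;> simp; norm_num
  rw [h2, Gamma_conj, mul_conj, normSq_eq_norm_sq] at h1
  have h3 : sin (Real.pi * (1/2 + t*I)) = ((Real.cosh (Real.pi*t) : ℝ) : ℂ) := by
    rw [show (Real.pi:ℂ) * (1/2 + t*I) = (Real.pi*t:ℂ)*I + Real.pi/2 by ring, Complex.sin_add_pi_div_two, Complex.cos_mul_I]
    push_cast; rfl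
  rw [h3] at h1
  have h4 : ‖Gamma (1/2 + t*I)‖^2 = Real.pi / Real.cosh (Real.pi*t) := by exact_mod_cast h1
  have h5 : Real.exp (Real.pi*|t|) / 2 ≤ Real.cosh (Real.pi*t) := by
    rw [← Real.cosh_abs, abs_mul, abs_of_pos Real.pi_pos, Real.cosh_eq]
    have := Real.exp_pos (-(Real.pi*|t|))
    linarith
  refine abs_le_of_sq_le_sq' ?_ (by positivity) |>.2
  rw [h4, mul_pow, Real.sq_sqrt (by positivity), ← Real.exp_nat_mul, div_le_iff₀ (Real.cosh_pos _)]
  have h6 : Real.exp (((2:ℕ):ℝ) * (-Real.pi*|t|/2)) * Real.exp (Real.pi*|t|) = 1 := by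
    rw [← Real.exp_add]; simp; ring
  have h7 := Real.exp_pos (((2:ℕ):ℝ) * (-Real.pi*|t|/2))
  have h8 : 1/2 ≤ Real.exp (((2:ℕ):ℝ) * (-Real.pi*|t|/2)) * Real.cosh (Real.pi*t) := by
    have := mul_le_mul_of_nonneg_left h5 h7.le
    linarith
  nlinarith [Real.pi_pos]

lemma arg_low_pos {z : ℂ} (hr : 0 < z.re) (hi : 0 < z.im) : Real.pi/2 * z.im - z.re ≤ z.im * arg z := by
  have h1 : 0 ≤ arg z := arg_nonneg_iff.2 hi.le
  have h2 : |arg z| < Real.pi/2 := Complex.abs_arg_lt_pi_div_two_iff.2 (Or.inl hr)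
  have h3 : 0 < arg z := by
    rcases h1.lt_or_eq with h | h
    · exact h
    · exfalso
      have := Complex.arg_eq_zero_iff.1 h.symm
      linarith [this.2]
  rw [abs_of_pos h3] at h2
  have h4 := Real.le_tan (x := Real.pi/2 - arg z) (by linarith) (by linarith)
  rw [Real.tan_pi_div_two_sub, tan_arg, inv_div, le_div_iff₀ hi] at h4
  linarith

lemma arg_low {z : ℂ} (hr : 0 < z.re) : Real.pi/2 * |z.im| - z.re ≤ z.im * arg z := by
  rcases lt_trichotomy z.im 0 with h | h | h
  · have h1 := arg_low_pos (z := (starRingEnd ℂ) z) (by simpa) (by simpa)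
    rw [arg_conj, if_neg] at h1
    · rw [abs_of_neg h]; simp only [conj_re, conj_im] at h1; linarith
    · intro h2
      have := (arg_eq_pi_iff.1 h2).1
      linarith
  · rw [h]; simp; exact hr.le
  · rw [abs_of_pos h]; exact arg_low_pos hr h

lemma arg_up {z : ℂ} (hr : 0 < z.re) : z.im * arg z ≤ Real.pi/2 * |z.im| := by
  have h2 : |arg z| < Real.pi/2 := Complex.abs_arg_lt_pi_div_two_iff.2 (Or.inl hr)
  calc _ ≤ |z.im * arg z| := le_abs_self _
    _ = |arg z| * |z.im| := by rw [abs_mul, mul_comm]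
    _ ≤ _ := by gcongr

noncomputable def GF (s : ℂ) : ℂ := Gamma s * exp ((1/2 - s) * log (s+1))

lemma GF_norm {s : ℂ} (hs : 0 < s.re) : ‖GF s‖ = ‖Gamma s‖ * (‖s+1‖^(1/2-s.re) * Real.exp (s.im * arg (s+1))) := by
  have h1 : 0 < ‖s+1‖ := norm_pos_iff.2 (by
    intro h; have := congrArg re h; simp at this; linarith)
  rw [GF, norm_mul, norm_exp, Real.rpow_def_of_pos h1, ← Real.exp_add]
  congr 2
  simp [mul_re, log_re, log_im]
  ring

lemma norm_add_one_ge {s : ℂ} (hs : 0 < s.re) : 1 ≤ ‖s+1‖ := by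
  have := Complex.re_le_norm (s+1)
  simp at this; linarith

lemma GF_bound {s : ℂ} (h1 : 1/2 ≤ s.re) (h2 : s.re ≤ 3/2) : ‖GF s‖ ≤ Real.sqrt (2*Real.pi) := by
  obtain ⟨C, hC, hG⟩ := Gamma_apriori
  refine PhragmenLindelof.vertical_strip (a := 1/2) (b := 3/2) (f := GF) ?_ ?_ ?_ ?_ h1 h2
  · refine DifferentiableOn.diffContOnCl ?_
    have hcl : closure (re ⁻¹' Ioo (1/2:ℝ) (3/2)) ⊆ {z : ℂ | 1/2 ≤ z.re} :=
      closure_minimal (fun z hz => hz.1.le) (isClosed_le continuous_const continuous_re)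
    intro z hz
    have hz : 1/2 ≤ z.re := hcl hz
    refine DifferentiableAt.differentiableWithinAt ?_
    unfold GF
    refine DifferentiableAt.mul (differentiableAt_Gamma _ ?_) ?_
    · intro m h
      have := congrArg re h
      simp at this
      have : (0:ℝ) ≤ m := by positivity
      linarith
    · refine DifferentiableAt.cexp (DifferentiableAt.mul (by fun_prop) ?_)
      refine DifferentiableAt.clog (by fun_prop) ?_
      left; simp; linarith
  · refine ⟨1, by norm_num; linarith [Real.pi_gt_three], Real.pi, ?_⟩
    refine Asymptotics.IsBigO.of_bound C ?_
    refine eventually_inf_principal.2 (Eventually.of_forall ?_)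
    intro z hz
    have hz1 : 1/2 < z.re := hz.1
    have hz2 : z.re < 3/2 := hz.2
    rw [GF_norm (by linarith), Real.norm_eq_abs, Real.abs_exp]
    have e1 : ‖z+1‖^(1/2-z.re) ≤ 1 := Real.rpow_le_one_of_one_le_of_nonpos (norm_add_one_ge (by linarith)) (by linarith)
    have e2 : z.im * arg (z+1) ≤ Real.pi * Real.exp (1 * |z.im|) := by
      have := arg_up (z := z+1) (by simp; linarith)
      simp only [add_im, one_im, add_zero] at this
      have h3 := Real.add_one_le_exp (1*|z.im|)
      have := abs_nonneg z.im
      nlinarith [Real.pi_pos]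
    have e3 := Real.exp_le_exp.2 e2
    have e4 := hG z hz1.le hz2.le
    calc _ ≤ C * (1 * Real.exp (Real.pi * Real.exp (1 * |z.im|))) := by gcongr
      _ = _ := by ring
  · intro z hz
    rw [GF_norm (by linarith), hz]
    have : z = 1/2 + z.im * I := by apply Complex.ext <;> simp [hz]
    have h3 := Gamma_half z.im
    rw [← this] at h3
    have h4 := arg_up (z := z+1) (by simp; linarith)
    simp only [add_im, one_im, add_zero] at h4
    simp only [sub_self, Real.rpow_zero, one_mul]
    calc _ ≤ (Real.sqrt (2*Real.pi) * Real.exp (-Real.pi*|z.im|/2)) * Real.exp (Real.pi/2 * |z.im|) := by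
          gcongr
      _ = _ := by
          rw [mul_assoc, ← Real.exp_add]; ring_nf; simp
  · intro z hz
    rw [GF_norm (by linarith), hz]
    have h5 : z = (z-1) + 1 := by ring
    have h5' : z - 1 = 1/2 + z.im * I := by apply Complex.ext <;> simp [hz]; norm_num
    have hne : z - 1 ≠ 0 := by
      intro h; have := congrArg re h; simp at this; linarith
    have h3 := Gamma_half z.im
    rw [← h5'] at h3
    have h6 : ‖Gamma z‖ = ‖z-1‖ * ‖Gamma (z-1)‖ := by
      conv_lhs => rw [h5, Gamma_add_one _ hne, norm_mul]
    have h4 := arg_up (z := z+1) (by simp; linarith)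
    simp only [add_im, one_im, add_zero] at h4
    have h7 : ‖z-1‖ ≤ ‖z+1‖ := by
      rw [← sq_le_sq₀ (norm_nonneg _) (norm_nonneg _), ← normSq_eq_norm_sq, ← normSq_eq_norm_sq, normSq_apply, normSq_apply]
      simp; nlinarith
    have h8 := norm_add_one_ge (s := z) (by linarith)
    rw [h6, show (1/2-3/2:ℝ) = -1 by norm_num, Real.rpow_neg_one]
    calc _ ≤ ‖z+1‖ * (Real.sqrt (2*Real.pi) * Real.exp (-Real.pi*|z.im|/2)) * (‖z+1‖⁻¹ * Real.exp (Real.pi/2 * |z.im|)) := by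
          gcongr
      _ = (‖z+1‖*‖z+1‖⁻¹) * (Real.sqrt (2*Real.pi) * (Real.exp (-Real.pi*|z.im|/2) * Real.exp (Real.pi/2 * |z.im|))) := by ring
      _ = _ := by
          rw [mul_inv_cancel₀ (by positivity), ← Real.exp_add]; ring_nf; simp


lemma Gamma_bd : ∃ C : ℝ, 1 ≤ C ∧ ∀ s : ℂ, 1/2 ≤ s.re → s.re ≤ 3/2 →
    ‖Gamma s‖ ≤ C * (‖s+1‖^(s.re-1/2) * Real.exp (-Real.pi*|s.im|/2)) := by
  have hq : 1 ≤ Real.sqrt (2*Real.pi) := by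
    rw [Real.one_le_sqrt]; linarith [Real.pi_gt_three]
  have he : 1 ≤ Real.exp (5/2) := by rw [Real.one_le_exp_iff]; norm_num
  refine ⟨Real.sqrt (2*Real.pi) * Real.exp (5/2), by nlinarith, ?_⟩
  intro s h1 h2
  have h3 := GF_bound h1 h2
  rw [GF_norm (by linarith)] at h3
  have h4 := norm_add_one_ge (s := s) (by linarith)
  have h5 := arg_low (z := s+1) (by simp; linarith)
  simp only [add_im, one_im, add_zero, add_re, one_re] at h5
  have h6 : ‖s+1‖^(s.re-1/2) * ‖s+1‖^(1/2-s.re) = 1 := by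
    rw [← Real.rpow_add (by linarith)]; simp
  have h7 : 1 ≤ Real.exp (5/2) * Real.exp (-Real.pi*|s.im|/2) * Real.exp (s.im * arg (s+1)) := by
    rw [← Real.exp_add, ← Real.exp_add, Real.one_le_exp_iff]; linarith
  have h8 : 0 ≤ Real.exp (5/2) * Real.exp (-Real.pi*|s.im|/2) * ‖s+1‖^(s.re-1/2) := by positivity
  calc ‖Gamma s‖ = ‖Gamma s‖ * 1 := by ring
    _ ≤ ‖Gamma s‖ * (Real.exp (5/2) * Real.exp (-Real.pi*|s.im|/2) * Real.exp (s.im * arg (s+1))) := by gcongr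
    _ = ‖Gamma s‖ * (Real.exp (5/2) * Real.exp (-Real.pi*|s.im|/2) * Real.exp (s.im * arg (s+1))) * (‖s+1‖^(s.re-1/2) * ‖s+1‖^(1/2-s.re)) := by rw [h6, mul_one]
    _ = (Real.exp (5/2) * Real.exp (-Real.pi*|s.im|/2) * ‖s+1‖^(s.re-1/2)) * (‖Gamma s‖ * (‖s+1‖^(1/2-s.re) * Real.exp (s.im * arg (s+1)))) := by ring
    _ ≤ (Real.exp (5/2) * Real.exp (-Real.pi*|s.im|/2) * ‖s+1‖^(s.re-1/2)) * Real.sqrt (2*Real.pi) := by gcongr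
    _ = _ := by ring

noncomputable def XX (s : ℂ) : ℂ := 2 * (2 * Real.pi) ^ (-s) * Gamma s * cos (Real.pi * s / 2)

lemma norm_cos_le (z : ℂ) : ‖cos z‖ ≤ Real.exp |z.im| := by
  rw [Complex.cos, norm_div]
  have h1 : ‖exp (z*I)‖ ≤ Real.exp |z.im| := by
    rw [norm_exp]; simp; exact neg_le_abs _
  have h2 : ‖exp (-z*I)‖ ≤ Real.exp |z.im| := by
    rw [norm_exp]; simp; exact le_abs_self _
  have := norm_add_le (exp (z*I)) (exp (-z*I))
  rw [show ‖(2:ℂ)‖ = 2 by simp, div_le_iff₀ (by norm_num)]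
  linarith

lemma XX_norm (s : ℂ) : ‖XX s‖ ≤ 2 * (2*Real.pi)^(-s.re) * ‖Gamma s‖ * Real.exp (Real.pi*|s.im|/2) := by
  rw [XX, norm_mul, norm_mul, norm_mul]
  have h1 : ‖(2 * Real.pi : ℂ)^(-s)‖ = (2*Real.pi)^(-s.re) := by
    have := norm_cpow_eq_rpow_re_of_pos (x := 2*Real.pi) (by positivity) (-s)
    push_cast at this
    simpa using this
  have h2 := norm_cos_le (Real.pi*s/2)
  have h3 : |(Real.pi*s/2 : ℂ).im| = Real.pi*|s.im|/2 := by
    rw [show (Real.pi*s/2 : ℂ) = ((Real.pi/2 : ℝ):ℂ) * s by push_cast; ring, im_ofReal_mul, abs_mul, abs_of_pos (by positivity)]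
    ring
  rw [h3] at h2
  rw [h1, show ‖(2:ℂ)‖ = 2 by simp]
  gcongr

/-- bound for the functional equation factor on `1/2 ≤ σ ≤ 3/2` -/
lemma XX_bd : ∃ C : ℝ, 1 ≤ C ∧ ∀ s : ℂ, 1/2 ≤ s.re → s.re ≤ 3/2 →
    ‖XX s‖ ≤ C * (1+|s.im|)^(s.re-1/2) := by
  obtain ⟨C, hC, h⟩ := Gamma_bd
  refine ⟨2*C*(5/2), by linarith, ?_⟩
  intro s h1 h2
  have h3 := h s h1 h2
  have h4 : (2*Real.pi)^(-s.re) ≤ 1 := Real.rpow_le_one_of_one_le_of_nonpos (by linarith [Real.pi_gt_three]) (by linarith)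
  have h5 : ‖s+1‖ ≤ (5/2) * (1+|s.im|) := by
    have := norm_le_abs_re_add_abs_im (s+1)
    simp only [add_im, one_im, add_zero, add_re, one_re] at this
    rw [abs_of_pos (by linarith)] at this
    nlinarith [abs_nonneg s.im]
  have h6 : ‖s+1‖^(s.re-1/2) ≤ (5/2) * (1+|s.im|)^(s.re-1/2) := by
    calc _ ≤ ((5/2) * (1+|s.im|))^(s.re-1/2) := Real.rpow_le_rpow (norm_nonneg _) h5 (by linarith)
      _ = (5/2)^(s.re-1/2) * (1+|s.im|)^(s.re-1/2) := Real.mul_rpow (by norm_num) (by positivity)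
      _ ≤ (5/2)^(1:ℝ) * (1+|s.im|)^(s.re-1/2) := by
        gcongr
        · norm_num
        · linarith
      _ = _ := by simp
  have h7 : Real.exp (-Real.pi*|s.im|/2) * Real.exp (Real.pi*|s.im|/2) = 1 := by
    rw [← Real.exp_add]; ring_nf; simp
  calc _ ≤ _ := XX_norm s
    _ ≤ 2 * 1 * (C * (((5/2) * (1+|s.im|)^(s.re-1/2)) * Real.exp (-Real.pi*|s.im|/2))) * Real.exp (Real.pi*|s.im|/2) := by
      gcongr
      exact h3.trans (by gcongr)
    _ = 2*C*(5/2) * (1+|s.im|)^(s.re-1/2) * (Real.exp (-Real.pi*|s.im|/2) * Real.exp (Real.pi*|s.im|/2)) := by ring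
    _ = _ := by rw [h7, mul_one]

noncomputable def YY (w : ℂ) : ℝ := (2*Real.pi)^w.re * ‖Gamma (1-w)‖ * Real.exp (Real.pi*|w.im|/2)

lemma XX_le_YY (w : ℂ) : ‖XX (1-w)‖ ≤ YY w := by
  refine (XX_norm _).trans ?_
  rw [YY]
  simp only [sub_re, one_re, sub_im, one_im, zero_sub, abs_neg]
  gcongr
  rw [show -(1-w.re) = w.re - 1 by ring, Real.rpow_sub_one (by positivity)]
  have := Real.pi_gt_three
  have h : 0 ≤ (2*Real.pi)^w.re := by positivity
  rw [← mul_div_assoc, div_le_iff₀ (by positivity)]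
  nlinarith

lemma YY_succ {w : ℂ} (h : w.im ≠ 0) : YY (w+1) = YY w * (2*Real.pi / ‖w‖) := by
  have hw : w ≠ 0 := by rintro rfl; simp at h
  have h1 : Gamma (1-w) = -w * Gamma (1-(w+1)) := by
    have := Gamma_add_one (-w) (neg_ne_zero.2 hw)
    rw [show 1-w = -w+1 by ring, this]; congr 2; ring
  have h2 : 0 < ‖w‖ := norm_pos_iff.2 hw
  rw [YY, YY, h1, norm_mul, norm_neg]
  simp only [add_re, one_re, add_im, one_im, add_zero]
  rw [Real.rpow_add_one (by positivity)]
  field_simp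

lemma YY_base : ∃ C : ℝ, 1 ≤ C ∧ ∀ w : ℂ, 1/2 ≤ w.re → w.re ≤ 3/2 → 2*Real.pi ≤ |w.im| → YY w ≤ C := by
  obtain ⟨C, hC, h⟩ := Gamma_bd
  refine ⟨(2*Real.pi)^(3/2:ℝ) * (C * 2), ?_, ?_⟩
  · have : 1 ≤ (2*Real.pi)^(3/2:ℝ) := Real.one_le_rpow (by linarith [Real.pi_gt_three]) (by norm_num)
    nlinarith
  intro w h1 h2 h3
  have hpi := Real.pi_gt_three
  have hne : 1 - w ≠ 0 := by
    intro h
    have := congrArg im h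
    simp at this
    rw [this] at h3; simp at h3; linarith
  have e1 : Gamma (2-w) = (1-w) * Gamma (1-w) := by
    rw [← Gamma_add_one _ hne]; congr 1; ring
  have e2 := h (2-w) (by simp; linarith) (by simp; linarith)
  rw [e1, norm_mul] at e2
  simp only [sub_re, sub_im, re_ofNat, im_ofNat, zero_sub, abs_neg] at e2
  have e3 : |w.im| ≤ ‖1-w‖ := by
    have := abs_im_le_norm (1-w)
    simpa using this
  have e4 : 1 ≤ ‖2-w+1‖ := by
    have := abs_im_le_norm (2-w+1)
    simp at this; linarith
  have e5 : ‖2-w+1‖ ≤ 2*|w.im| := by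
    have := norm_le_abs_re_add_abs_im (2-w+1)
    simp only [add_re, sub_re, add_im, sub_im, re_ofNat, im_ofNat, one_re, one_im, zero_sub, add_zero, abs_neg] at this
    rw [abs_of_pos (by linarith)] at this
    linarith
  have e6 : ‖2-w+1‖^(2-w.re-1/2) ≤ 2*|w.im| := by
    calc _ ≤ ‖2-w+1‖^(1:ℝ) := Real.rpow_le_rpow_of_exponent_le e4 (by linarith)
      _ ≤ _ := by simpa using e5
  have e7 : ‖Gamma (1-w)‖ ≤ C * 2 * Real.exp (-Real.pi*|w.im|/2) := by
    have h0 : 0 < |w.im| := by linarith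
    refine le_of_mul_le_mul_left ?_ h0
    calc _ ≤ ‖1-w‖ * ‖Gamma (1-w)‖ := by gcongr
      _ ≤ C * ((2*|w.im|) * Real.exp (-Real.pi*|w.im|/2)) := e2.trans (by gcongr)
      _ = _ := by ring
  have h7 : Real.exp (-Real.pi*|w.im|/2) * Real.exp (Real.pi*|w.im|/2) = 1 := by
    rw [← Real.exp_add]; ring_nf; simp
  rw [YY]
  calc _ ≤ (2*Real.pi)^(3/2:ℝ) * (C * 2 * Real.exp (-Real.pi*|w.im|/2)) * Real.exp (Real.pi*|w.im|/2) := by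
        gcongr
        linarith
    _ = (2*Real.pi)^(3/2:ℝ) * (C * 2) * (Real.exp (-Real.pi*|w.im|/2) * Real.exp (Real.pi*|w.im|/2)) := by ring
    _ = _ := by rw [h7, mul_one]

lemma YY_all : ∃ C : ℝ, 1 ≤ C ∧ ∀ w : ℂ, 1/2 ≤ w.re → 2*Real.pi ≤ |w.im| →
    YY w ≤ C ∧ (3/2 ≤ w.re → YY w ≤ C / |w.im|) := by
  obtain ⟨C, hC, h⟩ := YY_base
  have hpi := Real.pi_gt_three
  have key : ∀ n : ℕ, ∀ w : ℂ, 1/2 ≤ w.re → w.re ≤ 3/2 + n → 2*Real.pi ≤ |w.im| → YY w ≤ C := by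
    intro n
    induction n with
    | zero => intro w h1 h2 h3; exact h w h1 (by simpa using h2) h3
    | succ n ih =>
      intro w h1 h2 h3
      rcases le_total w.re (3/2) with h4 | h4
      · exact h w h1 h4 h3
      · push_cast at h2
        have h5 := ih (w-1) (by simp; linarith) (by simp; linarith) (by simpa using h3)
        have him : (w-1).im ≠ 0 := by
          intro h0; simp at h0; rw [h0] at h3; simp at h3; linarith
        have h6 := YY_succ him
        rw [sub_add_cancel] at h6
        have h7 : |w.im| ≤ ‖w-1‖ := by simpa using abs_im_le_norm (w-1)
        have h8 : 2*Real.pi/‖w-1‖ ≤ 1 := by rw [div_le_one (by linarith)]; linarith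
        have h9 : 0 ≤ YY (w-1) := by unfold YY; positivity
        rw [h6]
        nlinarith
  have key2 : ∀ w : ℂ, 1/2 ≤ w.re → 2*Real.pi ≤ |w.im| → YY w ≤ C := by
    intro w h1 h2
    obtain ⟨n, hn⟩ := exists_nat_ge w.re
    exact key n w h1 (by linarith) h2
  refine ⟨C * (2*Real.pi), by nlinarith, ?_⟩
  intro w h1 h3
  refine ⟨(key2 w h1 h3).trans (by nlinarith), ?_⟩
  intro h4
  have h5 := key2 (w-1) (by simp; linarith) (by simpa using h3)
  have him : (w-1).im ≠ 0 := by
    intro h0; simp at h0; rw [h0] at h3; simp at h3; linarith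
  have h6 := YY_succ him
  rw [sub_add_cancel] at h6
  have h7 : |w.im| ≤ ‖w-1‖ := by simpa using abs_im_le_norm (w-1)
  have h9 : 0 ≤ YY (w-1) := by unfold YY; positivity
  have : 0 < |w.im| := by linarith
  calc YY w = YY (w-1) * (2*Real.pi/‖w-1‖) := h6
    _ ≤ C * (2*Real.pi/|w.im|) := by gcongr
    _ = _ := by ring

lemma XX_one_sub_bd : ∃ C : ℝ, 1 ≤ C ∧ ∀ w : ℂ, 1/2 ≤ w.re → 2*Real.pi ≤ |w.im| →
    ‖XX (1-w)‖ ≤ C ∧ (3/2 ≤ w.re → ‖XX (1-w)‖ ≤ C / |w.im|) := by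
  obtain ⟨C, hC, h⟩ := YY_all
  exact ⟨C, hC, fun w h1 h2 => ⟨(XX_le_YY w).trans (h w h1 h2).1, fun h3 => (XX_le_YY w).trans ((h w h1 h2).2 h3)⟩⟩

lemma XX_diff {s : ℂ} (h : s.im ≠ 0) : DifferentiableAt ℂ XX s := by
  unfold XX
  refine DifferentiableAt.mul (DifferentiableAt.mul (DifferentiableAt.mul (by fun_prop) ?_) ?_) (by fun_prop)
  · refine DifferentiableAt.const_cpow (by fun_prop) (Or.inl ?_)
    have := Real.pi_ne_zero
    simp
  · refine differentiableAt_Gamma _ ?_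
    intro m hm; rw [hm] at h; simp at h

lemma zeta_fe {s : ℂ} (h : s.im ≠ 0) : riemannZeta (1-s) = XX s * riemannZeta s := by
  rw [XX]
  refine riemannZeta_one_sub ?_ ?_
  · intro m hm; rw [hm] at h; simp at h
  · rintro rfl; simp at h

end ZA

open Complex MeasureTheory Set Filter Topology
namespace ZA

noncomputable def cx (x : ℝ) (e : ℕ) : ℝ := ∏ i ∈ Finset.range e, (x+i)/(i+1)

lemma cx_succ (x : ℝ) (e : ℕ) : ((e:ℝ)+1) * cx x (e+1) = (x+e) * cx x e := by
  rw [cx, Finset.prod_range_succ, ← cx]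
  field_simp

lemma cx_zero (x : ℝ) : cx x 0 = 1 := by simp [cx]

lemma cx_nonneg {x : ℝ} (hx : 0 ≤ x) (e : ℕ) : 0 ≤ cx x e :=
  Finset.prod_nonneg fun i _ => by positivity

lemma cx_one (e : ℕ) : cx 1 e = 1 := by
  refine Finset.prod_eq_one fun i _ => ?_
  rw [add_comm, div_self (by positivity)]

lemma cx_le_one {x : ℝ} (hx : 0 ≤ x) (hx1 : x ≤ 1) (e : ℕ) : cx x e ≤ 1 := by
  refine Finset.prod_le_one (fun i _ => by positivity) fun i _ => ?_
  rw [div_le_one (by positivity)]; linarith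

lemma cx_sq {x : ℝ} (hx : 0 ≤ x) (e : ℕ) : cx x e ^ 2 ≤ cx (x^2) e := by
  rw [cx, ← Finset.prod_pow]
  refine Finset.prod_le_prod (fun i _ => by positivity) fun i _ => ?_
  rw [div_pow, div_le_div_iff₀ (by positivity) (by positivity)]
  have : 0 ≤ (i:ℝ) * (1-x)^2 * (i+1) := by positivity
  nlinarith

lemma cx_conv (x y : ℝ) (n : ℕ) : ∑ q ∈ Finset.HasAntidiagonal.antidiagonal n, cx x q.1 * cx y q.2 = cx (x+y) n := by
  induction n with
  | zero => simp [cx_zero]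
  | succ n ih =>
    have h1 : ((n:ℝ)+1) * ∑ q ∈ Finset.HasAntidiagonal.antidiagonal (n+1), cx x q.1 * cx y q.2 = ((n:ℝ)+1) * cx (x+y) (n+1) := by
      rw [cx_succ, ← ih]
      have e1 : ((n:ℝ)+1) * ∑ q ∈ Finset.HasAntidiagonal.antidiagonal (n+1), cx x q.1 * cx y q.2
          = ∑ q ∈ Finset.HasAntidiagonal.antidiagonal (n+1), (q.1:ℝ) * cx x q.1 * cx y q.2
          + ∑ q ∈ Finset.HasAntidiagonal.antidiagonal (n+1), (q.2:ℝ) * cx y q.2 * cx x q.1 := by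
        rw [Finset.mul_sum, ← Finset.sum_add_distrib]
        refine Finset.sum_congr rfl fun q hq => ?_
        have : (q.1:ℝ) + q.2 = n+1 := by exact_mod_cast Finset.HasAntidiagonal.mem_antidiagonal.1 hq
        rw [← this]; ring
      rw [e1, Finset.Nat.sum_antidiagonal_succ, Finset.Nat.sum_antidiagonal_succ', Finset.mul_sum]
      simp only [Nat.cast_zero, zero_mul, zero_add, add_zero, Nat.cast_add, Nat.cast_one, cx_succ]
      rw [← Finset.sum_add_distrib]
      refine Finset.sum_congr rfl fun q hq => ?_
      have : (q.1:ℝ) + q.2 = n := by exact_mod_cast Finset.HasAntidiagonal.mem_antidiagonal.1 hq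
      rw [← this]; ring
    exact mul_left_cancel₀ (by positivity) h1

noncomputable def dx (x : ℝ) : ArithmeticFunction ℝ :=
  ⟨fun n => if n = 0 then 0 else n.factorization.prod fun _ e => cx x e, by simp⟩

lemma dx_apply (x : ℝ) {n : ℕ} (hn : n ≠ 0) : dx x n = n.factorization.prod fun _ e => cx x e := by
  simp [dx, hn]

lemma dx_mult (x : ℝ) : (dx x).IsMultiplicative := by
  refine ArithmeticFunction.IsMultiplicative.iff_ne_zero.2 ⟨by simp [dx], ?_⟩
  intro m n hm hn hc
  rw [dx_apply _ hm, dx_apply _ hn, dx_apply _ (mul_ne_zero hm hn), Nat.factorization_mul_of_coprime hc]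
  exact Finsupp.prod_add_index_of_disjoint hc.disjoint_primeFactors _

lemma dx_prime_pow (x : ℝ) {p : ℕ} (hp : p.Prime) (i : ℕ) : dx x (p^i) = cx x i := by
  rw [dx_apply _ (pow_ne_zero _ hp.ne_zero), hp.factorization_pow, Finsupp.prod_single_index (h := fun _ e => cx x e) (cx_zero x)]

lemma dx_add (x y : ℝ) : dx x * dx y = dx (x+y) := by
  rw [ArithmeticFunction.IsMultiplicative.eq_iff_eq_on_prime_powers _ ((dx_mult x).mul (dx_mult y)) _ (dx_mult _)]
  intro p i hp
  rw [dx_prime_pow _ hp, ArithmeticFunction.mul_apply, Nat.sum_divisorsAntidiagonal (fun a b => dx x a * dx y b),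
    Nat.sum_divisors_prime_pow hp, ← cx_conv, Finset.Nat.sum_antidiagonal_eq_sum_range_succ (fun a b => cx x a * cx y b)]
  refine Finset.sum_congr rfl fun k hk => ?_
  have hk : k ≤ i := by simpa [Nat.lt_succ_iff] using hk
  rw [Nat.pow_div hk hp.pos, dx_prime_pow _ hp, dx_prime_pow _ hp]

lemma dx_one_apply {n : ℕ} (hn : n ≠ 0) : dx 1 n = 1 := by
  rw [dx_apply _ hn]; simp [cx_one, Finsupp.prod]

lemma dx_zero : dx 0 = 1 := by
  rw [ArithmeticFunction.IsMultiplicative.eq_iff_eq_on_prime_powers _ (dx_mult 0) _ ArithmeticFunction.isMultiplicative_one]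
  intro p i hp
  rw [dx_prime_pow _ hp]
  cases i with
  | zero => simp [cx_zero]
  | succ n =>
    rw [ArithmeticFunction.one_apply_ne (Nat.one_lt_pow (by omega) hp.one_lt).ne']
    rw [cx]; exact Finset.prod_eq_zero (i := 0) (by simp) (by simp)

lemma dx_pow (x : ℝ) (m : ℕ) : dx x ^ m = dx (m*x) := by
  induction m with
  | zero => simp [dx_zero]
  | succ n ih => rw [pow_succ, ih, dx_add]; congr 1; push_cast; ring

lemma dx_nonneg {x : ℝ} (hx : 0 ≤ x) (n : ℕ) : 0 ≤ dx x n := by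
  rcases eq_or_ne n 0 with rfl | hn
  · simp
  rw [dx_apply _ hn]
  exact Finset.prod_nonneg fun i _ => cx_nonneg hx _

lemma dx_le_one {x : ℝ} (hx : 0 ≤ x) (hx1 : x ≤ 1) (n : ℕ) : dx x n ≤ 1 := by
  rcases eq_or_ne n 0 with rfl | hn
  · simp
  rw [dx_apply _ hn]
  exact Finset.prod_le_one (fun i _ => cx_nonneg hx _) fun i _ => cx_le_one hx hx1 _

lemma dx_sq {x : ℝ} (hx : 0 ≤ x) (n : ℕ) : dx x n ^ 2 ≤ dx (x^2) n := by
  rcases eq_or_ne n 0 with rfl | hn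
  · simp
  rw [dx_apply _ hn, dx_apply _ hn, Finsupp.prod, Finsupp.prod, ← Finset.prod_pow]
  exact Finset.prod_le_prod (fun i _ => by positivity) fun i _ => cx_sq hx _

/-- L-series of a real arithmetic function -/
noncomputable def LS (f : ArithmeticFunction ℝ) (s : ℂ) : ℂ := LSeries (fun n => (f n : ℂ)) s
def LSum (f : ArithmeticFunction ℝ) (s : ℂ) : Prop := LSeriesSummable (fun n => (f n : ℂ)) s

lemma conv_eq (f g : ArithmeticFunction ℝ) : (fun n => ((f*g) n : ℂ)) = LSeries.convolution (fun n => (f n : ℂ)) (fun n => (g n : ℂ)) := by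
  rw [LSeries.convolution_def]
  ext n
  rw [ArithmeticFunction.mul_apply]; push_cast; rfl

lemma LS_mul {f g : ArithmeticFunction ℝ} {s : ℂ} (hf : LSum f s) (hg : LSum g s) :
    LSum (f*g) s ∧ LS (f*g) s = LS f s * LS g s := by
  unfold LSum LS
  rw [conv_eq]
  exact ⟨LSeriesSummable.convolution hf hg, LSeries_convolution' hf hg⟩

lemma LS_one (s : ℂ) : LSum 1 s ∧ LS 1 s = 1 := by
  have : (fun n => (((1:ArithmeticFunction ℝ) n : ℝ) : ℂ)) = LSeries.delta := by
    ext n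
    rcases eq_or_ne n 1 with rfl | h
    · simp [LSeries.delta]
    · simp [LSeries.delta, ArithmeticFunction.one_apply_ne h, h]
  unfold LSum LS
  rw [this]
  refine ⟨?_, by rw [LSeries_delta]; rfl⟩
  unfold LSeriesSummable
  refine summable_of_hasFiniteSupport (Set.Finite.subset (Set.finite_singleton 1) ?_)
  intro n hn
  by_contra h
  have h : n ≠ 1 := h
  apply hn
  rw [LSeries.term_def]; simp [LSeries.delta, h]

lemma LS_pow {f : ArithmeticFunction ℝ} {s : ℂ} (hf : LSum f s) (m : ℕ) :
    LSum (f^m) s ∧ LS (f^m) s = LS f s ^ m := by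
  induction m with
  | zero => simpa using LS_one s
  | succ n ih =>
    have := LS_mul ih.1 hf
    rw [pow_succ]
    exact ⟨this.1, by rw [this.2, ih.2, pow_succ]⟩

/-- truncation -/
noncomputable def tr (f : ArithmeticFunction ℝ) (N : ℕ) : ArithmeticFunction ℝ :=
  ⟨fun n => if n ≤ N then f n else 0, by simp⟩

lemma tr_le (f : ArithmeticFunction ℝ) {N n : ℕ} (h : n ≤ N) : tr f N n = f n := by simp [tr, h]

lemma tr_LS (f : ArithmeticFunction ℝ) (N : ℕ) (s : ℂ) :
    LSum (tr f N) s ∧ LS (tr f N) s = ∑ n ∈ Finset.Icc 1 N, (f n : ℂ) * (n:ℂ)^(-s) := by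
  have h0 : ∀ n ∉ Finset.Icc 1 N, LSeries.term (fun n => ((tr f N n : ℝ) : ℂ)) s n = 0 := by
    intro n hn
    rw [LSeries.term_def]
    rcases eq_or_ne n 0 with rfl | h
    · simp
    · have : ¬ n ≤ N := by
        intro h2; exact hn (Finset.mem_Icc.2 ⟨Nat.one_le_iff_ne_zero.2 h, h2⟩)
      simp [tr, this]
  refine ⟨?_, ?_⟩
  · exact summable_of_ne_finset_zero (s := Finset.Icc 1 N) h0
  · rw [LS, LSeries, tsum_eq_sum h0]
    refine Finset.sum_congr rfl fun n hn => ?_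
    have hn := Finset.mem_Icc.1 hn
    rw [LSeries.term_of_ne_zero (by omega), tr_le _ hn.2, cpow_neg]; rfl

lemma pow_mono_af {f g : ArithmeticFunction ℝ} (h : ∀ n, 0 ≤ f n ∧ f n ≤ g n) (m : ℕ) :
    ∀ n, 0 ≤ (f^m) n ∧ (f^m) n ≤ (g^m) n := by
  induction m with
  | zero =>
    intro n; simp only [pow_zero, le_refl, and_true]
    rcases eq_or_ne n 1 with rfl | h
    · simp
    · simp [ArithmeticFunction.one_apply_ne h]
  | succ k ih =>
    intro n
    rw [pow_succ, pow_succ, ArithmeticFunction.mul_apply, ArithmeticFunction.mul_apply]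
    refine ⟨Finset.sum_nonneg fun q _ => mul_nonneg (ih _).1 (h _).1, Finset.sum_le_sum fun q _ => ?_⟩
    exact mul_le_mul (ih _).2 (h _).2 (h _).1 ((ih _).1.trans (ih _).2)

lemma pow_agree {f g : ArithmeticFunction ℝ} {N : ℕ} (h : ∀ n ≤ N, f n = g n) (m : ℕ) :
    ∀ n ≤ N, (f^m) n = (g^m) n := by
  induction m with
  | zero => intro n _; simp
  | succ k ih =>
    intro n hn
    rw [pow_succ, pow_succ, ArithmeticFunction.mul_apply, ArithmeticFunction.mul_apply]
    refine Finset.sum_congr rfl fun q hq => ?_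
    have hq' := Nat.mem_divisorsAntidiagonal.1 hq
    have h1 : q.1 ≤ n := Nat.le_of_dvd (Nat.pos_of_ne_zero hq'.2) ⟨q.2, hq'.1.symm⟩
    have h2 : q.2 ≤ n := Nat.le_of_dvd (Nat.pos_of_ne_zero hq'.2) ⟨q.1, by rw [mul_comm]; exact hq'.1.symm⟩
    rw [ih _ (by omega), h _ (by omega)]

/-- the coefficients of the v-th power -/
lemma power_coeff {v : ℕ} (hv : 1 ≤ v) (N : ℕ) : ∃ b : ℕ → ℝ, (∀ n, 0 ≤ b n ∧ b n ≤ 1) ∧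
    (∀ n, 1 ≤ n → n ≤ N → b n = 1) ∧ ∀ s : ℂ, LSeriesSummable (fun n => (b n : ℂ)) s ∧
    LSeries (fun n => (b n : ℂ)) s = (∑ n ∈ Finset.Icc 1 N, (dx (1/v) n : ℂ) * (n:ℂ)^(-s))^v := by
  have hk : (0:ℝ) ≤ 1/v := by positivity
  have h1 : dx (1/v) ^ v = dx 1 := by
    rw [dx_pow]; congr 1
    have : (v:ℝ) ≠ 0 := by positivity
    field_simp
  refine ⟨fun n => (tr (dx (1/v)) N ^ v) n, ?_, ?_, ?_⟩
  · intro n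
    have := pow_mono_af (f := tr (dx (1/v)) N) (g := dx (1/v)) ?_ v n
    · refine ⟨this.1, this.2.trans ?_⟩
      rw [h1]; exact dx_le_one (by norm_num) le_rfl n
    · intro n
      simp only [tr, ArithmeticFunction.coe_mk]
      split_ifs
      · exact ⟨dx_nonneg hk n, le_rfl⟩
      · exact ⟨le_rfl, dx_nonneg hk n⟩
  · intro n hn1 hn2
    have := pow_agree (f := tr (dx (1/v)) N) (g := dx (1/v)) (N := N) (fun n hn => tr_le _ hn) v n hn2
    simp only
    rw [this, h1]; exact dx_one_apply (by omega)
  · intro s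
    have h := tr_LS (dx (1/v)) N s
    have := LS_pow h.1 v
    rw [h.2] at this
    exact this

lemma LS_real {f : ArithmeticFunction ℝ} (σ : ℝ) : LS f σ = ((∑' n, f n * (n:ℝ)^(-σ) : ℝ) : ℂ) := by
  rw [LS, LSeries, ofReal_tsum]
  congr 1; ext n
  rcases eq_or_ne n 0 with rfl | hn
  · simp
  · rw [LSeries.term_of_ne_zero hn, ofReal_mul, ofReal_cpow (by positivity), div_eq_mul_inv, ← cpow_neg]
    push_cast; rfl

lemma diag_sum : ∃ C : ℝ, 1 ≤ C ∧ ∀ v : ℕ, 1 ≤ v → ∀ N : ℕ, 3 ≤ N →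
    ∑ n ∈ Finset.Icc 1 N, dx (1/v) n ^ 2 / n ≤ 3 * (C * Real.log N)^(1/(v:ℝ)^2) := by
  obtain ⟨C, hC, hz⟩ := zeta_bound
  refine ⟨1 + 2*C, by linarith, ?_⟩
  intro v hv N hN
  have hv0 : (0:ℝ) < v := by exact_mod_cast hv
  have hL : 1 ≤ Real.log N := by
    rw [Real.le_log_iff_exp_le (by positivity)]
    have : (3:ℝ) ≤ N := by exact_mod_cast hN
    linarith [Real.exp_one_lt_d9]
  set σ : ℝ := 1 + 1/Real.log N with hσ
  have hσ1 : 1 < σ := by rw [hσ]; have : 0 < 1/Real.log N := by positivity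
                         linarith
  have hσ2 : σ ≤ 2 := by
    have : 1/Real.log N ≤ 1 := by rw [div_le_one (by linarith)]; exact hL
    linarith
  set x : ℝ := 1/((v^2:ℕ):ℝ) with hx
  have hv2 : 1 ≤ v^2 := Nat.one_le_pow _ _ hv
  have hv2' : (1:ℝ) ≤ ((v^2:ℕ):ℝ) := by exact_mod_cast hv2
  have hx0 : 0 ≤ x := by positivity
  have hx1 : x ≤ 1 := by rw [hx, div_le_one (by linarith)]; exact hv2'
  have hsum : LSum (dx x) σ := by
    refine LSeriesSummable_of_bounded_of_one_lt_re (m := 1) ?_ (by simpa using hσ1)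
    intro n _
    rw [norm_real, Real.norm_eq_abs, abs_of_nonneg (dx_nonneg hx0 n)]
    exact dx_le_one hx0 hx1 n
  have hpow := (LS_pow hsum (v^2)).2
  have h1 : dx x ^ (v^2) = dx 1 := by
    rw [dx_pow, hx]; congr 1
    field_simp
  have h2 : LS (dx 1) σ = riemannZeta σ := by
    rw [← LSeries_one_eq_riemannZeta (by simpa using hσ1)]
    refine LSeries_congr ?_ _
    intro n hn
    rw [dx_one_apply hn]; simp
  set D : ℝ := ∑' n, dx x n * (n:ℝ)^(-σ) with hD
  have hDn : ∀ n, 0 ≤ dx x n * (n:ℝ)^(-σ) := fun n => mul_nonneg (dx_nonneg hx0 n) (by positivity)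
  have hD0 : 0 ≤ D := tsum_nonneg hDn
  rw [h1, h2, LS_real, ← ofReal_pow] at hpow
  have h3 : D^(v^2) ≤ (1+2*C) * Real.log N := by
    have := hz σ (by simp; linarith) (by
      intro h; have := congrArg re h; simp at this; linarith)
    rw [hpow, norm_real, Real.norm_eq_abs, abs_of_nonneg (by positivity), ← ofReal_one, ← ofReal_sub, norm_real, norm_real,
      Real.norm_eq_abs, Real.norm_eq_abs, abs_of_pos (by linarith : 0 < σ - 1), abs_of_pos (by linarith : 0 < σ)] at this
    refine this.trans ?_
    rw [hσ, add_sub_cancel_left, one_div_one_div, ← hσ]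
    nlinarith
  have h4 : D ≤ ((1+2*C) * Real.log N)^(1/(v:ℝ)^2) := by
    have := Real.rpow_le_rpow (by positivity) h3 (show (0:ℝ) ≤ 1/(v:ℝ)^2 by positivity)
    refine le_trans (le_of_eq ?_) this
    rw [← Real.rpow_natCast, ← Real.rpow_mul hD0]
    push_cast
    rw [mul_one_div, div_self (by positivity), Real.rpow_one]
  have hs : Summable fun n => dx x n * (n:ℝ)^(-σ) := by
    have := hsum
    unfold LSum LSeriesSummable at this
    have := this.norm
    refine this.congr ?_
    intro n
    rcases eq_or_ne n 0 with rfl | hn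
    · simp
    · rw [LSeries.term_of_ne_zero hn, norm_div, norm_real, Real.norm_eq_abs, abs_of_nonneg (dx_nonneg hx0 n),
        norm_natCast_cpow_of_pos (Nat.pos_of_ne_zero hn), Real.rpow_neg (by positivity)]
      simp [div_eq_mul_inv]
  calc ∑ n ∈ Finset.Icc 1 N, dx (1/v) n ^ 2 / n ≤ ∑ n ∈ Finset.Icc 1 N, 3 * (dx x n * (n:ℝ)^(-σ)) := by
        refine Finset.sum_le_sum fun n hn => ?_
        have hn := Finset.mem_Icc.1 hn
        have hn0 : (0:ℝ) < n := by exact_mod_cast hn.1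
        have e1 : dx (1/v) n ^ 2 ≤ dx x n := by
          have := dx_sq (x := 1/(v:ℝ)) (by positivity) n
          refine this.trans (le_of_eq ?_)
          rw [hx]; congr 2; push_cast; field_simp
        have e2 : 1/(n:ℝ) ≤ 3 * (n:ℝ)^(-σ) := by
          have : (n:ℝ)^(-σ) = 1/(n:ℝ) * Real.exp (-(Real.log n/Real.log N)) := by
            rw [hσ, Real.rpow_def_of_pos hn0, ← Real.exp_log (x := 1/(n:ℝ)) (by positivity), ← Real.exp_add]
            congr 1
            rw [Real.log_div one_ne_zero hn0.ne', Real.log_one]; field_simp; ring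
          rw [this]
          have e3 : Real.log n/Real.log N ≤ 1 := by
            rw [div_le_one (by linarith)]
            exact Real.log_le_log hn0 (by exact_mod_cast hn.2)
          have e4 : 1 ≤ 3 * Real.exp (-(Real.log n/Real.log N)) := by
            have : Real.exp (-1) ≤ Real.exp (-(Real.log n/Real.log N)) := Real.exp_le_exp.2 (by linarith)
            have h5 : Real.exp (-1) * Real.exp 1 = 1 := by rw [← Real.exp_add]; simp
            have := Real.exp_one_lt_d9
            nlinarith [Real.exp_pos (-1)]
          have : 0 < 1/(n:ℝ) := by positivity
          nlinarith
        calc _ = dx (1/v) n ^ 2 * (1/n) := by ring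
          _ ≤ dx x n * (3 * (n:ℝ)^(-σ)) := mul_le_mul e1 e2 (by positivity) (dx_nonneg hx0 n)
          _ = _ := by ring
    _ = 3 * ∑ n ∈ Finset.Icc 1 N, (dx x n * (n:ℝ)^(-σ)) := by rw [Finset.mul_sum]
    _ ≤ 3 * D := by
        gcongr
        exact hs.sum_le_tsum _ (fun n _ => hDn n)
    _ ≤ _ := by gcongr

end ZA

open Complex MeasureTheory Set Filter Topology
namespace ZA

lemma gauss_int {T : ℝ} (hT : 0 < T) : Integrable fun t : ℝ => Real.exp (-(t/T)^2) := by
  refine (integrable_gauss' hT).mono' (by fun_prop) ?_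
  filter_upwards with t
  rw [Real.norm_eq_abs, Real.abs_exp]
  have : 0 ≤ |t| := abs_nonneg t
  nlinarith [Real.exp_pos (-(t/T)^2)]

lemma gauss_cos {T : ℝ} (hT : 0 < T) (w : ℝ) :
    ∫ t : ℝ, Real.cos (t*w) * Real.exp (-(t/T)^2) = T * Real.sqrt Real.pi * Real.exp (-T^2*w^2/4) := by
  have hb : 0 < ((1/T^2 : ℝ) : ℂ).re := by rw [ofReal_re]; positivity
  have h := fourierIntegral_gaussian hb w
  have h1 : ∀ t : ℝ, Real.cos (t*w) * Real.exp (-(t/T)^2) = (cexp (I * w * t) * cexp (-((1/T^2 : ℝ) : ℂ) * t^2)).re := by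
    intro t
    have e1 : cexp (-((1/T^2 : ℝ) : ℂ) * t^2) = ((Real.exp (-(t/T)^2) : ℝ) : ℂ) := by
      rw [ofReal_exp]; congr 1; push_cast; field_simp
    rw [e1, re_mul_ofReal, show I * (w:ℂ) * t = ((t*w:ℝ):ℂ) * I by push_cast; ring, exp_ofReal_mul_I_re]
  have h2 : Integrable fun t : ℝ => (cexp (I * w * t) * cexp (-((1/T^2 : ℝ) : ℂ) * t^2)) := by
    refine (gauss_int hT).mono' (by fun_prop) ?_
    filter_upwards with t
    rw [norm_mul, show I * (w:ℂ) * t = ((t*w:ℝ):ℂ) * I by push_cast; ring, norm_exp_ofReal_mul_I, one_mul, norm_exp]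
    refine le_of_eq ?_
    congr 1
    have : -((1/T^2 : ℝ) : ℂ) * t^2 = ((-(t/T)^2 : ℝ) : ℂ) := by push_cast; field_simp
    rw [this, ofReal_re]
  simp_rw [h1]
  have h3 := integral_re h2
  simp only [RCLike.re_eq_complex_re] at h3
  rw [h3, h]
  have e2 : ((Real.pi:ℂ) / ((1/T^2 : ℝ) : ℂ))^(1/2:ℂ) = ((T * Real.sqrt Real.pi : ℝ) : ℂ) := by
    rw [← ofReal_div, show (1/2:ℂ) = ((1/2:ℝ):ℂ) by push_cast; rfl, ← ofReal_cpow (by positivity), ← Real.sqrt_eq_rpow]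
    congr 1
    rw [div_div_eq_mul_div, div_one, Real.sqrt_mul Real.pi_pos.le, Real.sqrt_sq hT.le, mul_comm]
  have e3 : cexp (-(w:ℂ)^2 / (4 * ((1/T^2 : ℝ) : ℂ))) = ((Real.exp (-T^2*w^2/4) : ℝ) : ℂ) := by
    rw [ofReal_exp]; congr 1; push_cast; field_simp
  rw [e2, e3, ← ofReal_mul, ofReal_re]

lemma trig_sq (S : Finset ℕ) (a θ : ℕ → ℝ) (t : ℝ) :
    ‖∑ n ∈ S, (a n : ℂ) * cexp (((-(t*θ n) : ℝ) : ℂ) * I)‖^2 = ∑ m ∈ S, ∑ n ∈ S, a m * a n * Real.cos (t*(θ m - θ n)) := by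
  rw [← normSq_eq_norm_sq, normSq_apply, re_sum, im_sum]
  simp only [re_ofReal_mul, im_ofReal_mul, exp_ofReal_mul_I_re, exp_ofReal_mul_I_im, Real.cos_neg, Real.sin_neg]
  rw [Finset.sum_mul_sum, Finset.sum_mul_sum, ← Finset.sum_add_distrib]
  refine Finset.sum_congr rfl fun m _ => ?_
  rw [← Finset.sum_add_distrib]
  refine Finset.sum_congr rfl fun n _ => ?_
  rw [mul_sub, Real.cos_sub]; ring

lemma S_mean {N : ℕ} {c : ℕ → ℝ} (hc : ∀ n, 0 ≤ c n ∧ c n ≤ 1) {σ T : ℝ} (hσ : 1/2 ≤ σ) (hT : 0 < T) :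
    ∫ t : ℝ, ‖∑ n ∈ Finset.Icc 1 N, (c n : ℂ) * (n:ℂ)^(-((σ:ℂ)+t*I))‖^2 * Real.exp (-(t/T)^2)
      ≤ T * Real.sqrt Real.pi * (∑ n ∈ Finset.Icc 1 N, c n ^2 / n + N^2 * Real.exp (-T^2/(4*N^2))) := by
  set a : ℕ → ℝ := fun n => c n * (n:ℝ)^(-σ) with ha
  set S := Finset.Icc 1 N with hS
  have hS1 : ∀ n ∈ S, (1:ℝ) ≤ n ∧ (n:ℝ) ≤ N := by
    intro n hn
    have := Finset.mem_Icc.1 hn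
    exact ⟨by exact_mod_cast this.1, by exact_mod_cast this.2⟩
  have ha0 : ∀ n, 0 ≤ a n := fun n => mul_nonneg (hc n).1 (by positivity)
  have ha1 : ∀ n ∈ S, a n ≤ 1 := by
    intro n hn
    have : (n:ℝ)^(-σ) ≤ 1 := Real.rpow_le_one_of_one_le_of_nonpos (hS1 n hn).1 (by linarith)
    exact mul_le_one₀ (hc n).2 (by positivity) this
  have h1 : ∀ t : ℝ, ‖∑ n ∈ S, (c n : ℂ) * (n:ℂ)^(-((σ:ℂ)+t*I))‖^2 * Real.exp (-(t/T)^2)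
      = ∑ m ∈ S, ∑ n ∈ S, a m * a n * (Real.cos (t*(Real.log m - Real.log n)) * Real.exp (-(t/T)^2)) := by
    intro t
    have : ∑ n ∈ S, (c n : ℂ) * (n:ℂ)^(-((σ:ℂ)+t*I)) = ∑ n ∈ S, (a n : ℂ) * cexp (((-(t*Real.log n) : ℝ) : ℂ) * I) := by
      refine Finset.sum_congr rfl fun n hn => ?_
      have hn := (hS1 n hn).1
      have hn0 : (n:ℂ) ≠ 0 := by
        intro h; have : (n:ℝ) = 0 := by exact_mod_cast h
        linarith
      rw [ha]; simp only
      rw [neg_add, cpow_add _ _ hn0, ofReal_mul, mul_assoc, ofReal_cpow (by linarith)]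
      congr 2
      · push_cast; rfl
      · rw [cpow_def_of_ne_zero hn0, ← natCast_log]; push_cast; ring_nf
    rw [this, trig_sq, Finset.sum_mul]
    refine Finset.sum_congr rfl fun m _ => ?_
    rw [Finset.sum_mul]
    refine Finset.sum_congr rfl fun n _ => ?_
    ring
  simp_rw [h1]
  have hIntg : ∀ w : ℝ, Integrable fun t : ℝ => Real.cos (t*w) * Real.exp (-(t/T)^2) := by
    intro w
    refine (gauss_int hT).mono' (by fun_prop) ?_
    filter_upwards with t
    rw [norm_mul, Real.norm_eq_abs, Real.norm_eq_abs, Real.abs_exp]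
    have := Real.abs_cos_le_one (t*w)
    nlinarith [Real.exp_pos (-(t/T)^2)]
  rw [integral_finset_sum _ (fun m _ => integrable_finset_sum _ (fun n _ => (hIntg _).const_mul _))]
  have h2 : ∀ m ∈ S, ∫ t : ℝ, ∑ n ∈ S, a m * a n * (Real.cos (t*(Real.log m - Real.log n)) * Real.exp (-(t/T)^2))
      ≤ T * Real.sqrt Real.pi * (c m ^2 / m) + T * Real.sqrt Real.pi * (N * Real.exp (-T^2/(4*N^2))) := by
    intro m hm
    rw [integral_finset_sum _ (fun n _ => (hIntg _).const_mul _)]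
    simp_rw [integral_const_mul, gauss_cos hT]
    rw [← Finset.add_sum_erase _ _ hm]
    refine add_le_add ?_ ?_
    · have : a m * a m ≤ c m^2 / m := by
        rw [ha]; simp only
        have hm1 := (hS1 m hm).1
        have h3 : (m:ℝ)^(-σ) * (m:ℝ)^(-σ) ≤ 1/m := by
          rw [← Real.rpow_add (by linarith)]
          calc _ ≤ (m:ℝ)^(-1:ℝ) := Real.rpow_le_rpow_of_exponent_le hm1 (by linarith)
            _ = _ := by rw [Real.rpow_neg_one, one_div]
        calc _ = c m^2 * ((m:ℝ)^(-σ) * (m:ℝ)^(-σ)) := by ring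
          _ ≤ c m^2 * (1/m) := by gcongr
          _ = _ := by ring
      simp only [sub_self]
      have h0 : 0 ≤ T * Real.sqrt Real.pi := by positivity
      simp only [ne_eq, OfNat.ofNat_ne_zero, not_false_eq_true, zero_pow, mul_zero, zero_div, Real.exp_zero, mul_one]
      nlinarith
    · have hN1 : (1:ℝ) ≤ N := (hS1 m hm).1.trans (hS1 m hm).2
      have : ∀ n ∈ S.erase m, a m * a n * (T * Real.sqrt Real.pi * Real.exp (-T^2*(Real.log m - Real.log n)^2/4))
          ≤ T * Real.sqrt Real.pi * Real.exp (-T^2/(4*N^2)) := by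
        intro n hn
        have hnm := Finset.ne_of_mem_erase hn
        have hnS := Finset.mem_of_mem_erase hn
        have key : ∀ p q : ℕ, p ∈ S → q ∈ S → p < q → 1/(N:ℝ) ≤ Real.log q - Real.log p := by
          intro p q hp hq hpq
          have hp1 := hS1 p hp
          have hq1 := hS1 q hq
          have h3 : (p:ℝ) + 1 ≤ q := by exact_mod_cast hpq
          have h4 := Real.one_sub_inv_le_log_of_pos (x := (q:ℝ)/p) (by apply div_pos <;> linarith)
          rw [Real.log_div (by linarith) (by linarith), inv_div] at h4
          refine le_trans ?_ h4
          rw [show 1 - (p:ℝ)/q = (q-p)/q by rw [sub_div, div_self (by linarith)]]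
          rw [div_le_div_iff₀ (by linarith) (by linarith)]
          nlinarith
        have h5 : 1/(N:ℝ)^2 ≤ (Real.log m - Real.log n)^2 := by
          have : 0 < 1/(N:ℝ) := by positivity
          rw [← one_div_pow]
          rcases lt_or_gt_of_ne hnm with h | h
          · have := key n m hnS hm h
            gcongr
          · have := key m n hm hnS h
            rw [← neg_sub, neg_sq]
            gcongr
        have h6 : Real.exp (-T^2*(Real.log m - Real.log n)^2/4) ≤ Real.exp (-T^2/(4*N^2)) := by
          refine Real.exp_le_exp.2 ?_
          have := mul_le_mul_of_nonneg_left h5 (sq_nonneg T)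
          have h7 : -T^2/(4*(N:ℝ)^2) = -(T^2*(1/(N:ℝ)^2))/4 := by field_simp
          rw [h7]; linarith
        have h8 : a m * a n ≤ 1 := mul_le_one₀ (ha1 m hm) (ha0 n) (ha1 n hnS)
        calc _ ≤ 1 * (T * Real.sqrt Real.pi * Real.exp (-T^2/(4*N^2))) := by gcongr
          _ = _ := one_mul _
      refine (Finset.sum_le_card_nsmul _ _ _ this).trans ?_
      rw [nsmul_eq_mul]
      have h9 : ((S.erase m).card : ℝ) ≤ N := by
        have : (S.erase m).card ≤ N := (Finset.card_erase_le).trans (by rw [hS]; simp)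
        exact_mod_cast this
      calc _ ≤ (N:ℝ) * (T * Real.sqrt Real.pi * Real.exp (-T^2/(4*N^2))) := by gcongr
        _ = _ := by ring
  refine (Finset.sum_le_sum h2).trans (le_of_eq ?_)
  rw [Finset.sum_add_distrib, ← Finset.mul_sum, Finset.sum_const, hS, Nat.card_Icc, nsmul_eq_mul]
  push_cast
  ring

end ZA

open Complex MeasureTheory Set Filter Topology
namespace ZA

noncomputable def zz (s : ℂ) : ℂ := riemannZeta₁ s / (s+1)
noncomputable def ph (s : ℂ) : ℂ := (s-1)/(s+1)

lemma zeta1_eq {s : ℂ} (h : s ≠ 1) : riemannZeta₁ s = (s-1) * riemannZeta s := by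
  rw [riemannZeta_eq_inv_sub_mul h]
  have : s - 1 ≠ 0 := sub_ne_zero.2 h
  field_simp

lemma zz_eq {s : ℂ} (h : s ≠ 1) : zz s = ph s * riemannZeta s := by
  rw [zz, zeta1_eq h, ph]; ring

lemma add_one_ne {s : ℂ} (h : 0 < s.re) : s + 1 ≠ 0 := by
  intro h'; have := congrArg re h'; simp at this; linarith

lemma ph_le {s : ℂ} (h : 0 < s.re) : ‖ph s‖ ≤ 1 := by
  rw [ph, norm_div, div_le_one (norm_pos_iff.2 (add_one_ne h)), ← sq_le_sq₀ (norm_nonneg _) (norm_nonneg _),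
    ← normSq_eq_norm_sq, ← normSq_eq_norm_sq, normSq_apply, normSq_apply]
  simp; nlinarith

lemma zz_bound : ∃ C : ℝ, 1 ≤ C ∧ ∀ s : ℂ, 1/4 ≤ s.re → s.re ≤ 5 → ‖zz s‖ ≤ C * (1+|s.im|) := by
  obtain ⟨C, hC, h⟩ := zeta_bound
  refine ⟨1 + 5*C, by linarith, ?_⟩
  intro s h1 h2
  have hs1 := norm_add_one_ge (s := s) (by linarith)
  have hs : ‖s‖ ≤ 5 + |s.im| := by
    have := norm_le_abs_re_add_abs_im s
    rw [abs_of_pos (by linarith)] at this; linarith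
  have hab := abs_nonneg s.im
  rcases eq_or_ne s 1 with rfl | hne
  · simp [zz]; norm_num; linarith
  · have hp := ph_le (s := s) (by linarith)
    rw [zz_eq hne, norm_mul]
    have h3 : ‖ph s‖ * (1/‖s-1‖) ≤ 1 := by
      rw [ph, norm_div]
      have : 0 < ‖s-1‖ := norm_pos_iff.2 (sub_ne_zero.2 hne)
      rw [div_mul_div_comm, mul_one, mul_comm, div_mul_eq_div_div, div_self this.ne']
      rw [div_le_one (by linarith)]; exact hs1
    calc _ ≤ ‖ph s‖ * (1/‖s-1‖ + C * ‖s‖) := by gcongr; exact h s h1 hne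
      _ = ‖ph s‖ * (1/‖s-1‖) + ‖ph s‖ * (C * ‖s‖) := by ring
      _ ≤ 1 + 1 * (C * (5 + |s.im|)) := by gcongr
      _ ≤ _ := by nlinarith

lemma zz_diff {s : ℂ} (h : 0 < s.re) : DifferentiableAt ℂ zz s := by
  unfold zz
  exact (differentiable_riemannZeta₁ s).div (by fun_prop) (add_one_ne h)

lemma ph_diff {s : ℂ} (h : 0 < s.re) : DifferentiableAt ℂ ph s := by
  unfold ph
  exact DifferentiableAt.div (by fun_prop) (by fun_prop) (add_one_ne h)

noncomputable def SS (v N : ℕ) (s : ℂ) : ℂ := ∑ n ∈ Finset.Icc 1 N, (dx (1/v) n : ℂ) * (n:ℂ)^(-s)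

lemma SS_diff (v N : ℕ) : Differentiable ℂ (SS v N) := by
  intro s
  unfold SS
  refine DifferentiableAt.fun_sum fun n hn => ?_
  have hn := Finset.mem_Icc.1 hn
  refine DifferentiableAt.mul (by fun_prop) (DifferentiableAt.const_cpow (by fun_prop) (Or.inl ?_))
  exact_mod_cast (by omega : n ≠ 0)

lemma inv_le_one' {v : ℕ} (hv : 1 ≤ v) : (0:ℝ) ≤ 1/v ∧ (1:ℝ)/v ≤ 1 := by
  have : (1:ℝ) ≤ v := by exact_mod_cast hv
  exact ⟨by positivity, by rw [div_le_one (by linarith)]; exact this⟩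

lemma SS_bound {v : ℕ} (hv : 1 ≤ v) (N : ℕ) {s : ℂ} (hs : 0 ≤ s.re) : ‖SS v N s‖ ≤ N := by
  unfold SS
  refine (norm_sum_le _ _).trans ?_
  have : ∀ n ∈ Finset.Icc 1 N, ‖(dx (1/v) n : ℂ) * (n:ℂ)^(-s)‖ ≤ 1 := by
    intro n hn
    have hn := Finset.mem_Icc.1 hn
    have h1 := dx_nonneg (inv_le_one' hv).1 n
    have h2 := dx_le_one (inv_le_one' hv).1 (inv_le_one' hv).2 n
    rw [norm_mul, norm_real, Real.norm_eq_abs, abs_of_nonneg h1, norm_natCast_cpow_of_pos (by omega)]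
    refine mul_le_one₀ h2 (by positivity) (Real.rpow_le_one_of_one_le_of_nonpos (by exact_mod_cast hn.1) (by simpa using hs))
  refine (Finset.sum_le_card_nsmul _ _ _ this).trans ?_
  simp

/-- mean value of the Dirichlet polynomial -/
lemma D_bound : ∃ C : ℝ, 1 ≤ C ∧ ∀ v N : ℕ, ∀ T : ℝ, 1 ≤ v → 3 ≤ N → (N:ℝ)^10 ≤ T^9 → 10 ≤ T →
    1 ≤ Real.log (Real.log T) → Real.log (Real.log T) ≤ (v:ℝ)^2 → ∀ σ : ℝ, 1/2 ≤ σ →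
    MM (2/v) T (fun s => SS v N s ^ v) σ ≤ C * T := by
  obtain ⟨C, hC, hd⟩ := diag_sum
  refine ⟨Real.sqrt Real.pi * (3 * (C * Real.exp 1) + (Nat.factorial 9) * 4^9), ?_, ?_⟩
  · have h1 : 1 ≤ Real.sqrt Real.pi := by rw [Real.one_le_sqrt]; linarith [Real.pi_gt_three]
    have h2 : 1 ≤ 3 * (C * Real.exp 1) + ((Nat.factorial 9 : ℕ) : ℝ) * 4^9 := by
      have : (1:ℝ) ≤ ((Nat.factorial 9 : ℕ) : ℝ) * 4^9 := by norm_num [Nat.factorial]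
      have : 0 ≤ 3 * (C * Real.exp 1) := by positivity
      linarith
    nlinarith
  intro v N T hv hN hNT hT hLL hv2 σ hσ
  have hv0 : (0:ℝ) < v := by exact_mod_cast hv
  have hN0 : (3:ℝ) ≤ N := by exact_mod_cast hN
  have e1 : MM (2/v) T (fun s => SS v N s ^ v) σ
      = ∫ t : ℝ, ‖∑ n ∈ Finset.Icc 1 N, (dx (1/v) n : ℂ) * (n:ℂ)^(-((σ:ℂ)+t*I))‖^2 * Real.exp (-(t/T)^2) := by
    unfold MM
    congr 1; ext t
    congr 1
    rw [norm_pow, ← Real.rpow_natCast, ← Real.rpow_mul (norm_nonneg _), mul_div_cancel₀ _ hv0.ne', SS]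
    norm_num
  rw [e1]
  refine (S_mean (fun n => ⟨dx_nonneg (inv_le_one' hv).1 n, dx_le_one (inv_le_one' hv).1 (inv_le_one' hv).2 n⟩) hσ (by linarith)).trans ?_
  have hL1 : 1 ≤ Real.log T := by
    by_contra h
    push Not at h
    have h0 : 0 ≤ Real.log T := Real.log_nonneg (by linarith)
    have := Real.log_nonpos h0 h.le
    linarith
  have hlogN : Real.log N ≤ Real.log T := by
    have h1 := Real.log_le_log (by positivity) hNT
    rw [Real.log_pow, Real.log_pow] at h1
    push_cast at h1
    linarith
  have hlogN0 : 0 < Real.log N := Real.log_pos (by linarith)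
  have h2 : ∑ n ∈ Finset.Icc 1 N, dx (1/v) n ^ 2 / n ≤ 3 * (C * Real.exp 1) := by
    refine (hd v hv N hN).trans ?_
    gcongr
    calc (C * Real.log N)^(1/(v:ℝ)^2) ≤ (C * Real.log T)^(1/(v:ℝ)^2) := by gcongr
      _ ≤ (C * Real.log T)^(1/Real.log (Real.log T)) := by
        apply Real.rpow_le_rpow_of_exponent_le (by nlinarith)
        gcongr
      _ ≤ _ := by
        rw [Real.rpow_def_of_pos (by positivity), Real.log_mul (by positivity) (by positivity), ← Real.exp_log (x := C) (by linarith), ← Real.exp_add]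
        refine Real.exp_le_exp.2 ?_
        rw [Real.log_exp]
        have : 0 ≤ Real.log C := Real.log_nonneg hC
        rw [mul_one_div, div_le_iff₀ (by linarith)]
        nlinarith
  have h3 : (N:ℝ)^2 * Real.exp (-T^2/(4*N^2)) ≤ (Nat.factorial 9) * 4^9 := by
    set x := T^2/(4*(N:ℝ)^2) with hx
    have hx0 : 0 < x := by positivity
    have h4 := Real.pow_div_factorial_le_exp x hx0.le 9
    have h5 : Real.exp (-T^2/(4*N^2)) * Real.exp x = 1 := by
      rw [← Real.exp_add, hx, neg_div, neg_add_cancel, Real.exp_zero]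
    have h6 : Real.exp (-T^2/(4*N^2)) ≤ (Nat.factorial 9) / x^9 := by
      rw [le_div_iff₀ (by positivity)]
      rw [div_le_iff₀ (by positivity)] at h4
      calc _ ≤ Real.exp (-T^2/(4*N^2)) * (Real.exp x * (Nat.factorial 9)) := by gcongr
        _ = (Real.exp (-T^2/(4*N^2)) * Real.exp x) * (Nat.factorial 9) := by ring
        _ = _ := by rw [h5, one_mul]
    calc _ ≤ (N:ℝ)^2 * ((Nat.factorial 9) / x^9) := by gcongr
      _ = (Nat.factorial 9) * 4^9 * (((N:ℝ)^10)^2 / (T^9)^2) := by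
        rw [hx]; field_simp
      _ ≤ (Nat.factorial 9) * 4^9 * 1 := by
        gcongr
        rw [div_le_one (by positivity)]
        gcongr
      _ = _ := mul_one _
  calc _ ≤ T * Real.sqrt Real.pi * (3 * (C * Real.exp 1) + (Nat.factorial 9) * 4^9) := by gcongr
    _ = _ := by ring

lemma g_five : ∃ C : ℝ, 1 ≤ C ∧ ∀ v N : ℕ, 1 ≤ v → 1 ≤ N → ∀ s : ℂ, s.re = 5 →
    ‖riemannZeta s - SS v N s ^ v‖ ≤ C * ((N:ℝ)^3)⁻¹ := by
  have hsum : Summable fun n : ℕ => ((n:ℝ)^2)⁻¹ := Real.summable_nat_pow_inv.2 (by norm_num)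
  refine ⟨1 + ∑' n : ℕ, ((n:ℝ)^2)⁻¹, ?_, ?_⟩
  · have : 0 ≤ ∑' n : ℕ, ((n:ℝ)^2)⁻¹ := tsum_nonneg fun n => by positivity
    linarith
  intro v N hv hN s hs
  obtain ⟨b, hb1, hb2, hb3⟩ := power_coeff hv N
  have h1 : (1:ℝ) < s.re := by rw [hs]; norm_num
  have h2 := LSeriesHasSum_one h1
  have h3 := (hb3 s).1.LSeriesHasSum
  rw [(hb3 s).2] at h3
  unfold LSeriesHasSum at h2 h3
  have h4 := h2.sub h3
  have hN0 : (1:ℝ) ≤ N := by exact_mod_cast hN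
  have h5 : ‖riemannZeta s - SS v N s ^ v‖ ≤ ∑' n : ℕ, ((n:ℝ)^2)⁻¹ * ((N:ℝ)^3)⁻¹ := by
    unfold SS
    rw [← h4.tsum_eq]
    refine tsum_of_norm_bounded (hsum.mul_right _).hasSum ?_
    intro n
    rcases eq_or_ne n 0 with rfl | hn
    · simp
    rw [LSeries.term_of_ne_zero hn, LSeries.term_of_ne_zero hn]
    rcases le_or_gt n N with h | h
    · rw [hb2 n (by omega) h]; simp; positivity
    · have hn0 : (0:ℝ) < n := by exact_mod_cast Nat.pos_of_ne_zero hn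
      have hNn : (N:ℝ) ≤ n := by exact_mod_cast h.le
      rw [← sub_div, norm_div, norm_natCast_cpow_of_pos (Nat.pos_of_ne_zero hn), hs]
      have e1 : ‖(1:ℕ → ℂ) n - (b n : ℂ)‖ ≤ 1 := by
        rw [show (1:ℕ → ℂ) n - (b n : ℂ) = ((1 - b n : ℝ) : ℂ) by simp, norm_real, Real.norm_eq_abs, abs_le]
        constructor <;> linarith [(hb1 n).1, (hb1 n).2]
      have e2 : (n:ℝ)^(5:ℝ) = (n:ℝ)^2 * (n:ℝ)^3 := by
        rw [show (5:ℝ) = ((5:ℕ):ℝ) by norm_num, Real.rpow_natCast]; ring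
      rw [e2]
      calc _ ≤ 1 / ((n:ℝ)^2 * (n:ℝ)^3) := by gcongr
        _ ≤ 1 / ((n:ℝ)^2 * (N:ℝ)^3) := by gcongr
        _ = _ := by rw [one_div, mul_inv]
  rw [tsum_mul_right] at h5
  refine h5.trans ?_
  gcongr
  linarith

end ZA

open Complex MeasureTheory Set Filter Topology
namespace ZA

lemma line_ne {σ : ℝ} (t : ℝ) (h : σ ≠ 1 ∨ t ≠ 0) : (σ:ℂ) + t * I ≠ 1 := by
  intro h'
  have h1 := congrArg re h'
  have h2 := congrArg im h'
  rw [re_mk'] at h1; rw [im_mk'] at h2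
  simp at h1 h2
  rcases h with h | h
  · exact h h1
  · exact h h2

lemma line_cont {h : ℂ → ℂ} {σ : ℝ} (hσ : 0 < σ) (hh : ∀ s : ℂ, 0 < s.re → DifferentiableAt ℂ h s) :
    Continuous (fun t : ℝ => h (σ + t * I)) := by
  rw [continuous_iff_continuousAt]
  intro t
  have h1 : ContinuousAt h (σ + t * I) := (hh _ (by rw [re_mk']; exact hσ)).continuousAt
  exact ContinuousAt.comp (f := fun t : ℝ => (σ:ℂ) + t * I) h1 (by fun_prop)

lemma MM_tri {p T σ : ℝ} {f g h : ℂ → ℂ} (hp : 0 < p) (hp1 : p ≤ 1)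
    (hg : Integrable (fun t : ℝ => ‖g (σ + t * I)‖ ^ p * Real.exp (-(t / T) ^ 2)))
    (hh : Integrable (fun t : ℝ => ‖h (σ + t * I)‖ ^ p * Real.exp (-(t / T) ^ 2)))
    (hle : ∀ t : ℝ, ‖f (σ + t * I)‖ ≤ ‖g (σ + t * I)‖ + ‖h (σ + t * I)‖) :
    MM p T f σ ≤ MM p T g σ + MM p T h σ := by
  unfold MM
  rw [← integral_add hg hh]
  refine integral_mono_of_nonneg (Eventually.of_forall fun t => by positivity) (hg.add hh)
    (Eventually.of_forall fun t => ?_)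
  simp only
  rw [← add_mul]
  gcongr
  exact (Real.rpow_le_rpow (norm_nonneg _) (hle t) hp.le).trans
    (Real.rpow_add_le_add_rpow (norm_nonneg _) (norm_nonneg _) hp.le hp1)

lemma MM_mono {p T σ : ℝ} {f g : ℂ → ℂ} (hp : 0 < p)
    (hg : Integrable (fun t : ℝ => ‖g (σ + t * I)‖ ^ p * Real.exp (-(t / T) ^ 2)))
    (hle : ∀ t : ℝ, ‖f (σ + t * I)‖ ≤ ‖g (σ + t * I)‖) :
    MM p T f σ ≤ MM p T g σ := by
  unfold MM
  refine integral_mono_of_nonneg (Eventually.of_forall fun t => by positivity) hg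
    (Eventually.of_forall fun t => ?_)
  simp only
  gcongr
  exact hle t

lemma gauss_total {T : ℝ} (hT : 0 < T) : ∫ t : ℝ, Real.exp (-(t/T)^2) ≤ 2 * T := by
  have := gauss_cos hT 0
  simp at this
  have h4 : √Real.pi ≤ 2 := by
    rw [Real.sqrt_le_left (by norm_num)]; linarith [Real.pi_le_four]
  simp only [Real.exp_neg] at this ⊢
  nlinarith [Real.pi_pos]

set_option maxHeartbeats 1600000 in
lemma stepA : ∃ C : ℝ, 1 ≤ C ∧ ∀ v N : ℕ, ∀ T : ℝ, 2 ≤ v → 3 ≤ N → (N:ℝ)^10 ≤ T^9 → 10 ≤ T →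
    1 ≤ Real.log (Real.log T) → Real.log (Real.log T) ≤ (v:ℝ)^2 → ∀ σ : ℝ, 1/2 ≤ σ → σ ≤ 5 →
    MM (2/v) T zz σ ≤ C * T + 2 * Real.exp (-((4/3) * (Real.log N / v) * (σ - 1/2))) *
      (MM (2/v) T zz (1/2) + C * T) := by
  obtain ⟨C1, hC1, h1⟩ := D_bound
  obtain ⟨C2, hC2, h2⟩ := g_five
  obtain ⟨C3, hC3, h3⟩ := zz_bound
  refine ⟨C1 + 2 * C2, by linarith, ?_⟩
  intro v N T hv hN hNT hT hLL hLv σ hσ hσ5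
  have hT0 : 0 < T := by linarith
  have hv' : (2:ℝ) ≤ v := by exact_mod_cast hv
  have hN' : (3:ℝ) ≤ N := by exact_mod_cast hN
  set p : ℝ := 2 / v with hp
  have hp0 : 0 < p := by positivity
  have hp1 : p ≤ 1 := by rw [hp, div_le_one (by linarith)]; exact hv'
  have hNv : (1:ℝ) ≤ (N:ℝ)^v := one_le_pow₀ (by linarith)
  have bSv : ∀ s : ℂ, 0 < s.re → ‖SS v N s ^ v‖ ≤ (N:ℝ)^v := by
    intro s hs
    rw [norm_pow]
    exact pow_le_pow_left₀ (norm_nonneg _) (SS_bound (by omega) N hs.le) v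
  have bD : ∀ s : ℂ, 0 < s.re → ‖ph s * SS v N s ^ v‖ ≤ ‖SS v N s ^ v‖ := by
    intro s hs
    rw [norm_mul]
    nlinarith [ph_le hs, norm_nonneg (SS v N s ^ v)]
  have dSv : ∀ s : ℂ, 0 < s.re → DifferentiableAt ℂ (fun s => SS v N s ^ v) s :=
    fun s _ => ((SS_diff v N) s).pow v
  have dD : ∀ s : ℂ, 0 < s.re → DifferentiableAt ℂ (fun s => ph s * SS v N s ^ v) s :=
    fun s hs => (ph_diff hs).mul (dSv s hs)
  have dG : ∀ s : ℂ, 0 < s.re → DifferentiableAt ℂ (fun s => zz s - ph s * SS v N s ^ v) s :=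
    fun s hs => (zz_diff hs).sub (dD s hs)
  have bG : ∀ s : ℂ, 1/2 ≤ s.re → s.re ≤ 5 →
      ‖zz s - ph s * SS v N s ^ v‖ ≤ (C3 + (N:ℝ)^v) * (1+|s.im|) := by
    intro s hs hs5
    have e1 := norm_sub_le (zz s) (ph s * SS v N s ^ v)
    have e2 := h3 s (by linarith) hs5
    have e3 := bD s (by linarith)
    have e4 := bSv s (by linarith)
    nlinarith [abs_nonneg s.im]
  have iSv : ∀ σ : ℝ, 1/2 ≤ σ → σ ≤ 5 → Integrable (fun t : ℝ => ‖SS v N (σ + t * I) ^ v‖ ^ p * Real.exp (-(t / T) ^ 2)) := by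
    intro σ hσ hσ5
    refine MM_integrable (h := fun s => SS v N s ^ v) hp0 hp1 hT0 hNv (line_cont (by linarith) dSv) ?_
    intro t
    have := bSv (σ + t * I) (by rw [re_mk']; linarith)
    nlinarith [abs_nonneg t]
  have iD : ∀ σ : ℝ, 1/2 ≤ σ → σ ≤ 5 → Integrable (fun t : ℝ => ‖ph (σ + t * I) * SS v N (σ + t * I) ^ v‖ ^ p * Real.exp (-(t / T) ^ 2)) := by
    intro σ hσ hσ5
    refine MM_integrable (h := fun s => ph s * SS v N s ^ v) hp0 hp1 hT0 hNv (line_cont (by linarith) dD) ?_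
    intro t
    have := bSv (σ + t * I) (by rw [re_mk']; linarith)
    have := bD (σ + t * I) (by rw [re_mk']; linarith)
    nlinarith [abs_nonneg t]
  have iG : ∀ σ : ℝ, 1/2 ≤ σ → σ ≤ 5 → Integrable (fun t : ℝ => ‖zz (σ + t * I) - ph (σ + t * I) * SS v N (σ + t * I) ^ v‖ ^ p * Real.exp (-(t / T) ^ 2)) := by
    intro σ hσ hσ5
    refine MM_integrable (h := fun s => zz s - ph s * SS v N s ^ v) (C := C3 + (N:ℝ)^v) hp0 hp1 hT0 (by linarith) (line_cont (by linarith) dG) ?_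
    intro t
    have := bG (σ + t * I) (by rw [re_mk']; linarith) (by rw [re_mk']; linarith)
    rwa [im_mk'] at this
  have iz : ∀ σ : ℝ, 1/2 ≤ σ → σ ≤ 5 → Integrable (fun t : ℝ => ‖zz (σ + t * I)‖ ^ p * Real.exp (-(t / T) ^ 2)) := by
    intro σ hσ hσ5
    refine MM_integrable (h := zz) (C := C3) hp0 hp1 hT0 hC3 (line_cont (by linarith) fun s hs => zz_diff hs) ?_
    intro t
    have := h3 (σ + t * I) (by rw [re_mk']; linarith) (by rw [re_mk']; linarith)
    rwa [im_mk'] at this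
  have mD : ∀ σ : ℝ, 1/2 ≤ σ → σ ≤ 5 → MM p T (fun s => ph s * SS v N s ^ v) σ ≤ C1 * T := by
    intro σ hσ hσ5
    refine le_trans (MM_mono (f := fun s => ph s * SS v N s ^ v) (g := fun s => SS v N s ^ v) hp0 (iSv σ hσ hσ5) fun t => ?_) (h1 v N T (by omega) hN hNT hT hLL hLv σ hσ)
    exact bD _ (by rw [re_mk']; linarith)
  have JK : MM p T zz σ ≤ MM p T (fun s => zz s - ph s * SS v N s ^ v) σ + C1 * T := by
    refine le_trans (MM_tri (f := zz) (g := fun s => zz s - ph s * SS v N s ^ v) (h := fun s => ph s * SS v N s ^ v) hp0 hp1 (iG σ hσ hσ5) (iD σ hσ hσ5) fun t => ?_) (by gcongr; exact mD σ hσ hσ5)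
    exact norm_le_norm_sub_add _ _
  have KJ : MM p T (fun s => zz s - ph s * SS v N s ^ v) (1/2) ≤ MM p T zz (1/2) + C1 * T := by
    refine le_trans (MM_tri (f := fun s => zz s - ph s * SS v N s ^ v) (g := zz) (h := fun s => ph s * SS v N s ^ v) hp0 hp1 (iz (1/2) (by norm_num) (by norm_num)) (iD (1/2) (by norm_num) (by norm_num)) fun t => ?_) (by gcongr; exact mD (1/2) (by norm_num) (by norm_num))
    exact norm_sub_le _ _
  have hmax := MM_max (lam := (4/3) * (Real.log N / v)) hp0 hp1 hT (C := C3 + (N:ℝ)^v) (by linarith) (a := 1/2) (b := 5) (by norm_num)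
    (by norm_num [abs_le]) (by norm_num [abs_le]) (h := fun s => zz s - ph s * SS v N s ^ v)
    (fun s hs => by
      have hs' : 0 < s.re := by have := hs.1; linarith
      refine DifferentiableOn.analyticAt (s := {s : ℂ | 0 < s.re}) (fun z hz => (dG z hz).differentiableWithinAt) ?_
      exact (isOpen_lt continuous_const continuous_re).mem_nhds hs')
    bG σ ⟨hσ, hσ5⟩
  have K5 : MM p T (fun s => zz s - ph s * SS v N s ^ v) 5 ≤ Real.exp (-(6 * (Real.log N / v))) * (2 * C2 * T) := by
    have : MM p T (fun s => zz s - ph s * SS v N s ^ v) 5 ≤ ∫ t : ℝ, (Real.exp (-(6 * (Real.log N / v))) * C2) * Real.exp (-(t/T)^2) := by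
      unfold MM
      refine integral_mono_of_nonneg (Eventually.of_forall fun t => by positivity) ((gauss_int hT0).const_mul _)
        (Eventually.of_forall fun t => ?_)
      simp only
      gcongr
      have e0 : ((5:ℝ):ℂ) + t * I ≠ 1 := line_ne t (Or.inl (by norm_num))
      rw [zz_eq e0, ← mul_sub, norm_mul]
      have e1 := h2 v N (by omega) (by omega) (((5:ℝ):ℂ) + t * I) (by rw [re_mk'])
      have e2 := ph_le (s := ((5:ℝ):ℂ) + t * I) (by rw [re_mk']; norm_num)
      have e3 : ‖ph (((5:ℝ):ℂ) + t * I)‖ * ‖riemannZeta (((5:ℝ):ℂ) + t * I) - SS v N (((5:ℝ):ℂ) + t * I) ^ v‖ ≤ C2 * ((N:ℝ)^3)⁻¹ := by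
        nlinarith [norm_nonneg (ph (((5:ℝ):ℂ) + t * I)), norm_nonneg (riemannZeta (((5:ℝ):ℂ) + t * I) - SS v N (((5:ℝ):ℂ) + t * I) ^ v)]
      refine (Real.rpow_le_rpow (by positivity) e3 hp0.le).trans ?_
      rw [Real.mul_rpow (by linarith) (by positivity), mul_comm]
      gcongr
      · rw [Real.rpow_def_of_pos (by positivity), Real.log_inv, Real.log_pow, hp]
        apply le_of_eq; congr 1; push_cast; field_simp; ring
      · calc C2 ^ p ≤ C2 ^ (1:ℝ) := Real.rpow_le_rpow_of_exponent_le hC2 hp1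
          _ = C2 := Real.rpow_one _
    rw [integral_const_mul] at this
    refine this.trans ?_
    rw [mul_assoc]
    refine mul_le_mul_of_nonneg_left ?_ (Real.exp_pos _).le
    nlinarith [gauss_total hT0]
  refine JK.trans ?_
  set J := MM p T zz (1/2)
  have hJ0 : 0 ≤ J := MM_nonneg _ _ _ _
  set E := Real.exp (-((4/3) * (Real.log N / v) * (σ - 1/2)))
  have hE : 0 < E := Real.exp_pos _
  have m1 : Real.exp ((4/3) * (Real.log N / v) * (1/2 - σ)) = E := by
    simp only [E]; congr 1; ring
  have m2 : Real.exp ((4/3) * (Real.log N / v) * (5 - σ)) * Real.exp (-(6 * (Real.log N / v))) = E := by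
    rw [← Real.exp_add]; simp only [E]; congr 1; ring
  have hb : max (Real.exp ((4/3) * (Real.log N / v) * (1/2 - σ)) * MM p T (fun s => zz s - ph s * SS v N s ^ v) (1/2))
      (Real.exp ((4/3) * (Real.log N / v) * (5 - σ)) * MM p T (fun s => zz s - ph s * SS v N s ^ v) 5) ≤ E * (J + (C1 + 2*C2)*T) := by
    refine max_le ?_ ?_
    · rw [m1]; gcongr; nlinarith
    · calc _ ≤ Real.exp ((4/3) * (Real.log N / v) * (5 - σ)) * (Real.exp (-(6 * (Real.log N / v))) * (2 * C2 * T)) := by gcongr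
        _ = E * (2 * C2 * T) := by rw [← mul_assoc, m2]
        _ ≤ _ := by gcongr; nlinarith
  nlinarith
end ZA

open Complex MeasureTheory Set Filter Topology
namespace ZA

lemma zz_fe {σ t : ℝ} (h1 : 1/2 ≤ σ) (h2 : σ ≤ 3/4) (ht : t ≠ 0) :
    ‖zz (((1-σ:ℝ):ℂ) + t * I)‖ ≤ 9 * ‖XX (σ + t * I)‖ * ‖zz (σ + t * I)‖ := by
  set s : ℂ := σ + t * I with hs
  have hre : s.re = σ := re_mk' _ _
  have him : s.im = t := im_mk' _ _
  have hfe := zeta_fe (s := s) (by rw [him]; exact ht)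
  have hconj : ((1-σ:ℝ):ℂ) + t * I = (starRingEnd ℂ) (1 - s) := by
    apply Complex.ext
    · rw [re_mk']; simp [hre]
    · rw [im_mk']; simp [him]
  rw [zz_eq (line_ne t (Or.inr ht)), zz_eq (s := s) (line_ne t (Or.inr ht)), norm_mul, norm_mul]
  have e1 := ph_le (s := ((1-σ:ℝ):ℂ) + t * I) (by rw [re_mk']; linarith)
  have e2 : ‖riemannZeta (((1-σ:ℝ):ℂ) + t * I)‖ = ‖XX s‖ * ‖riemannZeta s‖ := by
    rw [hconj, riemannZeta_conj, RCLike.norm_conj, hfe, norm_mul]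
  have e3 : 1 ≤ 9 * ‖ph s‖ := by
    have hp : 0 < ‖s+1‖ := norm_pos_iff.2 (add_one_ne (by rw [hre]; linarith))
    rw [ph, norm_div, ← mul_div_assoc, le_div_iff₀ hp, one_mul]
    rw [← sq_le_sq₀ (norm_nonneg _) (by positivity), mul_pow, ← normSq_eq_norm_sq, ← normSq_eq_norm_sq, normSq_apply, normSq_apply]
    simp [hre, him]; nlinarith [sq_nonneg t]
  rw [e2]
  calc ‖ph (((1-σ:ℝ):ℂ) + t * I)‖ * (‖XX s‖ * ‖riemannZeta s‖) ≤ 1 * (‖XX s‖ * ‖riemannZeta s‖) := by gcongr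
    _ ≤ (9 * ‖ph s‖) * (‖XX s‖ * ‖riemannZeta s‖) := by gcongr
    _ = _ := by ring

lemma tail_pt {T t C x : ℝ} (hT : 10 ≤ T) (hC : 1 ≤ C) (ht : T^11 ≤ |t|^10) (hx : x ≤ C * (1+|t|)) :
    x * Real.exp (-(t/T)^2) ≤ (4 * C * (Nat.factorial 22)) * (1+t^2)⁻¹ := by
  have hT0 : 0 < T := by linarith
  have ht1 : 1 ≤ |t| := by
    by_contra h
    push Not at h
    have h1 : |t|^10 ≤ 1 := pow_le_one₀ (abs_nonneg _) h.le
    have h2 : (1:ℝ) < T^11 := one_lt_pow₀ (by linarith) (by norm_num)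
    linarith
  have hf := Real.pow_div_factorial_le_exp ((t/T)^2) (sq_nonneg _) 22
  have h44 : t^4 ≤ ((t/T)^2)^22 := by
    rw [← pow_mul, div_pow, le_div_iff₀ (by positivity)]
    have : T^44 ≤ t^40 := by
      calc T^44 = (T^11)^4 := by ring
        _ ≤ (|t|^10)^4 := by gcongr
        _ = t^40 := by rw [← pow_mul]; exact Even.pow_abs (by decide) t
    calc t^4 * T^(2*22) ≤ t^4 * t^40 := by gcongr
      _ = _ := by ring
  have ht4 : 0 < t^4 := by
    have : t ≠ 0 := by intro h; simp [h] at ht1; linarith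
    positivity
  set F : ℝ := ((Nat.factorial 22 : ℕ) : ℝ) with hF
  have hF0 : 0 < F := by rw [hF]; exact_mod_cast Nat.factorial_pos 22
  have he : Real.exp (-(t/T)^2) ≤ F / t^4 := by
    rw [Real.exp_neg, inv_le_comm₀ (Real.exp_pos _) (by positivity), inv_div]
    refine le_trans ?_ hf
    gcongr
  have hx2 : C * (1+|t|) ≤ 2*C*|t| := by nlinarith
  calc x * Real.exp (-(t/T)^2) ≤ (2*C*|t|) * (F / t^4) := by
        apply mul_le_mul (hx.trans hx2) he (Real.exp_pos _).le (by positivity)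
    _ ≤ _ := by
      rw [← div_eq_mul_inv, mul_div_assoc', div_le_div_iff₀ ht4 (by positivity)]
      have a4 : t^4 = |t|^4 := by rw [← abs_pow, abs_of_nonneg ht4.le]
      have a2 : t^2 = |t|^2 := by rw [sq_abs]
      rw [a4, a2]
      set y := |t|
      have : y * (1+y^2) ≤ 2 * y^4 := by nlinarith [pow_pos (by linarith : 0 < y) 2, pow_pos (by linarith : 0 < y) 3, mul_le_mul_of_nonneg_left ht1 (by positivity : 0 ≤ y), mul_le_mul_of_nonneg_left ht1 (by positivity : 0 ≤ y^3), mul_le_mul_of_nonneg_left ht1 (by positivity : 0 ≤ y^2)]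
      nlinarith [mul_le_mul_of_nonneg_left this (by positivity : 0 ≤ 2*C*F)]

lemma stepB : ∃ C : ℝ, 1 ≤ C ∧ ∀ v : ℕ, ∀ T A : ℝ, 2 ≤ v → 10 ≤ T → 1 ≤ Real.log T → 0 < A →
    A * v / Real.log T ≤ 1/4 → 
    MM (2/v) T zz (1 - (1/2 + A * v / Real.log T)) ≤ C * Real.exp (2.2 * A) * MM (2/v) T zz (1/2 + A * v / Real.log T) + C := by
  obtain ⟨C3, hC3, h3⟩ := zz_bound
  obtain ⟨C1, hC1, h1⟩ := XX_bd
  refine ⟨18 * C1 + (4 * C3 * (Nat.factorial 22)) * Real.pi, ?_, ?_⟩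
  · have := Real.pi_pos
    have : 0 ≤ (4 * C3 * (Nat.factorial 22)) * Real.pi := by positivity
    linarith
  intro v T A hv hT hL hA hh
  have hT0 : 0 < T := by linarith
  have hv' : (2:ℝ) ≤ v := by exact_mod_cast hv
  set p : ℝ := 2 / v with hp
  have hp0 : 0 < p := by positivity
  have hp1 : p ≤ 1 := by rw [hp, div_le_one (by linarith)]; exact hv'
  set L := Real.log T with hLd
  have hL0 : 0 < L := by linarith
  set h : ℝ := A * v / L with hhd
  have hh0 : 0 < h := by positivity
  have hhp : h * p = 2 * A / L := by rw [hhd, hp]; field_simp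
  have hAL : 2 * A / L ≤ 1 := by rw [← hhp]; nlinarith
  set F : ℝ := ((Nat.factorial 22 : ℕ) : ℝ) with hF
  have iz : Integrable (fun t : ℝ => ‖zz (((1/2 + h : ℝ):ℂ) + t * I)‖ ^ p * Real.exp (-(t / T) ^ 2)) := by
    refine MM_integrable (h := zz) (C := C3) hp0 hp1 hT0 hC3 (line_cont (by linarith) fun s hs => zz_diff hs) ?_
    intro t
    have := h3 (((1/2 + h : ℝ):ℂ) + t * I) (by rw [re_mk']; linarith) (by rw [re_mk']; linarith)
    rwa [im_mk'] at this
  have key : ∀ t : ℝ, t ≠ 0 → ‖zz (((1 - (1/2 + h) : ℝ):ℂ) + t * I)‖ ^ p * Real.exp (-(t / T) ^ 2) ≤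
      (18 * C1 * Real.exp (2.2 * A)) * (‖zz (((1/2 + h : ℝ):ℂ) + t * I)‖ ^ p * Real.exp (-(t / T) ^ 2)) + (4 * C3 * F) * (1+t^2)⁻¹ := by
    intro t ht
    rcases le_total (T^11) (|t|^10) with hc | hc
    · have e1 := h3 (((1 - (1/2 + h) : ℝ):ℂ) + t * I) (by rw [re_mk']; linarith) (by rw [re_mk']; linarith)
      rw [im_mk'] at e1
      have e2 := tail_pt hT hC3 hc (rpow_bound (norm_nonneg _) hC3 hp0 hp1 e1)
      have : 0 ≤ (18 * C1 * Real.exp (2.2 * A)) * (‖zz (((1/2 + h : ℝ):ℂ) + t * I)‖ ^ p * Real.exp (-(t / T) ^ 2)) := by positivity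
      linarith
    · have e1 := zz_fe (σ := 1/2+h) (by linarith) (by linarith) ht
      have e2 := h1 (((1/2 + h : ℝ):ℂ) + t * I) (by rw [re_mk']; linarith) (by rw [re_mk']; linarith)
      rw [re_mk', im_mk'] at e2
      have e3 : ‖zz (((1 - (1/2 + h) : ℝ):ℂ) + t * I)‖ ^ p ≤ (18 * C1 * Real.exp (2.2 * A)) * ‖zz (((1/2 + h : ℝ):ℂ) + t * I)‖ ^ p := by
        have f1 : 9 * ‖XX (((1/2 + h : ℝ):ℂ) + t * I)‖ ≤ 9 * C1 * (1+|t|)^h := by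
          have : (1/2 + h - 1/2 : ℝ) = h := by ring
          rw [this] at e2; linarith
        have f2 : ‖zz (((1 - (1/2 + h) : ℝ):ℂ) + t * I)‖ ≤ (9 * C1 * (1+|t|)^h) * ‖zz (((1/2 + h : ℝ):ℂ) + t * I)‖ :=
          e1.trans (by gcongr)
        refine (Real.rpow_le_rpow (norm_nonneg _) f2 hp0.le).trans ?_
        rw [Real.mul_rpow (by positivity) (norm_nonneg _), Real.mul_rpow (by positivity) (by positivity), ← Real.rpow_mul (by positivity), hhp]
        refine mul_le_mul_of_nonneg_right ?_ (by positivity)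
        have g1 : (9*C1)^p ≤ 9*C1 := by
          calc (9*C1)^p ≤ (9*C1)^(1:ℝ) := Real.rpow_le_rpow_of_exponent_le (by linarith) hp1
            _ = _ := Real.rpow_one _
        have g2 : (1+|t|)^(2*A/L) ≤ 2 * Real.exp (2.2 * A) := by
          have k1 : |t| ≤ Real.exp (1.1 * L) := by
            refine le_of_pow_le_pow_left₀ (n := 10) (by norm_num) (Real.exp_pos _).le ?_
            rw [← Real.exp_nat_mul]
            have : T^11 = Real.exp (((10:ℕ):ℝ) * (1.1 * L)) := by
              rw [← Real.exp_log hT0, ← Real.exp_nat_mul, ← hLd]; congr 1; push_cast; ring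
            rw [← this]; exact hc
          have k2 : 1 + |t| ≤ 2 * Real.exp (1.1 * L) := by
            have : 1 ≤ Real.exp (1.1 * L) := Real.one_le_exp (by positivity)
            linarith
          calc (1+|t|)^(2*A/L) ≤ (2 * Real.exp (1.1*L))^(2*A/L) := by gcongr
            _ = 2^(2*A/L) * Real.exp (2.2 * A) := by
              rw [Real.mul_rpow (by norm_num) (Real.exp_pos _).le, ← Real.exp_mul]
              congr 2; field_simp; ring
            _ ≤ 2 * Real.exp (2.2*A) := by
              gcongr
              calc (2:ℝ)^(2*A/L) ≤ 2^(1:ℝ) := Real.rpow_le_rpow_of_exponent_le (by norm_num) hAL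
                _ = 2 := Real.rpow_one _
        calc (9*C1)^p * (1+|t|)^(2*A/L) ≤ (9*C1) * (2 * Real.exp (2.2*A)) := by gcongr
          _ = _ := by ring
      have : 0 ≤ (4 * C3 * F) * (1+t^2)⁻¹ := by positivity
      have := mul_le_mul_of_nonneg_right e3 (Real.exp_pos (-(t/T)^2)).le
      linarith
  have hIntg : MM p T zz (1 - (1/2 + h)) ≤ ∫ t : ℝ, ((18 * C1 * Real.exp (2.2 * A)) * (‖zz (((1/2 + h : ℝ):ℂ) + t * I)‖ ^ p * Real.exp (-(t / T) ^ 2)) + (4 * C3 * F) * (1+t^2)⁻¹) := by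
    unfold MM
    refine integral_mono_of_nonneg (Eventually.of_forall fun t => by positivity) ((iz.const_mul _).add (integrable_inv_one_add_sq.const_mul _)) ?_
    have : ∀ᵐ t : ℝ, t ≠ 0 := by simp [ae_iff]
    filter_upwards [this] with t ht using key t ht
  rw [integral_add (iz.const_mul _) (integrable_inv_one_add_sq.const_mul _), integral_const_mul, integral_const_mul, integral_univ_inv_one_add_sq] at hIntg
  have hJ := MM_nonneg p T zz (1/2+h)
  have hJe : MM p T zz (1/2+h) = ∫ t : ℝ, (‖zz (((1/2 + h : ℝ):ℂ) + t * I)‖ ^ p * Real.exp (-(t / T) ^ 2)) := rfl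
  rw [← hJe] at hIntg
  have q1 : 0 ≤ (4 * C3 * F) * Real.pi * (Real.exp (2.2*A) * MM p T zz (1/2+h)) := by
    have := Real.pi_pos; positivity
  nlinarith
end ZA

open Complex MeasureTheory Set Filter Topology
namespace ZA

lemma moment_aux {C5 C A J Js L : ℝ} {T : ℝ} (hC5 : 1 ≤ C5) (hC : 1 ≤ C) (hT : 10 ≤ T) (hA : 0 < A) (hJ : 0 ≤ J)
    (hA2 : 4 * C5 * Real.exp (-0.06*A) ≤ 1/2)
    (h1 : J ≤ 2 * (C5 * Real.exp (1.1*A) * Js + C5)) (h2 : Js ≤ C * T + 2 * Real.exp (-1.16 * A) * (J + C * T)) :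
    J ≤ (4 * C5 * Real.exp (1.1*A) * C + C + 4 * C5) * T := by
  have hE : Real.exp (1.1*A) * Real.exp (-1.16*A) = Real.exp (-0.06*A) := by
    rw [← Real.exp_add]; congr 1; ring
  set E := Real.exp (1.1*A)
  have hE0 : 0 < E := Real.exp_pos _
  have h3 : C5 * E * Js ≤ C5 * E * (C * T + 2 * Real.exp (-1.16 * A) * (J + C * T)) := by gcongr
  have h4 : C5 * E * (C * T + 2 * Real.exp (-1.16 * A) * (J + C * T)) = C5 * E * C * T + 2 * C5 * Real.exp (-0.06*A) * (J + C*T) := by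
    rw [← hE]; ring
  have h5 : 4 * C5 * Real.exp (-0.06*A) * (J + C*T) ≤ 1/2 * (J + C*T) := by gcongr
  nlinarith

lemma lim_large (A : ℝ) : ∃ T₀ : ℝ, 16 ≤ T₀ ∧ ∀ T : ℝ, T₀ ≤ T → 24 ≤ Real.log T ∧ 2 ≤ Real.log (Real.log T) ∧
    A * (2 * √(Real.log (Real.log T))) / Real.log T ≤ 1/4 := by
  have h1 : Tendsto Real.log atTop atTop := Real.tendsto_log_atTop
  have h2 : Tendsto (fun T => Real.log (Real.log T)) atTop atTop := h1.comp h1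
  have h3 : Tendsto (fun T => A * (2 * (Real.log (Real.log T))) / Real.log T) atTop (𝓝 0) := by
    have h4 : Tendsto (fun x : ℝ => Real.log x / x) atTop (𝓝 0) := by
      have := Real.isLittleO_log_id_atTop.tendsto_div_nhds_zero
      simpa using this
    have h5 := (h4.comp h1).const_mul (2 * |A|)
    simp only [mul_zero] at h5
    have h6 := (h4.comp h1).const_mul (2 * A)
    simp only [mul_zero] at h6
    refine h6.congr fun T => ?_
    simp; ring
  have h3' : Tendsto (fun T => |A * (2 * (Real.log (Real.log T))) / Real.log T|) atTop (𝓝 0) := by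
    simpa using h3.abs
  have h7 := (h1.eventually_ge_atTop 24).and ((h2.eventually_ge_atTop 2).and
    ((h3'.eventually (ge_mem_nhds (by norm_num : (0:ℝ) < 1/4)))))
  obtain ⟨T₀, hT₀⟩ := (h7.and (eventually_ge_atTop 16)).exists_forall_of_atTop
  refine ⟨max T₀ 16, le_max_right _ _, fun T hT => ?_⟩
  obtain ⟨⟨a1, a2, a3⟩, a4⟩ := hT₀ T (le_trans (le_max_left _ _) hT)
  refine ⟨a1, a2, ?_⟩
  have hs : √(Real.log (Real.log T)) ≤ Real.log (Real.log T) := by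
    rw [Real.sqrt_le_left (by linarith)]; nlinarith
  have hs0 := Real.sqrt_nonneg (Real.log (Real.log T))
  have hL : 0 < Real.log T := by linarith
  calc A * (2 * √(Real.log (Real.log T))) / Real.log T ≤ |A| * (2 * (Real.log (Real.log T))) / Real.log T := by
        gcongr
        exact le_abs_self A
    _ = |A * (2 * (Real.log (Real.log T))) / Real.log T| := by
        rw [abs_div, abs_mul, abs_of_pos hL, abs_of_nonneg (by linarith : 0 ≤ 2 * Real.log (Real.log T))]
    _ ≤ 1/4 := a3

set_option maxHeartbeats 1600000 in
lemma moment : ∃ C : ℝ, 1 ≤ C ∧ ∃ T₀ : ℝ, 16 ≤ T₀ ∧ ∀ T : ℝ, T₀ ≤ T → 24 ≤ Real.log T ∧ 2 ≤ Real.log (Real.log T) ∧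
    ∃ v : ℕ, 2 ≤ v ∧ (v:ℝ) ≤ 2 * √(Real.log (Real.log T)) ∧ ∀ σ : ℝ, 1/2 ≤ σ → σ ≤ 5 → MM (2/v) T zz σ ≤ C * T := by
  obtain ⟨C, hC, hA⟩ := stepA
  obtain ⟨C5, hC5, hB⟩ := stepB
  obtain ⟨C3, hC3, h3⟩ := zz_bound
  set A : ℝ := Real.log (8 * C5) / 0.06 with hAd
  have hA0 : 0 < A := by
    have := Real.log_pos (by linarith : 1 < 8 * C5)
    positivity
  have hA2 : 4 * C5 * Real.exp (-0.06*A) ≤ 1/2 := by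
    have : Real.exp (-0.06*A) = (8*C5)⁻¹ := by
      rw [← Real.exp_log (by positivity : 0 < (8*C5)⁻¹), Real.log_inv, hAd]; congr 1; field_simp
    rw [this]; apply le_of_eq; field_simp; norm_num
  obtain ⟨T₀, hT₀, hlim⟩ := lim_large A
  set C9 := 4 * C5 * Real.exp (1.1*A) * C + C + 4 * C5 with hC9
  have hC90 : 0 < C9 := by positivity
  refine ⟨C + 2 * (C9 + C), by linarith, T₀, hT₀, ?_⟩
  intro T hT
  obtain ⟨hL, hLL, hA4⟩ := hlim T hT
  refine ⟨hL, hLL, ?_⟩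
  set L := Real.log T with hLd
  have hL0 : 0 < L := by linarith
  have hT0 : 0 < T := by linarith
  have hT10 : 10 ≤ T := by linarith
  set v := ⌈√(Real.log L)⌉₊ with hv
  have hs1 : 1 < √(Real.log L) := by rw [Real.lt_sqrt (by norm_num)]; linarith
  have hvc : √(Real.log L) ≤ v := Nat.le_ceil _
  have hv2 : 2 ≤ v := by
    have : (1:ℝ) < v := by linarith
    exact_mod_cast this
  have hv3 : (v:ℝ) ≤ 2 * √(Real.log L) := by
    have := Nat.ceil_lt_add_one (Real.sqrt_nonneg (Real.log L)); linarith
  refine ⟨v, hv2, hv3, ?_⟩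
  have hv2' : (2:ℝ) ≤ v := by exact_mod_cast hv2
  set N := ⌊T^(9/10:ℝ)⌋₊ with hN
  have hTe : T = Real.exp L := (Real.exp_log hT0).symm
  have hTp : T^(9/10:ℝ) = Real.exp (0.9 * L) := by
    rw [Real.rpow_def_of_pos hT0]; congr 1; ring
  have hbig : 8 ≤ T^(9/10:ℝ) := by
    rw [hTp]; have := Real.add_one_le_exp (0.9*L); linarith
  have hNle : (N:ℝ) ≤ T^(9/10:ℝ) := Nat.floor_le (by positivity)
  have hNge : T^(9/10:ℝ)/2 ≤ N := by
    have := Nat.lt_floor_add_one (T^(9/10:ℝ)); linarith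
  have hN3 : 3 ≤ N := by
    have : (3:ℝ) ≤ N := by linarith
    exact_mod_cast this
  have hN0 : (0:ℝ) < N := by linarith
  have hN10 : (N:ℝ)^10 ≤ T^9 := by
    calc (N:ℝ)^10 ≤ (T^(9/10:ℝ))^10 := by gcongr
      _ = T^9 := by
        rw [← Real.rpow_natCast, ← Real.rpow_mul hT0.le, ← Real.rpow_natCast]; congr 1; norm_num
  have hlogN : 0.87 * L ≤ Real.log N := by
    have := Real.log_le_log (by positivity) hNge
    rw [hTp, Real.log_div (Real.exp_pos _).ne' (by norm_num), Real.log_exp] at this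
    have h2 := Real.log_two_lt_d9
    linarith
  have hLv : Real.log L ≤ (v:ℝ)^2 := by
    have := Real.sq_sqrt (by linarith : 0 ≤ Real.log L)
    nlinarith
  have hA' := hA v N T hv2 hN3 hN10 hT10 (by linarith) hLv
  set p : ℝ := 2 / v with hp
  have hp0 : 0 < p := by positivity
  have hp1 : p ≤ 1 := by rw [hp, div_le_one (by linarith)]; exact hv2'
  set h : ℝ := A * v / L with hh
  have hh0 : 0 < h := by positivity
  have hh4 : h ≤ 1/4 := by
    refine le_trans ?_ hA4
    rw [hh]; gcongr
  have hB' := hB v T A hv2 hT10 (by linarith) hA0 hh4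
  rw [← hLd, ← hh] at hB'
  set J := MM p T zz (1/2) with hJd
  have hJ0 : 0 ≤ J := MM_nonneg _ _ _ _
  set Js := MM p T zz (1/2 + h) with hJsd
  have hJs0 : 0 ≤ Js := MM_nonneg _ _ _ _
  have hJs : Js ≤ C * T + 2 * Real.exp (-1.16 * A) * (J + C * T) := by
    refine (hA' (1/2+h) (by linarith) (by linarith)).trans ?_
    gcongr
    have e1 : Real.log N / v * h = Real.log N / L * A := by rw [hh]; field_simp
    have e2 : 0.87 ≤ Real.log N / L := by rw [le_div_iff₀ hL0]; exact hlogN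
    have e3 : 4/3 * (Real.log N / v) * (1/2 + h - 1/2) = 4/3 * (Real.log N / L * A) := by rw [← e1]; ring
    rw [e3]
    nlinarith
  have hmax := MM_max (lam := 1.1 * A / h) (a := 1 - (1/2+h)) (b := 1/2+h) (h := zz) hp0 hp1 hT10 hC3 (by linarith)
    (by rw [abs_le]; constructor <;> linarith) (by rw [abs_le]; constructor <;> linarith)
    (fun s hs => by
      have hs' : 0 < s.re := by have := hs.1; linarith
      refine DifferentiableOn.analyticAt (s := {s : ℂ | 0 < s.re}) (fun z hz => (zz_diff hz).differentiableWithinAt) ?_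
      exact (isOpen_lt continuous_const continuous_re).mem_nhds hs')
    (fun s h1 h2 => h3 s (by linarith) (by linarith)) (1/2) ⟨by linarith, by linarith⟩
  have l1 : 1.1 * A / h * (1 - (1/2+h) - 1/2) = -(1.1*A) := by field_simp; ring
  have l2 : 1.1 * A / h * (1/2+h - 1/2) = 1.1*A := by field_simp; ring
  rw [l1, l2, ← hJd, ← hJsd] at hmax
  have hJ1 : J ≤ 2 * (C5 * Real.exp (1.1*A) * Js + C5) := by
    refine hmax.trans ?_
    have hE1 : 1 ≤ Real.exp (1.1*A) := Real.one_le_exp (by positivity)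
    gcongr
    refine max_le ?_ ?_
    · calc _ ≤ Real.exp (-(1.1*A)) * (C5 * Real.exp (2.2*A) * Js + C5) := by gcongr
        _ = C5 * (Real.exp (-(1.1*A)) * Real.exp (2.2*A)) * Js + Real.exp (-(1.1*A)) * C5 := by ring
        _ = C5 * Real.exp (1.1*A) * Js + Real.exp (-(1.1*A)) * C5 := by
          rw [← Real.exp_add]; congr 4; ring
        _ ≤ C5 * Real.exp (1.1*A) * Js + 1 * C5 := by
          gcongr
          rw [Real.exp_le_one_iff]; linarith
        _ = _ := by ring
    · have : 0 ≤ Real.exp (1.1*A) * Js := by positivity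
      nlinarith
  have hJf := moment_aux (L := L) hC5 hC hT10 hA0 hJ0 hA2 hJ1 hJs
  intro σ hσ hσ5
  refine (hA' σ hσ hσ5).trans ?_
  have hE : Real.exp (-(4/3 * (Real.log N / v) * (σ - 1/2))) ≤ 1 := by
    rw [Real.exp_le_one_iff]
    have : 0 ≤ Real.log N := by nlinarith
    have : 0 ≤ Real.log N / v := by positivity
    nlinarith
  calc _ ≤ C * T + 2 * 1 * (J + C * T) := by gcongr
    _ ≤ _ := by rw [← hC9] at hJf; nlinarith
end ZA

open Complex MeasureTheory Set Filter Topology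
namespace ZA

lemma zeta_large : ∃ C : ℝ, 1 ≤ C ∧ ∀ s : ℂ, 2 ≤ s.re →
    ‖riemannZeta s - 1 - (2:ℂ)^(-s)‖ ≤ C * (3:ℝ)^(-s.re) := by
  have hsum2 : Summable (fun n : ℕ => ((n:ℝ)+1)^(-2:ℝ)) := by
    have := summ_aux (e := 1) (by norm_num)
    refine this.congr fun n => ?_
    norm_num
  have hsum2' : Summable (fun n : ℕ => (((n+2:ℕ):ℝ)+1)^(-2:ℝ)) := (summable_nat_add_iff 2).2 hsum2
  refine ⟨1 + 9 * ∑' n : ℕ, (((n+2:ℕ):ℝ)+1)^(-2:ℝ), ?_, ?_⟩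
  · have : 0 ≤ ∑' n : ℕ, (((n+2:ℕ):ℝ)+1)^(-2:ℝ) := tsum_nonneg fun n => by positivity
    linarith
  intro s hs
  have hnorm : ∀ n : ℕ, ‖1 / ((n:ℂ)+1)^s‖ = ((n:ℝ)+1)^(-s.re) := by
    intro n
    rw [one_div, norm_inv, show ((n:ℂ)+1) = (((n:ℝ)+1 : ℝ):ℂ) by push_cast; rfl, norm_cpow_eq_rpow_re_of_pos (by positivity), Real.rpow_neg (by positivity)]
  have hle : ∀ n : ℕ, ((n:ℝ)+1)^(-s.re) ≤ ((n:ℝ)+1)^(-2:ℝ) := by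
    intro n
    exact Real.rpow_le_rpow_of_exponent_le (by linarith [Nat.cast_nonneg (α := ℝ) n]) (by linarith)
  have hS : Summable (fun n : ℕ => 1 / ((n:ℂ)+1)^s) := by
    refine Summable.of_norm_bounded hsum2 fun n => ?_
    rw [hnorm]; exact hle n
  have hz := zeta_eq_tsum_one_div_nat_add_one_cpow (s := s) (by linarith)
  have hsp := hS.sum_add_tsum_nat_add 2
  rw [← hz] at hsp
  have : riemannZeta s - 1 - (2:ℂ)^(-s) = ∑' n : ℕ, 1 / (((n+2:ℕ):ℂ)+1)^s := by
    rw [← hsp, Finset.sum_range_succ, Finset.sum_range_one, cpow_neg]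
    norm_num
    ring
  rw [this]
  have hterm : ∀ n : ℕ, ‖1 / (((n+2:ℕ):ℂ)+1)^s‖ ≤ (9 * (3:ℝ)^(-s.re)) * (((n+2:ℕ):ℝ)+1)^(-2:ℝ) := by
    intro n
    rw [hnorm]
    set x : ℝ := ((n+2:ℕ):ℝ)+1 with hx
    have hx3 : 3 ≤ x := by rw [hx]; push_cast; linarith [Nat.cast_nonneg (α := ℝ) n]
    have e1 : x^(-s.re) = x^(-(s.re-2)) * x^(-2:ℝ) := by
      rw [← Real.rpow_add (by linarith)]; congr 1; ring
    have e2 : (9:ℝ) * 3^(-s.re) = 3^(-(s.re-2)) := by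
      rw [show (9:ℝ) = 3^(2:ℝ) by norm_num, ← Real.rpow_add (by norm_num)]; congr 1; ring
    rw [e1, e2]
    refine mul_le_mul_of_nonneg_right ?_ (by positivity)
    exact Real.rpow_le_rpow_of_nonpos (by norm_num) hx3 (by linarith)
  have h3 : 0 < (3:ℝ)^(-s.re) := by positivity
  calc _ ≤ ∑' n : ℕ, (9 * (3:ℝ)^(-s.re)) * (((n+2:ℕ):ℝ)+1)^(-2:ℝ) :=
        tsum_of_norm_bounded (hsum2'.mul_left _).hasSum hterm
    _ = (9 * ∑' n : ℕ, (((n+2:ℕ):ℝ)+1)^(-2:ℝ)) * (3:ℝ)^(-s.re) := by rw [tsum_mul_left]; ring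
    _ ≤ _ := by nlinarith

lemma zeta_le_zz {σ t : ℝ} (ht : 2 ≤ t) (hσ : 0 < σ) : ‖riemannZeta (σ + t * I)‖ ≤ 2 * ‖zz (σ + t * I)‖ := by
  set s : ℂ := σ + t * I with hs
  have him : s.im = t := im_mk' _ _
  have hre : s.re = σ := re_mk' _ _
  rw [zz_eq (line_ne t (Or.inr (by linarith))), norm_mul]
  have e3 : 1 ≤ 2 * ‖ph s‖ := by
    have hp : 0 < ‖s+1‖ := norm_pos_iff.2 (add_one_ne (by rw [hre]; linarith))
    rw [ph, norm_div, ← mul_div_assoc, le_div_iff₀ hp, one_mul]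
    have h1 : |(s-1).im| ≤ ‖s-1‖ := abs_im_le_norm _
    have h2 : ‖s+1‖ ≤ ‖s-1‖ + ‖(2:ℂ)‖ := by
      have := norm_add_le (s-1) 2
      rwa [show s - 1 + 2 = s + 1 by ring] at this
    have h3 : (s-1).im = t := by simp [him]
    rw [h3] at h1
    have := le_abs_self t
    norm_num at h2
    linarith
  calc ‖riemannZeta s‖ = 1 * ‖riemannZeta s‖ := by ring
    _ ≤ (2 * ‖ph s‖) * ‖riemannZeta s‖ := by gcongr
    _ = _ := by ring

lemma zeta_line_cont (σ : ℝ) {a b : ℝ} (ha : 0 < a) (hab : a ≤ b) : ContinuousOn (fun t : ℝ => riemannZeta (σ + t * I)) (uIcc a b) := by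
  intro t ht
  rw [uIcc_of_le hab] at ht
  have h1 := (differentiableAt_riemannZeta (line_ne (σ := σ) t (Or.inr (by linarith [ht.1])))).continuousAt
  exact (ContinuousAt.comp (f := fun t : ℝ => (σ:ℂ) + t * I) h1 (by fun_prop)).continuousWithinAt

lemma zeta_log : ∃ C : ℝ, 1 ≤ C ∧ ∃ T₀ : ℝ, 16 ≤ T₀ ∧ ∀ T : ℝ, T₀ ≤ T → 24 ≤ Real.log T ∧ 2 ≤ Real.log (Real.log T) ∧
    ∀ σ : ℝ, 1/2 ≤ σ → ∫ t in (T/2)..(3*T), Real.posLog ‖riemannZeta (σ + t * I)‖ ≤ C * T * √(Real.log (Real.log T)) := by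
  obtain ⟨C, hC, T₀, hT₀, hm⟩ := moment
  obtain ⟨C1, hC1, h1⟩ := zeta_large
  obtain ⟨C3, hC3, h3⟩ := zz_bound
  set K := Real.posLog (2 + C1) with hK
  have hK0 : 0 ≤ K := Real.posLog_nonneg
  refine ⟨2 * Real.exp 9 * C + 3 * K, ?_, T₀, hT₀, ?_⟩
  · have : 1 ≤ Real.exp 9 := Real.one_le_exp (by norm_num)
    nlinarith
  intro T hT
  obtain ⟨hL, hLL, v, hv2, hv, hmm⟩ := hm T hT
  refine ⟨hL, hLL, ?_⟩
  intro σ hσ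
  have hT0 : 0 < T := by linarith
  set S := √(Real.log (Real.log T)) with hS
  have hS1 : 1 ≤ S := by rw [hS, Real.one_le_sqrt]; linarith
  have hab : T/2 ≤ 3*T := by linarith
  have hcont := zeta_line_cont σ (by linarith : 0 < T/2) hab
  have hIntg : IntervalIntegrable (fun t : ℝ => Real.posLog ‖riemannZeta (σ + t * I)‖) volume (T/2) (3*T) :=
    (Real.continuous_posLog.comp_continuousOn hcont.norm).intervalIntegrable
  have hv2' : (2:ℝ) ≤ v := by exact_mod_cast hv2
  rcases le_total σ 5 with h5 | h5
  · set p : ℝ := 2 / v with hp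
    have hp0 : 0 < p := by positivity
    have hp1 : p ≤ 1 := by rw [hp, div_le_one (by linarith)]; exact hv2'
    have iz : Integrable (fun t : ℝ => ‖zz (σ + t * I)‖ ^ p * Real.exp (-(t / T) ^ 2)) := by
      refine MM_integrable (h := zz) (C := C3) hp0 hp1 hT0 hC3 (line_cont (by linarith) fun s hs => zz_diff hs) ?_
      intro t
      have := h3 (σ + t * I) (by rw [re_mk']; linarith) (by rw [re_mk']; linarith)
      rwa [im_mk'] at this
    have hpt : ∀ t ∈ Icc (T/2) (3*T), Real.posLog ‖riemannZeta (σ + t * I)‖ ≤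
        (2 * Real.exp 9 * S) * (‖zz (σ + t * I)‖ ^ p * Real.exp (-(t / T) ^ 2)) := by
      intro t ht
      have ht2 : 2 ≤ t := by linarith [ht.1]
      have e1 := zeta_le_zz (σ := σ) ht2 (by linarith)
      have e2 : Real.posLog ‖riemannZeta (σ + t * I)‖ ≤ ‖riemannZeta (σ + t * I)‖^p / p := by
        rw [Real.posLog_apply]
        exact max_le (by positivity) (Real.log_le_rpow_div (norm_nonneg _) hp0)
      have e3 : ‖riemannZeta (σ + t * I)‖^p ≤ 2 * ‖zz (σ + t * I)‖ ^ p := by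
        refine (Real.rpow_le_rpow (norm_nonneg _) e1 hp0.le).trans ?_
        rw [Real.mul_rpow (by norm_num) (norm_nonneg _)]
        gcongr
        calc (2:ℝ)^p ≤ 2^(1:ℝ) := Real.rpow_le_rpow_of_exponent_le (by norm_num) hp1
          _ = 2 := Real.rpow_one _
      have e4 : 1 / p ≤ S := by rw [hp]; simp; linarith
      have e5 : 1 ≤ Real.exp 9 * Real.exp (-(t / T) ^ 2) := by
        rw [← Real.exp_add]
        apply Real.one_le_exp
        have : t / T ≤ 3 := by rw [div_le_iff₀ hT0]; exact ht.2
        have : 0 ≤ t / T := by positivity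
        nlinarith
      set Z := ‖zz (σ + t * I)‖ ^ p
      have hZ : 0 ≤ Z := by positivity
      calc _ ≤ ‖riemannZeta (σ + t * I)‖^p / p := e2
        _ = ‖riemannZeta (σ + t * I)‖^p * (1 / p) := by ring
        _ ≤ (2 * Z) * S := by gcongr
        _ ≤ (2 * Z) * S * (Real.exp 9 * Real.exp (-(t / T) ^ 2)) := le_mul_of_one_le_right (by positivity) e5
        _ = _ := by ring
    have h6 := intervalIntegral.integral_mono_on hab hIntg ((iz.const_mul _).intervalIntegrable) hpt
    refine h6.trans ?_
    have h7 : ∫ t in (T/2)..(3*T), (‖zz (σ + t * I)‖ ^ p * Real.exp (-(t / T) ^ 2)) ≤ MM p T zz σ := by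
      rw [intervalIntegral.integral_of_le hab]
      exact setIntegral_le_integral iz (Eventually.of_forall fun t => by positivity)
    rw [intervalIntegral.integral_const_mul]
    calc _ ≤ (2 * Real.exp 9 * S) * (C * T) := by gcongr; exact h7.trans (hmm σ hσ h5)
      _ ≤ _ := by
        have : 0 ≤ 3 * K * T * S := by positivity
        nlinarith
  · have hpt : ∀ t ∈ Icc (T/2) (3*T), Real.posLog ‖riemannZeta (σ + t * I)‖ ≤ K := by
      intro t ht
      apply Real.posLog_le_posLog (norm_nonneg _)
      set s : ℂ := σ + t * I with hs
      have hre : s.re = σ := re_mk' _ _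
      have e1 := h1 s (by rw [hre]; linarith)
      have e2 : ‖(2:ℂ)^(-s)‖ ≤ 1 := by
        rw [show (2:ℂ) = ((2:ℝ):ℂ) by norm_num, norm_cpow_eq_rpow_re_of_pos (by norm_num)]
        apply Real.rpow_le_one_of_one_le_of_nonpos (by norm_num)
        simp [hre]; linarith
      have e3 : (3:ℝ)^(-s.re) ≤ 1 := by
        apply Real.rpow_le_one_of_one_le_of_nonpos (by norm_num)
        rw [hre]; linarith
      have e4 : ‖riemannZeta s‖ ≤ ‖riemannZeta s - 1 - (2:ℂ)^(-s)‖ + ‖(1:ℂ)‖ + ‖(2:ℂ)^(-s)‖ := by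
        have := norm_add₃_le (a := riemannZeta s - 1 - (2:ℂ)^(-s)) (b := 1) (c := (2:ℂ)^(-s))
        rwa [show riemannZeta s - 1 - (2:ℂ)^(-s) + 1 + (2:ℂ)^(-s) = riemannZeta s by ring] at this
      rw [norm_one] at e4
      nlinarith
    have h6 := intervalIntegral.integral_mono_on hab hIntg (intervalIntegrable_const) hpt
    rw [intervalIntegral.integral_const] at h6
    refine h6.trans ?_
    rw [smul_eq_mul]
    have q1 : 0 ≤ 2 * Real.exp 9 * C * T * S := by positivity
    have q2 : K * T ≤ K * T * S := le_mul_of_one_le_right (by positivity) hS1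
    have q3 : 0 ≤ K * T := by positivity
    nlinarith

lemma f_log (M : ℝ) (hM : 0 ≤ M) : ∃ C : ℝ, 1 ≤ C ∧ ∃ T₀ : ℝ, 16 ≤ T₀ ∧ ∀ T : ℝ, T₀ ≤ T → 24 ≤ Real.log T ∧ 2 ≤ Real.log (Real.log T) ∧
    ∀ f : ℂ → ℂ, (∀ s : ℂ, 1/2 ≤ s.re → T/2 ≤ s.im → ContinuousAt f s) → (∀ s : ℂ, 1/2 ≤ s.re → T/2 ≤ s.im → ‖f s‖ ≤ ‖riemannZeta s‖ + M) →
    ∀ σ : ℝ, 1/2 ≤ σ → ∫ t in (T/2)..(3*T), Real.posLog ‖f (σ + t * I)‖ ≤ C * T * √(Real.log (Real.log T)) := by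
  obtain ⟨C, hC, T₀, hT₀, hm⟩ := zeta_log
  set K := Real.log 2 + Real.posLog M with hK
  have hK0 : 0 ≤ K := add_nonneg (Real.log_nonneg (by norm_num)) Real.posLog_nonneg
  refine ⟨C + 3 * K, by linarith, T₀, hT₀, ?_⟩
  intro T hT
  obtain ⟨hL, hLL, hz⟩ := hm T hT
  refine ⟨hL, hLL, ?_⟩
  intro f hfc hfb σ hσ
  have hT0 : 0 < T := by linarith
  set S := √(Real.log (Real.log T)) with hS
  have hS1 : 1 ≤ S := by rw [hS, Real.one_le_sqrt]; linarith
  have hab : T/2 ≤ 3*T := by linarith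
  have hIntg : IntervalIntegrable (fun t : ℝ => Real.posLog ‖riemannZeta (σ + t * I)‖) volume (T/2) (3*T) :=
    (Real.continuous_posLog.comp_continuousOn (zeta_line_cont σ (by linarith : 0 < T/2) hab).norm).intervalIntegrable
  have hfc' : ContinuousOn (fun t : ℝ => f (σ + t * I)) (uIcc (T/2) (3*T)) := by
    intro t ht
    rw [uIcc_of_le hab] at ht
    have h1 := hfc (σ + t * I) (by rw [re_mk']; exact hσ) (by rw [im_mk']; exact ht.1)
    exact (ContinuousAt.comp (f := fun t : ℝ => (σ:ℂ) + t * I) h1 (by fun_prop)).continuousWithinAt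
  have hIntgf : IntervalIntegrable (fun t : ℝ => Real.posLog ‖f (σ + t * I)‖) volume (T/2) (3*T) :=
    (Real.continuous_posLog.comp_continuousOn hfc'.norm).intervalIntegrable
  have h6 := intervalIntegral.integral_mono_on hab hIntgf (hIntg.add (intervalIntegrable_const (c := K))) (fun t ht => by
    have h1 := hfb (σ + t * I) (by rw [re_mk']; exact hσ) (by rw [im_mk']; exact ht.1)
    have h2 := Real.posLog_le_posLog (norm_nonneg _) h1
    have h3 := Real.posLog_add (x := ‖riemannZeta (σ + t * I)‖) (y := M)
    show _ ≤ Real.posLog ‖riemannZeta (σ + t * I)‖ + K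
    linarith)
  rw [intervalIntegral.integral_add hIntg intervalIntegrable_const, intervalIntegral.integral_const, smul_eq_mul] at h6
  have := hz σ hσ
  have q2 : K * T ≤ K * T * S := le_mul_of_one_le_right (by positivity) hS1
  have q3 : 0 ≤ K * T := by positivity
  nlinarith
end ZA

open Complex MeasureTheory Set Filter Topology
namespace ZA

/-- Moebius map of the unit disc onto the disc of centre `R` and radius `R`, sending `0` to `A`. -/
noncomputable def mob (R A : ℝ) (z : ℂ) : ℂ :=
  R + R * ((z - ((1 - A/R : ℝ):ℂ)) / (1 - ((1 - A/R : ℝ):ℂ) * z))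

lemma mob_den {u : ℝ} (h0 : 0 ≤ u) (h1 : u < 1) {z : ℂ} (hz : ‖z‖ ≤ 1) : 1 - (u:ℂ) * z ≠ 0 := by
  intro h
  have h2 : (u:ℂ) * z = 1 := (sub_eq_zero.1 h).symm
  have h3 := congrArg norm h2
  rw [norm_mul, norm_one, norm_real, Real.norm_of_nonneg h0] at h3
  nlinarith [norm_nonneg z]

lemma u_mem {R A : ℝ} (hA : 0 < A) (hAR : A ≤ R) : 0 ≤ 1 - A/R ∧ 1 - A/R < 1 := by
  have hR : 0 < R := by linarith
  have h1 : A / R ≤ 1 := by rw [div_le_one hR]; exact hAR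
  have h2 : 0 < A / R := by positivity
  constructor <;> linarith

lemma mob_ball {R A : ℝ} (hA : 0 < A) (hAR : A ≤ R) {z : ℂ} (hz : ‖z‖ ≤ 1) : ‖mob R A z - R‖ ≤ R := by
  have hR : 0 < R := by linarith
  obtain ⟨h0, h1⟩ := u_mem hA hAR
  unfold mob
  set u : ℝ := 1 - A/R
  have hd := mob_den h0 h1 hz
  rw [add_sub_cancel_left, norm_mul, norm_real, Real.norm_of_nonneg hR.le, norm_div]
  have : ‖z - u‖ ≤ ‖1 - (u:ℂ) * z‖ := by
    rw [← sq_le_sq₀ (norm_nonneg _) (norm_nonneg _), ← normSq_eq_norm_sq, ← normSq_eq_norm_sq, normSq_apply, normSq_apply]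
    have hz2 : z.re * z.re + z.im * z.im ≤ 1 := by
      rw [← normSq_apply, normSq_eq_norm_sq]; exact pow_le_one₀ (norm_nonneg _) hz
    simp
    nlinarith [mul_nonneg (by nlinarith : 0 ≤ 1 - u^2) (by linarith : 0 ≤ 1 - (z.re * z.re + z.im * z.im))]
  have h3 : ‖z - u‖ / ‖1 - (u:ℂ) * z‖ ≤ 1 := by
    rw [div_le_one (norm_pos_iff.2 hd)]; exact this
  nlinarith

lemma mob_re {R A : ℝ} (hA : 0 < A) (hAR : A ≤ R) {z : ℂ} (hz : ‖z‖ ≤ 1) : 0 ≤ (mob R A z).re ∧ |(mob R A z).im| ≤ R := by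
  have h := mob_ball hA hAR hz
  have h1 := (abs_le.1 ((abs_re_le_norm _).trans h)).1
  have h2 := (abs_im_le_norm _).trans h
  simp at h1 h2
  exact ⟨by linarith, h2⟩

lemma mob_zero {R A : ℝ} (hR : 0 < R) : mob R A 0 = A := by
  unfold mob
  have : (R:ℂ) ≠ 0 := by exact_mod_cast hR.ne'
  push_cast
  simp
  field_simp
  ring

lemma mob_an {R A : ℝ} (hA : 0 < A) (hAR : A ≤ R) {z : ℂ} (hz : ‖z‖ ≤ 1) : AnalyticAt ℂ (mob R A) z := by
  obtain ⟨h0, h1⟩ := u_mem hA hAR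
  have hd := mob_den h0 h1 hz
  unfold mob
  exact analyticAt_const.add (analyticAt_const.mul ((analyticAt_id.sub analyticAt_const).div (analyticAt_const.sub (analyticAt_const.mul analyticAt_id)) hd))

lemma mob_surj {R A B d : ℝ} (hA : 0 < A) (hAR : A ≤ R) (hd : 0 < d) (hRd : 2 ≤ R * d) (hB : B ≤ R/2) {q : ℂ}
    (hq1 : d ≤ q.re) (hq2 : q.re ≤ B) (hq3 : |q.im| ≤ 1) :
    ∃ z : ℂ, mob R A z = q ∧ ‖z‖ ≤ 1 ∧ A / ((A+B)^2+1) * d ≤ 1 - ‖z‖^2 := by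
  have hR : 0 < R := by linarith
  have hRc : (R:ℂ) ≠ 0 := by exact_mod_cast hR.ne'
  obtain ⟨h0, h1⟩ := u_mem hA hAR
  have hu : R * (1 - A/R) = R - A := by field_simp
  set u : ℝ := 1 - A/R with hud
  set x := q.re with hx
  set y := q.im with hy
  have hx0 : 0 < x := by linarith
  have hy2 : y^2 ≤ 1 := by rw [← sq_abs]; exact pow_le_one₀ (abs_nonneg _) hq3
  have hRx : 2 ≤ R * x := by nlinarith
  have hxx : x^2 ≤ R * x / 2 := by nlinarith
  have hnum : R * x ≤ 2 * R * x - x^2 - y^2 := by linarith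
  have hden0 : (R:ℂ) + u * (q - R) ≠ 0 := by
    intro h
    have := congrArg re h
    simp [← hx] at this
    nlinarith
  set D : ℂ := (R:ℂ) + u * (q - R) with hD
  have hDn : ‖D‖^2 = (A + u*x)^2 + (u*y)^2 := by
    rw [← normSq_eq_norm_sq, normSq_apply, hD]
    simp [← hx, ← hy]
    have : R + u * (x - R) = A + u * x := by linarith
    rw [this]; ring
  have hDpos : 0 < ‖D‖^2 := by have := norm_pos_iff.2 hden0; positivity
  have hDle : ‖D‖^2 ≤ (A+B)^2+1 := by
    rw [hDn]
    have : u * x ≤ B := by nlinarith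
    have : 0 ≤ u * x := by positivity
    have : u^2 ≤ 1 := by nlinarith
    nlinarith [mul_le_mul this hy2 (sq_nonneg _) (by norm_num)]
  have hN : ‖q - R + R * u‖^2 = (x - A)^2 + y^2 := by
    rw [← normSq_eq_norm_sq, normSq_apply]
    simp [← hx, ← hy]
    rw [hu]; ring
  have h1z : 1 - ‖(q - R + R * u) / D‖^2 = (1-u^2) * (2*R*x - x^2-y^2) / ‖D‖^2 := by
    rw [norm_div, div_pow, eq_div_iff hDpos.ne', sub_mul, div_mul_cancel₀ _ hDpos.ne', hDn, hN, one_mul]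
    have hA' : A = R - R * u := by linarith
    rw [hA']; ring
  have hlow : A / ((A+B)^2+1) * d ≤ 1 - ‖(q - R + R * u) / D‖^2 := by
    rw [h1z]
    have hu2 : A / R ≤ 1 - u^2 := by
      have : A / R = 1 - u := by rw [hud]; ring
      rw [this]; nlinarith
    have hARR : A/R * (R * x) = A * x := by field_simp
    calc A / ((A+B)^2+1) * d = (A * d) / ((A+B)^2+1) := by ring
      _ ≤ (A * d) / ‖D‖^2 := by gcongr
      _ ≤ ((1-u^2) * (2*R*x - x^2-y^2)) / ‖D‖^2 := by
        refine div_le_div_of_nonneg_right ?_ hDpos.le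
        calc A * d ≤ A * x := by gcongr
          _ = A / R * (R * x) := hARR.symm
          _ ≤ _ := by
            apply mul_le_mul hu2 hnum (by positivity)
            have : 0 ≤ A / R := by positivity
            linarith
  have hz1 : ‖(q - R + R * u) / D‖ ≤ 1 := by
    have : 0 ≤ A / ((A+B)^2+1) * d := by positivity
    have h2 : ‖(q - R + R * u) / D‖^2 ≤ 1 := by linarith
    exact (sq_le_one_iff₀ (norm_nonneg _)).1 h2
  refine ⟨(q - R + R * u) / D, ?_, hz1, hlow⟩
  have hdz := mob_den h0 h1 hz1
  unfold mob
  rw [← hud]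
  have e1 : (q - R + R * u) / D - u = (1 - u^2) * (q - R) / D := by
    rw [eq_div_iff hden0, sub_mul, div_mul_cancel₀ _ hden0, hD]; ring
  have e2 : 1 - (u:ℂ) * ((q - R + R * u) / D) = (1 - u^2) * R / D := by
    rw [eq_div_iff hden0, sub_mul, mul_assoc, div_mul_cancel₀ _ hden0, hD]; ring
  rw [e2] at hdz
  have hn : ((1 - (u:ℂ)^2) * R) ≠ 0 := fun h => hdz (by rw [h, zero_div])
  have hn1 : (1 - (u:ℂ)^2) ≠ 0 := left_ne_zero_of_mul hn
  rw [e1, e2]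
  field_simp
  ring

lemma jens_tau {f : ℂ → ℂ} {T R A B d K0 : ℝ} (hRT : R ≤ T/2) (hA : 0 < A) (hAR : A ≤ R) (hd : 0 < d) (hRd : 2 ≤ R * d) (hB : B ≤ R/2)
    (hf : ∀ s : ℂ, 1/2 ≤ s.re → T/2 ≤ s.im → AnalyticAt ℂ f s) {τ : ℝ} (hτ : T ≤ τ)
    (hl0 : f (((1/2 + A : ℝ):ℂ) + τ * I) ≠ 0) (hl : -K0 ≤ Real.log ‖f (((1/2 + A : ℝ):ℂ) + τ * I)‖)
    (Z : Finset ℂ) (hZ : ∀ ρ ∈ Z, f ρ = 0 ∧ 1/2 + d ≤ ρ.re ∧ ρ.re ≤ 1/2 + B ∧ |ρ.im - τ| ≤ 1) :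
    Z.card * (A / ((A+B)^2+1) * d / 2) - K0 ≤ Real.circleAverage (fun z => Real.posLog ‖f (((1/2:ℝ):ℂ) + τ * I + mob R A z)‖) 0 1 := by
  have hR : 0 < R := by linarith
  set G : ℂ → ℂ := fun z => f (((1/2:ℝ):ℂ) + τ * I + mob R A z) with hG
  have hGa : AnalyticOnNhd ℂ G (Metric.closedBall 0 1) := by
    intro z hz
    have hz1 : ‖z‖ ≤ 1 := by simpa using hz
    obtain ⟨m1, m2⟩ := mob_re hA hAR hz1
    have m3 := (abs_le.1 m2).1
    have h1 : AnalyticAt ℂ f (((1/2:ℝ):ℂ) + τ * I + mob R A z) := by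
      apply hf
      · rw [add_re, re_mk']; linarith
      · rw [add_im, im_mk']; linarith
    exact AnalyticAt.fun_comp h1 (analyticAt_const.add (mob_an hA hAR hz1))
  have hG0 : G 0 = f (((1/2 + A : ℝ):ℂ) + τ * I) := by
    simp only [hG]; rw [mob_zero hR]; congr 1; push_cast; ring
  have hGc0 : G 0 ≠ 0 := by rw [hG0]; exact hl0
  have hex : ∀ ρ : ℂ, ∃ z : ℂ, ρ ∈ Z → ((((1/2:ℝ):ℂ) + τ * I + mob R A z) = ρ ∧ ‖z‖ ≤ 1 ∧ A / ((A+B)^2+1) * d ≤ 1 - ‖z‖^2) := by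
    intro ρ
    by_cases hρ : ρ ∈ Z
    · obtain ⟨a1, a2, a3, a4⟩ := hZ ρ hρ
      have hre : (ρ - (((1/2:ℝ):ℂ) + τ * I)).re = ρ.re - 1/2 := by rw [sub_re, re_mk']
      have him : (ρ - (((1/2:ℝ):ℂ) + τ * I)).im = ρ.im - τ := by rw [sub_im, im_mk']
      obtain ⟨z, z1, z2, z3⟩ := mob_surj (q := ρ - (((1/2:ℝ):ℂ) + τ * I)) hA hAR hd hRd hB (by rw [hre]; linarith) (by rw [hre]; linarith) (by rw [him]; exact a4)
      exact ⟨z, fun _ => ⟨by rw [z1]; ring, z2, z3⟩⟩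
    · exact ⟨0, fun h => absurd h hρ⟩
  choose g hg using hex
  have hinj : Set.InjOn g Z := by
    intro a ha b hb hab
    rw [← (hg a ha).1, ← (hg b hb).1, hab]
  classical
  have hJ := jensen_sum (G := G) (c := 0) (r := 1) one_pos hGa hGc0 (Z.image g) (by
    intro u hu
    obtain ⟨ρ, hρ, rfl⟩ := Finset.mem_image.1 hu
    refine ⟨by simpa using (hg ρ hρ).2.1, ?_⟩
    simp only [hG]; rw [(hg ρ hρ).1]; exact (hZ ρ hρ).1)
  rw [Finset.sum_image hinj] at hJ
  have hsum : Z.card * (A / ((A+B)^2+1) * d / 2) ≤ ∑ ρ ∈ Z, Real.log (1 * ‖0 - g ρ‖⁻¹) := by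
    rw [← nsmul_eq_mul]
    refine Finset.card_nsmul_le_sum _ _ _ fun ρ hρ => ?_
    obtain ⟨b1, b2, b3⟩ := hg ρ hρ
    rw [one_mul, zero_sub, norm_neg, Real.log_inv]
    have hz0 : g ρ ≠ 0 := by
      intro h
      rw [h] at b1
      apply hGc0
      simp only [hG]; rw [b1]; exact (hZ ρ hρ).1
    have hp := norm_pos_iff.2 hz0
    have := Real.log_le_sub_one_of_pos (by positivity : 0 < ‖g ρ‖^2)
    rw [Real.log_pow] at this
    push_cast at this
    linarith
  have hsph : Metric.sphere (0:ℂ) |1| ⊆ Metric.closedBall 0 1 := by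
    rw [abs_one]; exact Metric.sphere_subset_closedBall
  have hmono := Real.circleAverage_mono (c := 0) (R := 1) (f₁ := fun z => Real.log ‖G z‖) (f₂ := fun z => Real.posLog ‖G z‖)
    (hGa.mono hsph).meromorphicOn.circleIntegrable_log_norm
    (by
      apply ContinuousOn.circleIntegrable zero_le_one
      exact Real.continuous_posLog.comp_continuousOn (hGa.continuousOn.mono Metric.sphere_subset_closedBall).norm)
    (fun z _ => by rw [Real.posLog_apply]; exact le_max_right _ _)
  rw [← hG0] at hl
  linarith
end ZA

open Complex MeasureTheory Set Filter Topology
namespace ZA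

lemma avg_bound {f : ℂ → ℂ} {T R A Q : ℝ} (hT : 4 ≤ T) (hRT : R ≤ T/2) (hA : 0 < A) (hAR : A ≤ R)
    (hf : ∀ s : ℂ, 1/2 ≤ s.re → T/2 ≤ s.im → AnalyticAt ℂ f s)
    (hQ : ∀ σ : ℝ, 1/2 ≤ σ → ∫ t in (T/2)..(3*T), Real.posLog ‖f (σ + t * I)‖ ≤ Q) :
    IntegrableOn (fun τ : ℝ => Real.circleAverage (fun z => Real.posLog ‖f (((1/2:ℝ):ℂ) + τ * I + mob R A z)‖) 0 1) (Ioc T (2*T)) ∧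
    ∫ τ in Ioc T (2*T), Real.circleAverage (fun z => Real.posLog ‖f (((1/2:ℝ):ℂ) + τ * I + mob R A z)‖) 0 1 ≤ Q := by
  have hR : 0 < R := by linarith
  have h2pi := Real.two_pi_pos
  set H : ℝ → ℝ → ℝ := fun τ θ => Real.posLog ‖f (((1/2:ℝ):ℂ) + τ * I + mob R A (circleMap 0 1 θ))‖ with hH
  have hcm : ∀ θ, ‖circleMap 0 1 θ‖ ≤ 1 := fun θ => by simp
  have hcont : ContinuousOn (Function.uncurry H) (Icc T (2*T) ×ˢ Icc 0 (2*Real.pi)) := by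
    rintro ⟨τ, θ⟩ ⟨hτ, hθ⟩
    apply ContinuousAt.continuousWithinAt
    obtain ⟨m1, m2⟩ := mob_re hA hAR (hcm θ)
    have m3 := (abs_le.1 m2).1
    have h1 : ContinuousAt f (((1/2:ℝ):ℂ) + τ * I + mob R A (circleMap 0 1 θ)) := by
      apply (hf _ _ _).continuousAt
      · rw [add_re, re_mk']; linarith
      · rw [add_im, im_mk']; simp at hτ; linarith [hτ.1]
    have h2 : ContinuousAt (mob R A) (circleMap 0 1 θ) := (mob_an hA hAR (hcm θ)).continuousAt
    have h3 : ContinuousAt (fun q : ℝ × ℝ => mob R A (circleMap 0 1 q.2)) (τ, θ) := by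
      have hc2 : Continuous (fun q : ℝ × ℝ => circleMap 0 1 q.2) := (continuous_circleMap 0 1).comp continuous_snd
      exact ContinuousAt.comp (x := (τ, θ)) (g := mob R A) (f := fun q : ℝ × ℝ => circleMap 0 1 q.2) h2 hc2.continuousAt
    have h4 : ContinuousAt (fun q : ℝ × ℝ => ((1/2:ℝ):ℂ) + (q.1:ℂ) * I + mob R A (circleMap 0 1 q.2)) (τ, θ) :=
      ContinuousAt.add (by fun_prop) h3
    have h5 : ContinuousAt (fun q : ℝ × ℝ => f (((1/2:ℝ):ℂ) + (q.1:ℂ) * I + mob R A (circleMap 0 1 q.2))) (τ, θ) :=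
      ContinuousAt.comp (f := fun q : ℝ × ℝ => ((1/2:ℝ):ℂ) + (q.1:ℂ) * I + mob R A (circleMap 0 1 q.2)) h1 h4
    exact Real.continuous_posLog.continuousAt.comp h5.norm
  have hIntg : Integrable (Function.uncurry H) ((volume.restrict (Ioc T (2*T))).prod (volume.restrict (Ioc 0 (2*Real.pi)))) := by
    rw [Measure.prod_restrict]
    exact (hcont.integrableOn_compact (isCompact_Icc.prod isCompact_Icc)).mono_set (prod_mono Ioc_subset_Icc_self Ioc_subset_Icc_self)
  have hG : ∀ τ : ℝ, Real.circleAverage (fun z => Real.posLog ‖f (((1/2:ℝ):ℂ) + τ * I + mob R A z)‖) 0 1 =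
      (2 * Real.pi)⁻¹ * ∫ θ in Ioc 0 (2*Real.pi), H τ θ := by
    intro τ
    rw [Real.circleAverage, intervalIntegral.integral_of_le h2pi.le, smul_eq_mul]
  simp only [hG]
  refine ⟨hIntg.integral_prod_left.const_mul _, ?_⟩
  rw [integral_const_mul, integral_integral_swap hIntg]
  have hin : ∀ θ : ℝ, ∫ τ in Ioc T (2*T), H τ θ ≤ Q := by
    intro θ
    obtain ⟨m1, m2⟩ := mob_re hA hAR (hcm θ)
    obtain ⟨m3, m4⟩ := abs_le.1 m2
    set x := (mob R A (circleMap 0 1 θ)).re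
    set y := (mob R A (circleMap 0 1 θ)).im
    have he : ∀ τ : ℝ, H τ θ = (fun t : ℝ => Real.posLog ‖f (((1/2+x:ℝ):ℂ) + t * I)‖) (τ + y) := by
      intro τ
      simp only [hH]
      congr 3
      rw [← re_add_im (mob R A (circleMap 0 1 θ))]
      push_cast; ring
    rw [← intervalIntegral.integral_of_le (by linarith : T ≤ 2*T)]
    simp only [he]
    rw [intervalIntegral.integral_comp_add_right (fun t : ℝ => Real.posLog ‖f (((1/2+x:ℝ):ℂ) + t * I)‖)]
    refine le_trans ?_ (hQ (1/2+x) (by linarith))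
    have hfc' : ContinuousOn (fun t : ℝ => f (((1/2+x:ℝ):ℂ) + t * I)) (uIcc (T/2) (3*T)) := by
      intro t ht
      rw [uIcc_of_le (by linarith)] at ht
      have h1 := (hf (((1/2+x:ℝ):ℂ) + t * I) (by rw [re_mk']; linarith) (by rw [im_mk']; exact ht.1)).continuousAt
      exact (ContinuousAt.comp (f := fun t : ℝ => ((1/2+x:ℝ):ℂ) + t * I) h1 (by fun_prop)).continuousWithinAt
    refine intervalIntegral.integral_mono_interval (by linarith) (by linarith) (by linarith) ?_ ?_
    · exact Eventually.of_forall fun t => Real.posLog_nonneg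
    · exact (Real.continuous_posLog.comp_continuousOn hfc'.norm).intervalIntegrable
  have h8 : ∫ θ in Ioc 0 (2*Real.pi), ∫ τ in Ioc T (2*T), H τ θ ≤ ∫ θ in Ioc 0 (2*Real.pi), Q := by
    refine integral_mono hIntg.integral_prod_right (integrable_const _) fun θ => hin θ
  rw [setIntegral_const, smul_eq_mul, Real.volume_real_Ioc_of_le h2pi.le, sub_zero] at h8
  rw [inv_mul_le_iff₀ h2pi]
  exact h8

lemma window {T γ : ℝ} (hT : 4 ≤ T) (h1 : T < γ) (h2 : γ ≤ 2*T) :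
    1 ≤ ∫ τ in Ioc T (2*T), (Icc (γ-1) (γ+1)).indicator (fun _ => (1:ℝ)) τ := by
  rw [setIntegral_indicator measurableSet_Icc, setIntegral_const, smul_eq_mul, mul_one]
  have hfin : volume (Ioc T (2*T) ∩ Icc (γ-1) (γ+1)) ≠ ⊤ :=
    ne_top_of_le_ne_top (by simp) (measure_mono inter_subset_left)
  rcases le_total (γ+1) (2*T) with h | h
  · have hs : Ioc γ (γ+1) ⊆ Ioc T (2*T) ∩ Icc (γ-1) (γ+1) := fun t ht =>
      ⟨⟨by linarith [ht.1], by linarith [ht.2]⟩, by linarith [ht.1], ht.2⟩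
    have := measureReal_mono hs hfin
    rw [Real.volume_real_Ioc_of_le (by linarith)] at this
    linarith
  · have hs : Ioc (γ-1) γ ⊆ Ioc T (2*T) ∩ Icc (γ-1) (γ+1) := fun t ht =>
      ⟨⟨by linarith [ht.1], by linarith [ht.2]⟩, ht.1.le, by linarith [ht.2]⟩
    have := measureReal_mono hs hfin
    rw [Real.volume_real_Ioc_of_le (by linarith)] at this
    linarith

lemma count {f : ℂ → ℂ} {T R A B d K0 Q : ℝ} (hT : 4 ≤ T) (hRT : R ≤ T/2) (hA : 0 < A) (hAR : A ≤ R) (hd : 0 < d) (hRd : 2 ≤ R * d) (hB : B ≤ R/2)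
    (hf : ∀ s : ℂ, 1/2 ≤ s.re → T/2 ≤ s.im → AnalyticAt ℂ f s)
    (hl : ∀ τ : ℝ, T ≤ τ → τ ≤ 2*T → f (((1/2 + A : ℝ):ℂ) + τ * I) ≠ 0 ∧ -K0 ≤ Real.log ‖f (((1/2 + A : ℝ):ℂ) + τ * I)‖)
    (hQ : ∀ σ : ℝ, 1/2 ≤ σ → ∫ t in (T/2)..(3*T), Real.posLog ‖f (σ + t * I)‖ ≤ Q)
    (Z : Finset ℂ) (hZ : ∀ ρ ∈ Z, f ρ = 0 ∧ 1/2 + d ≤ ρ.re ∧ ρ.re ≤ 1/2 + B ∧ T < ρ.im ∧ ρ.im ≤ 2*T) :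
    Z.card * (A / ((A+B)^2+1) * d / 2) ≤ Q + K0 * T := by
  obtain ⟨i1, i2⟩ := avg_bound hT hRT hA hAR hf hQ
  set κ := A / ((A+B)^2+1) * d / 2 with hκ
  have hκ0 : 0 < κ := by positivity
  set G : ℝ → ℝ := fun τ => Real.circleAverage (fun z => Real.posLog ‖f (((1/2:ℝ):ℂ) + τ * I + mob R A z)‖) 0 1 with hG
  have hpt : ∀ τ ∈ Ioc T (2*T), κ * ∑ ρ ∈ Z, (Icc (ρ.im-1) (ρ.im+1)).indicator (fun _ => (1:ℝ)) τ ≤ G τ + K0 := by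
    intro τ hτ
    classical
    have hl' := hl τ hτ.1.le hτ.2
    have hj := jens_tau hRT hA hAR hd hRd hB hf hτ.1.le hl'.1 hl'.2 (Z.filter fun ρ => τ ∈ Icc (ρ.im-1) (ρ.im+1)) (by
      intro ρ hρ
      obtain ⟨hρ1, hρ2⟩ := Finset.mem_filter.1 hρ
      obtain ⟨a1, a2, a3, a4, a5⟩ := hZ ρ hρ1
      refine ⟨a1, a2, a3, ?_⟩
      rw [abs_le]; constructor <;> linarith [hρ2.1, hρ2.2])
    have hc : ∑ ρ ∈ Z, (Icc (ρ.im-1) (ρ.im+1)).indicator (fun _ => (1:ℝ)) τ = ((Z.filter fun ρ => τ ∈ Icc (ρ.im-1) (ρ.im+1)).card : ℝ) := by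
      rw [Finset.card_filter]; push_cast
      refine Finset.sum_congr rfl fun ρ _ => ?_
      rw [indicator_apply]
    have hj' : ((Z.filter fun ρ => τ ∈ Icc (ρ.im-1) (ρ.im+1)).card : ℝ) * κ - K0 ≤ G τ := hj
    rw [hc, mul_comm]
    linarith
  have hii : ∀ ρ : ℂ, IntegrableOn (fun τ => (Icc (ρ.im-1) (ρ.im+1)).indicator (fun _ => (1:ℝ)) τ) (Ioc T (2*T)) := by
    intro ρ
    exact (integrable_const (1:ℝ)).indicator measurableSet_Icc
  have h1 : ∫ τ in Ioc T (2*T), κ * ∑ ρ ∈ Z, (Icc (ρ.im-1) (ρ.im+1)).indicator (fun _ => (1:ℝ)) τ ≤ ∫ τ in Ioc T (2*T), (G τ + K0) := by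
    refine setIntegral_mono_on ?_ (i1.add (integrable_const _)) measurableSet_Ioc hpt
    exact (integrable_finsetSum _ fun ρ _ => hii ρ).const_mul _
  rw [integral_const_mul, integral_finsetSum _ (fun ρ _ => hii ρ), integral_add i1 (integrable_const _), setIntegral_const, smul_eq_mul,
    Real.volume_real_Ioc_of_le (by linarith)] at h1
  have h2 : (Z.card : ℝ) ≤ ∑ ρ ∈ Z, ∫ τ in Ioc T (2*T), (Icc (ρ.im-1) (ρ.im+1)).indicator (fun _ => (1:ℝ)) τ := by
    have := Finset.card_nsmul_le_sum Z (fun ρ => ∫ τ in Ioc T (2*T), (Icc (ρ.im-1) (ρ.im+1)).indicator (fun _ => (1:ℝ)) τ) 1 (fun ρ hρ => by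
      obtain ⟨a1, a2, a3, a4, a5⟩ := hZ ρ hρ
      exact window hT a4 a5)
    simpa using this
  nlinarith
end ZA

open Complex MeasureTheory Set Filter Topology
namespace ZA

lemma final_count {f : ℂ → ℂ} {t0 M A η : ℝ} (hM : 0 ≤ M) (hA : 0 < A) (hη : 0 < η)
    (hf : ∀ s : ℂ, 1/2 ≤ s.re → t0 ≤ s.im → AnalyticAt ℂ f s)
    (hb : ∀ s : ℂ, 1/2 ≤ s.re → t0 ≤ s.im → ‖f s‖ ≤ ‖riemannZeta s‖ + M)
    (hl : ∀ s : ℂ, 1/2 + A ≤ s.re → t0 ≤ s.im → f s ≠ 0)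
    (hηf : ∀ s : ℂ, s.re = 1/2 + A → t0 ≤ s.im → η ≤ ‖f s‖) :
    ∃ C : ℝ, 1 ≤ C ∧ ∃ T₀ : ℝ, 16 ≤ T₀ ∧ ∀ T : ℝ, T₀ ≤ T → 24 ≤ Real.log T ∧ 2 ≤ Real.log (Real.log T) ∧
      ∀ d : ℝ, 0 < d → 2 ≤ Real.log T * d → ∀ Z : Finset ℂ,
        (∀ ρ ∈ Z, f ρ = 0 ∧ 1/2 + d ≤ ρ.re ∧ T < ρ.im ∧ ρ.im ≤ 2*T) →
        (Z.card : ℝ) ≤ C * T * √(Real.log (Real.log T)) / d := by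
  obtain ⟨C, hC, T₁, hT₁, h1⟩ := f_log M hM
  set K0 := |Real.log η| with hK0
  have hK00 : 0 ≤ K0 := abs_nonneg _
  set κ := A / ((A+A)^2+1) with hκ
  have hκ0 : 0 < κ := by positivity
  obtain ⟨T₂, hT₂⟩ := (Real.tendsto_log_atTop.eventually_ge_atTop (2*A)).exists_forall_of_atTop
  refine ⟨1 + 2 * (C + K0) / κ, ?_, max T₁ (max T₂ (2*|t0|)), le_trans hT₁ (le_max_left _ _), ?_⟩
  · have : 0 ≤ 2 * (C + K0) / κ := by positivity
    linarith
  intro T hT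
  have hTa : T₁ ≤ T := le_trans (le_max_left _ _) hT
  have hTb : T₂ ≤ T := le_trans (le_trans (le_max_left _ _) (le_max_right _ _)) hT
  have hTc : 2*|t0| ≤ T := le_trans (le_trans (le_max_right _ _) (le_max_right _ _)) hT
  have ht0 : t0 ≤ T/2 := by linarith [le_abs_self t0]
  obtain ⟨hL, hLL, hlog⟩ := h1 T hTa
  refine ⟨hL, hLL, ?_⟩
  intro d hd hLd Z hZ
  have hT0 : 0 < T := by linarith
  have hlT : Real.log T ≤ T/2 := by
    have := Real.log_le_sub_one_of_pos (by linarith : 0 < T/2)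
    rw [Real.log_div hT0.ne' (by norm_num)] at this
    have h2 := Real.log_two_lt_d9
    linarith
  have hRA := hT₂ T hTb
  have hfT : ∀ s : ℂ, 1/2 ≤ s.re → T/2 ≤ s.im → AnalyticAt ℂ f s := fun s h1 h2 => hf s h1 (by linarith)
  have hQ := hlog f (fun s h1 h2 => (hfT s h1 h2).continuousAt) (fun s h1 h2 => hb s h1 (by linarith))
  have hcount := count (f := f) (T := T) (R := Real.log T) (A := A) (B := A) (d := d) (K0 := K0) (by linarith) hlT hA (by linarith) hd hLd (by linarith) hfT
    (fun τ h1 h2 => by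
      refine ⟨hl _ (by rw [re_mk']) (by rw [im_mk']; linarith), ?_⟩
      have h3 := hηf (((1/2 + A : ℝ):ℂ) + τ * I) (by rw [re_mk']) (by rw [im_mk']; linarith)
      have h4 := Real.log_le_log hη h3
      have h5 := neg_abs_le (Real.log η)
      linarith)
    hQ Z (fun ρ hρ => by
      obtain ⟨a1, a2, a3, a4⟩ := hZ ρ hρ
      refine ⟨a1, a2, ?_, a3, a4⟩
      by_contra hcon
      push Not at hcon
      exact hl ρ hcon.le (by linarith) a1)
  rw [← hκ] at hcount
  set S := √(Real.log (Real.log T)) with hS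
  have hS1 : 1 ≤ S := by rw [hS, Real.one_le_sqrt]; linarith
  rw [le_div_iff₀ hd]
  have e1 : (Z.card : ℝ) * d * κ ≤ 2 * (C + K0) * (T * S) := by
    have : K0 * T ≤ K0 * T * S := le_mul_of_one_le_right (by positivity) hS1
    nlinarith
  have e2 : (Z.card : ℝ) * d ≤ 2 * (C + K0) * (T * S) / κ := by rw [le_div_iff₀ hκ0]; exact e1
  have e3 : 2 * (C + K0) * (T * S) / κ = 2 * (C + K0) / κ * T * S := by ring
  have e4 : 0 ≤ T * S := by positivity
  nlinarith

lemma pow_small {b ε : ℝ} (hb0 : 0 < b) (hb1 : b < 1) (hε : 0 < ε) : ∃ A : ℝ, 2 ≤ A ∧ ∀ x : ℝ, A ≤ x → b^x ≤ ε := by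
  have h := tendsto_rpow_atTop_of_base_lt_one b (by linarith) hb1
  obtain ⟨A, hA⟩ := (h.eventually (ge_mem_nhds hε)).exists_forall_of_atTop
  exact ⟨max A 2, le_max_right _ _, fun x hx => hA x (le_trans (le_max_left _ _) hx)⟩

lemma two_cpow_norm (s : ℂ) : ‖(2:ℂ)^(-s)‖ = (1/2:ℝ)^s.re := by
  rw [show (2:ℂ) = ((2:ℝ):ℂ) by norm_num, norm_cpow_eq_rpow_re_of_pos (by norm_num), neg_re, Real.rpow_neg (by norm_num),
    ← Real.inv_rpow (by norm_num)]
  norm_num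

lemma zeta_sub_one : ∃ C : ℝ, 1 ≤ C ∧ ∀ s : ℂ, 2 ≤ s.re →
    ‖riemannZeta s - 1‖ ≤ C * (1/2:ℝ)^s.re ∧ (1/2:ℝ)^s.re * (1 - C * (2/3:ℝ)^s.re) ≤ ‖riemannZeta s - 1‖ := by
  obtain ⟨C, hC, h⟩ := zeta_large
  refine ⟨C + 1, by linarith, fun s hs => ?_⟩
  have h1 := h s hs
  have h2 := two_cpow_norm s
  have e1 : (3:ℝ)^(-s.re) = (1/2:ℝ)^s.re * (2/3:ℝ)^s.re := by
    rw [← Real.mul_rpow (by norm_num) (by norm_num), Real.rpow_neg (by norm_num), ← Real.inv_rpow (by norm_num)]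
    norm_num
  have e2 : (2/3:ℝ)^s.re ≤ 1 := Real.rpow_le_one (by norm_num) (by norm_num) (by linarith)
  have p1 : 0 < (1/2:ℝ)^s.re := by positivity
  have p2 : 0 < (2/3:ℝ)^s.re := by positivity
  rw [e1] at h1
  have t1 : ‖riemannZeta s - 1‖ ≤ ‖riemannZeta s - 1 - (2:ℂ)^(-s)‖ + ‖(2:ℂ)^(-s)‖ := norm_le_norm_sub_add _ _
  have t2 : ‖(2:ℂ)^(-s)‖ ≤ ‖riemannZeta s - 1 - (2:ℂ)^(-s)‖ + ‖riemannZeta s - 1‖ := by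
    have := norm_le_norm_sub_add ((2:ℂ)^(-s)) (riemannZeta s - 1)
    rwa [norm_sub_rev] at this
  rw [h2] at t1 t2
  have q := mul_pos p1 p2
  constructor
  · have : (1/2:ℝ)^s.re * (2/3:ℝ)^s.re ≤ (1/2:ℝ)^s.re := mul_le_of_le_one_right p1.le e2
    nlinarith
  · nlinarith

lemma line_low (a : ℂ) : ∃ A : ℝ, 2 ≤ A ∧ ∀ s : ℂ, A ≤ s.re → riemannZeta s - a ≠ 0 ∧
    ∃ η : ℝ, 0 < η ∧ ∀ w : ℂ, w.re = s.re → η ≤ ‖riemannZeta w - a‖ := by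
  obtain ⟨C, hC, h⟩ := zeta_sub_one
  suffices H : ∃ A : ℝ, 2 ≤ A ∧ ∃ η : ℝ → ℝ, ∀ s : ℂ, A ≤ s.re → 0 < η s.re ∧ η s.re ≤ ‖riemannZeta s - a‖ by
    obtain ⟨A, hA, η, hη⟩ := H
    refine ⟨A, hA, fun s hs => ⟨?_, η s.re, (hη s hs).1, fun w hw => ?_⟩⟩
    · have := hη s hs
      exact norm_pos_iff.1 (by linarith)
    · have := (hη w (by rw [hw]; exact hs)).2
      rwa [hw] at this
  by_cases ha : a = 1
  · obtain ⟨A, hA, hA'⟩ := pow_small (b := 2/3) (ε := 1/(2*C)) (by norm_num) (by norm_num) (by positivity)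
    refine ⟨A, hA, fun x => (1/2:ℝ)^x * (1/2), fun s hs => ⟨by positivity, ?_⟩⟩
    rw [ha]
    refine le_trans ?_ (h s (by linarith)).2
    have h1 := hA' s.re hs
    have : C * (2/3:ℝ)^s.re ≤ 1/2 := by
      calc C * (2/3:ℝ)^s.re ≤ C * (1/(2*C)) := by gcongr
        _ = 1/2 := by field_simp
    refine mul_le_mul_of_nonneg_left ?_ (by positivity)
    linarith
  · have he : 0 < ‖1 - a‖ := norm_pos_iff.2 (sub_ne_zero.2 (Ne.symm ha))
    obtain ⟨A, hA, hA'⟩ := pow_small (b := 1/2) (ε := ‖1-a‖/(2*C)) (by norm_num) (by norm_num) (by positivity)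
    refine ⟨A, hA, fun x => ‖1-a‖/2, fun s hs => ⟨by positivity, ?_⟩⟩
    have h1 := (h s (by linarith)).1
    have h2 : C * (1/2:ℝ)^s.re ≤ ‖1-a‖/2 := by
      calc C * (1/2:ℝ)^s.re ≤ C * (‖1-a‖/(2*C)) := by gcongr; exact hA' s.re hs
        _ = _ := by field_simp
    have h3 : ‖1 - a‖ ≤ ‖riemannZeta s - a‖ + ‖riemannZeta s - 1‖ := by
      have := norm_sub_le (riemannZeta s - a) (riemannZeta s - 1)
      rwa [show riemannZeta s - a - (riemannZeta s - 1) = 1 - a by ring] at this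
    linarith

lemma an_upper {f : ℂ → ℂ} (h : ∀ s : ℂ, 0 < s.im → DifferentiableAt ℂ f s) {s : ℂ} (hs : 0 < s.im) : AnalyticAt ℂ f s :=
  DifferentiableOn.analyticAt (s := {s : ℂ | 0 < s.im}) (fun z hz => (h z hz).differentiableWithinAt)
    ((isOpen_lt continuous_const continuous_im).mem_nhds hs)

lemma im_ne_one {s : ℂ} (hs : 0 < s.im) : s ≠ 1 := by
  intro h; rw [h] at hs; simp at hs

lemma right_count (a : ℂ) : ∃ C : ℝ, 1 ≤ C ∧ ∃ T₀ : ℝ, 16 ≤ T₀ ∧ ∀ T : ℝ, T₀ ≤ T → 24 ≤ Real.log T ∧ 2 ≤ Real.log (Real.log T) ∧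
      ∀ d : ℝ, 0 < d → 2 ≤ Real.log T * d → ∀ Z : Finset ℂ,
        (∀ ρ ∈ Z, riemannZeta ρ = a ∧ 1/2 + d ≤ ρ.re ∧ T < ρ.im ∧ ρ.im ≤ 2*T) →
        (Z.card : ℝ) ≤ C * T * √(Real.log (Real.log T)) / d := by
  obtain ⟨A, hA, h⟩ := line_low a
  obtain ⟨η, hη, hη'⟩ := (h ((1/2 + A : ℝ):ℂ) (by rw [ofReal_re]; linarith)).2
  obtain ⟨C, hC, T₀, hT₀, H⟩ := final_count (f := fun s => riemannZeta s - a) (t0 := 1) (M := ‖a‖) (A := A) (η := η) (norm_nonneg _) (by linarith) hη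
    (fun s _ h2 => an_upper (fun z hz => (differentiableAt_riemannZeta (im_ne_one hz)).sub_const a) (by linarith))
    (fun s _ _ => norm_sub_le _ _)
    (fun s h1 _ => (h s (by linarith)).1)
    (fun s h1 _ => hη' s (by rw [h1, ofReal_re]))
  refine ⟨C, hC, T₀, hT₀, fun T hT => ?_⟩
  obtain ⟨b1, b2, b3⟩ := H T hT
  refine ⟨b1, b2, fun d hd hLd Z hZ => b3 d hd hLd Z fun ρ hρ => ?_⟩
  obtain ⟨c1, c2⟩ := hZ ρ hρ
  exact ⟨sub_eq_zero.2 c1, c2⟩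

lemma left_count (b : ℂ) : ∃ C : ℝ, 1 ≤ C ∧ ∃ T₀ : ℝ, 16 ≤ T₀ ∧ ∀ T : ℝ, T₀ ≤ T → 24 ≤ Real.log T ∧ 2 ≤ Real.log (Real.log T) ∧
      ∀ d : ℝ, 0 < d → 2 ≤ Real.log T * d → ∀ Z : Finset ℂ,
        (∀ w ∈ Z, riemannZeta (1 - w) = b ∧ 1/2 + d ≤ w.re ∧ T < w.im ∧ w.im ≤ 2*T) →
        (Z.card : ℝ) ≤ C * T * √(Real.log (Real.log T)) / d := by
  obtain ⟨C1, hC1, h1⟩ := XX_one_sub_bd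
  obtain ⟨C2, hC2, h2⟩ := zeta_sub_one
  obtain ⟨A, hA, hA'⟩ := pow_small (b := 1/2) (ε := 1/(2*C2)) (by norm_num) (by norm_num) (by positivity)
  have hpi := Real.pi_pos
  set t0 := 2 * Real.pi + 4 * (‖b‖ * C1) with ht0
  have hbC : 0 ≤ ‖b‖ * C1 := by positivity
  have ht0p : 0 < t0 := by positivity
  have hlow : ∀ s : ℂ, 1/2 + A ≤ s.re → t0 ≤ s.im → 1/4 ≤ ‖riemannZeta s - b * XX (1 - s)‖ := by
    intro s hs hsi
    have hsp : 0 < s.im := by linarith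
    have e1 := (h2 s (by linarith)).1
    have e2 : C2 * (1/2:ℝ)^s.re ≤ 1/2 := by
      calc C2 * (1/2:ℝ)^s.re ≤ C2 * (1/(2*C2)) := by gcongr; exact hA' s.re (by linarith)
        _ = _ := by field_simp
    have e3 := (h1 s (by linarith) (by rw [abs_of_pos hsp]; linarith)).2 (by linarith)
    rw [abs_of_pos hsp] at e3
    have e4 : ‖b * XX (1-s)‖ ≤ 1/4 := by
      rw [norm_mul]
      calc ‖b‖ * ‖XX (1-s)‖ ≤ ‖b‖ * (C1 / s.im) := by gcongr
        _ = (‖b‖ * C1) / s.im := by ring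
        _ ≤ 1/4 := by rw [div_le_iff₀ hsp]; linarith
    have e5 : ‖(1:ℂ)‖ ≤ ‖riemannZeta s - b * XX (1-s)‖ + ‖b * XX (1-s)‖ + ‖riemannZeta s - 1‖ := by
      have q1 := norm_sub_le (riemannZeta s - b * XX (1-s) + b * XX (1-s)) (riemannZeta s - 1)
      have q2 := norm_add_le (riemannZeta s - b * XX (1-s)) (b * XX (1-s))
      rw [show riemannZeta s - b * XX (1-s) + b * XX (1-s) - (riemannZeta s - 1) = 1 by ring] at q1
      linarith
    rw [norm_one] at e5
    linarith
  obtain ⟨C, hC, T₀, hT₀, H⟩ := final_count (f := fun s => riemannZeta s - b * XX (1 - s)) (t0 := t0) (M := ‖b‖ * C1) (A := A) (η := 1/4) hbC (by linarith) (by norm_num)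
    (fun s _ h2 => an_upper (fun z hz => (differentiableAt_riemannZeta (im_ne_one hz)).sub
      ((DifferentiableAt.comp z (XX_diff (s := 1 - z) (by simp; linarith)) (by fun_prop)).const_mul b)) (by linarith))
    (fun s hs hsi => by
      refine (norm_sub_le _ _).trans ?_
      rw [norm_mul]
      have hsp : 0 < s.im := by linarith
      have := (h1 s hs (by rw [abs_of_pos hsp]; linarith)).1
      gcongr)
    (fun s h1 h2 => norm_pos_iff.1 (by linarith [hlow s h1 h2]))
    (fun s h1 h2 => hlow s h1.ge h2)
  refine ⟨C, hC, T₀, hT₀, fun T hT => ?_⟩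
  obtain ⟨b1, b2, b3⟩ := H T hT
  refine ⟨b1, b2, fun d hd hLd Z hZ => b3 d hd hLd Z fun w hw => ?_⟩
  obtain ⟨c1, c2, c3, c4⟩ := hZ w hw
  refine ⟨?_, c2, c3, c4⟩
  have := zeta_fe (s := 1 - w) (by simp; linarith)
  rw [sub_sub_cancel, c1] at this
  rw [this]; ring

lemma fin_of_card {α : Type*} {S : Set α} {M : ℝ} (h : ∀ F : Finset α, (F : Set α) ⊆ S → (F.card : ℝ) ≤ M) :
    S.Finite ∧ (S.ncard : ℝ) ≤ M := by
  have hfin : S.Finite := by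
    by_contra hinf
    obtain ⟨F, hF, hc⟩ := Set.Infinite.exists_subset_card_eq hinf (⌊M⌋₊ + 1)
    have := h F hF
    rw [hc] at this
    have h2 := Nat.lt_floor_add_one M
    push_cast at this
    linarith
  refine ⟨hfin, ?_⟩
  rw [Set.ncard_eq_toFinset_card S hfin]
  exact h _ (by simp)

lemma main (a : ℂ) (μ : ℝ → ℝ) (hμ : Tendsto μ atTop atTop) :
    ∃ C > (0 : ℝ), ∃ T₀ : ℝ, 16 ≤ T₀ ∧ ∀ T : ℝ, T₀ ≤ T → 
      ∀ F : Finset ℂ, (F : Set ℂ) ⊆ {ρ : ℂ | riemannZeta ρ = a ∧ T < ρ.im ∧ ρ.im ≤ 2 * T ∧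
        μ T * Real.sqrt (Real.log (Real.log T)) / Real.log T ≤ |ρ.re - 1 / 2|} → (F.card : ℝ) ≤ C * T * Real.log T / μ T := by
  obtain ⟨C1, hC1, T₁, hT₁, h1⟩ := right_count a
  obtain ⟨C2, hC2, T₂, hT₂, h2⟩ := left_count ((starRingEnd ℂ) a)
  obtain ⟨T₃, hT₃⟩ := (hμ.eventually_ge_atTop 2).exists_forall_of_atTop
  refine ⟨C1 + C2, by linarith, max T₁ (max T₂ T₃), le_trans hT₁ (le_max_left _ _), ?_⟩
  intro T hT F hF
  have hTa : T₁ ≤ T := le_trans (le_max_left _ _) hT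
  have hTb : T₂ ≤ T := le_trans (le_trans (le_max_left _ _) (le_max_right _ _)) hT
  have hTc : T₃ ≤ T := le_trans (le_trans (le_max_right _ _) (le_max_right _ _)) hT
  have hm2 := hT₃ T hTc
  obtain ⟨hL, hLL, h1'⟩ := h1 T hTa
  obtain ⟨-, -, h2'⟩ := h2 T hTb
  have hT0 : 0 < T := by linarith
  set L := Real.log T with hLd
  set S := √(Real.log L) with hS
  have hS1 : 1 ≤ S := by rw [hS, Real.one_le_sqrt]; linarith
  set d := μ T * S / L with hd
  have hL0 : 0 < L := by linarith
  have hd0 : 0 < d := by positivity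
  have hLd2 : 2 ≤ L * d := by
    have : L * d = μ T * S := by rw [hd]; field_simp
    rw [this]; nlinarith
  classical
  have hright := h1' d hd0 hLd2 (F.filter fun ρ => 0 ≤ ρ.re - 1/2) (by
    intro ρ hρ
    obtain ⟨q1, q2⟩ := Finset.mem_filter.1 hρ
    obtain ⟨c1, c2, c3, c4⟩ := hF q1
    rw [abs_of_nonneg q2] at c4
    exact ⟨c1, by linarith, c2, c3⟩)
  have hinj : Function.Injective (fun ρ : ℂ => 1 - (starRingEnd ℂ) ρ) := by
    intro x y hxy
    exact (starRingEnd ℂ).injective (sub_right_injective hxy)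
  have hleft := h2' d hd0 hLd2 ((F.filter fun ρ => ¬ 0 ≤ ρ.re - 1/2).image (fun ρ : ℂ => 1 - (starRingEnd ℂ) ρ)) (by
    intro w hw
    obtain ⟨ρ, hρ, rfl⟩ := Finset.mem_image.1 hw
    obtain ⟨q1, q2⟩ := Finset.mem_filter.1 hρ
    obtain ⟨c1, c2, c3, c4⟩ := hF q1
    push Not at q2
    rw [abs_of_neg q2] at c4
    refine ⟨?_, ?_, ?_, ?_⟩
    · rw [sub_sub_cancel, riemannZeta_conj, c1]
    · simp; linarith
    · simp; exact c2
    · simp; exact c3)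
  rw [Finset.card_image_of_injective _ hinj] at hleft
  have hcard := Finset.card_filter_add_card_filter_not (s := F) (fun ρ : ℂ => 0 ≤ ρ.re - 1/2)
  have hcard' : (F.card : ℝ) = ((F.filter fun ρ => 0 ≤ ρ.re - 1/2).card : ℝ) + ((F.filter fun ρ => ¬ 0 ≤ ρ.re - 1/2).card : ℝ) := by
    exact_mod_cast hcard.symm
  rw [hcard']
  have e : (C1 + C2) * T * L / μ T = C1 * T * S / d + C2 * T * S / d := by
    have : 0 < μ T := by linarith
    rw [hd]; field_simp
  rw [e]
  exact add_le_add hright hleft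
end ZA


open Complex Filter Set Topology

theorem stmt15
    (a : ℂ) (μ : ℝ → ℝ) (hμpos : ∀ T : ℝ, 2 ≤ T → 0 < μ T)
    (hμ : Tendsto μ atTop atTop) :
    ∃ C > (0 : ℝ), ∃ T₀ : ℝ, 16 ≤ T₀ ∧ ∀ T : ℝ, T₀ ≤ T →
      ({ρ : ℂ | riemannZeta ρ = a ∧ T < ρ.im ∧ ρ.im ≤ 2 * T ∧
        μ T * Real.sqrt (Real.log (Real.log T)) / Real.log T ≤ |ρ.re - 1 / 2|}).Finite ∧
      (({ρ : ℂ | riemannZeta ρ = a ∧ T < ρ.im ∧ ρ.im ≤ 2 * T ∧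
        μ T * Real.sqrt (Real.log (Real.log T)) / Real.log T ≤ |ρ.re - 1 / 2|}).ncard : ℝ) ≤
        C * T * Real.log T / μ T := by
  obtain ⟨C, hC, T₀, hT₀, h⟩ := ZA.main a μ hμ
  exact ⟨C, hC, T₀, hT₀, fun T hT => ZA.fin_of_card (h T hT)⟩
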